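/- If S ⊆ Sym TT_n is finite, then K_S = ∅ if and only if −1 ∈ T_S^tr. -/

import Mathlib

noncomputable section

open Matrix

/-- The polynomial ring ℝ[ξ] in the g·n² commuting variables ξ_{jıȷ}. -/
abbrev PolyRing (n g : ℕ) : Type := MvPolynomial (Fin g × Fin n × Fin n) ℝ

/-- n×n matrices over ℝ[ξ]. -/
abbrev MatP (n g : ℕ) : Type := Matrix (Fin n) (Fin n) (PolyRing n g)

/-- The generic matrices Ξ_j = (ξ_{jıȷ})_{ıȷ}. -/
def genMat (n g : ℕ) (j : Fin g) : MatP n g :=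
  Matrix.of fun a b => MvPolynomial.X (j, a, b)

/-- The set of generic matrices together with their transposes. -/
def genSet (n g : ℕ) : Set (MatP n g) :=
  Set.range (genMat n g) ∪ Set.range (fun j => (genMat n g j)ᵀ)

/-- The trace ring TT_n: the ℝ-subalgebra of M_n(ℝ[ξ]) generated by the Ξ_j, their
transposes, and the scalar matrices tr(w)·1 for all products w of the Ξ_j, Ξ_jᵀ. -/
def traceRing (n g : ℕ) : Subalgebra ℝ (MatP n g) :=
  Algebra.adjoin ℝ
    (genSet n g ∪
      {m | ∃ w ∈ Submonoid.closure (genSet n g), m = (Matrix.trace w) • (1 : MatP n g)})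

/-- The center C_n of the trace ring: the scalar matrices in TT_n. -/
def centerSet (n g : ℕ) : Set (MatP n g) :=
  {c | c ∈ traceRing n g ∧ ∃ p : PolyRing n g, c = p • (1 : MatP n g)}

/-- Evaluation of a matrix of polynomials at a g-tuple X of n×n real matrices. -/
def evalMat (n g : ℕ) (X : Fin g → Matrix (Fin n) (Fin n) ℝ) (h : MatP n g) :
    Matrix (Fin n) (Fin n) ℝ :=
  h.map (MvPolynomial.eval fun v => X v.1 v.2.1 v.2.2)

/-- The semialgebraic set K_S determined by S. -/
def KSet (n g : ℕ) (S : Set (MatP n g)) : Set (Fin g → Matrix (Fin n) (Fin n) ℝ) :=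
  {X | ∀ s ∈ S, (evalMat n g X s).PosSemidef}

/-- Cyclic quadratic module in Sym TT_n. -/
def IsCyclicQM (n g : ℕ) (Q : Set (MatP n g)) : Prop :=
  (∀ q ∈ Q, q ∈ traceRing n g ∧ qᵀ = q) ∧
  (1 : MatP n g) ∈ Q ∧
  (∀ a ∈ Q, ∀ b ∈ Q, a + b ∈ Q) ∧
  (∀ h ∈ traceRing n g, ∀ q ∈ Q, h * q * hᵀ ∈ Q) ∧
  (∀ q ∈ Q, (Matrix.trace q) • (1 : MatP n g) ∈ Q)

/-- Cyclic preordering: a cyclic quadratic module whose intersection with the center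
is closed under multiplication. -/
def IsCyclicPreordering (n g : ℕ) (T : Set (MatP n g)) : Prop :=
  IsCyclicQM n g T ∧
  ∀ a ∈ T ∩ centerSet n g, ∀ b ∈ T ∩ centerSet n g, a * b ∈ T

/-- The smallest cyclic preordering T_S^tr containing S. -/
def TtrS (n g : ℕ) (S : Set (MatP n g)) : Set (MatP n g) :=
  {a | ∀ T : Set (MatP n g), IsCyclicPreordering n g T → S ⊆ T → a ∈ T}

set_option linter.unusedSectionVars false

namespace TracePos

section Precone

/-- A preordering of a commutative ring, given by its underlying set. -/
structure IsPrecone {C : Type*} [CommRing C] (T : Set C) : Prop where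
  add : ∀ a ∈ T, ∀ b ∈ T, a + b ∈ T
  mul : ∀ a ∈ T, ∀ b ∈ T, a * b ∈ T
  sq : ∀ a, a * a ∈ T
  neg_one : (-1 : C) ∉ T

variable {C : Type*} [CommRing C] {T : Set C}

lemma IsPrecone.zero (hT : IsPrecone T) : (0 : C) ∈ T := by simpa using hT.sq 0

lemma IsPrecone.one (hT : IsPrecone T) : (1 : C) ∈ T := by simpa using hT.sq 1

lemma IsPrecone.exists_maximal (hT : IsPrecone T) :
    ∃ P : Set C, T ⊆ P ∧ IsPrecone P ∧ ∀ x ∉ P, ∃ p ∈ P, ∃ q ∈ P, p + x * q = -1 := by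
  obtain ⟨P, hTP, hP⟩ := zorn_subset_nonempty {P : Set C | IsPrecone P}
    (by
      intro c hc hchain hne
      refine ⟨⋃₀ c, ⟨?_, ?_, ?_, ?_⟩, fun s hs => Set.subset_sUnion_of_mem hs⟩
      · rintro a ⟨s, hs, ha⟩ b ⟨t, ht, hb⟩
        rcases hchain.total hs ht with h | h
        · exact ⟨t, ht, (hc ht).add _ (h ha) _ hb⟩
        · exact ⟨s, hs, (hc hs).add _ ha _ (h hb)⟩
      · rintro a ⟨s, hs, ha⟩ b ⟨t, ht, hb⟩
        rcases hchain.total hs ht with h | h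
        · exact ⟨t, ht, (hc ht).mul _ (h ha) _ hb⟩
        · exact ⟨s, hs, (hc hs).mul _ ha _ (h hb)⟩
      · intro a
        obtain ⟨s, hs⟩ := hne
        exact ⟨s, hs, (hc hs).sq a⟩
      · rintro ⟨s, hs, h⟩
        exact (hc hs).neg_one h) T hT
  have hPc : IsPrecone P := hP.prop
  refine ⟨P, hTP, hPc, fun x hx => ?_⟩
  by_contra hcon
  push Not at hcon
  let P' : Set C := {y | ∃ p ∈ P, ∃ q ∈ P, p + x * q = y}
  have hP' : IsPrecone P' := by
    refine ⟨?_, ?_, ?_, ?_⟩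
    · rintro _ ⟨p, hp, q, hq, rfl⟩ _ ⟨p', hp', q', hq', rfl⟩
      exact ⟨p + p', hPc.add _ hp _ hp', q + q', hPc.add _ hq _ hq', by ring⟩
    · rintro _ ⟨p, hp, q, hq, rfl⟩ _ ⟨p', hp', q', hq', rfl⟩
      exact ⟨p * p' + (x * x) * (q * q'),
        hPc.add _ (hPc.mul _ hp _ hp') _ (hPc.mul _ (hPc.sq x) _ (hPc.mul _ hq _ hq')),
        p * q' + q * p', hPc.add _ (hPc.mul _ hp _ hq') _ (hPc.mul _ hq _ hp'), by ring⟩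
    · intro a
      exact ⟨a * a, hPc.sq a, 0, hPc.zero, by ring⟩
    · rintro ⟨p, hp, q, hq, h⟩
      exact hcon p hp q hq h
  have hle : P ⊆ P' := fun p hp => ⟨p, hp, 0, hPc.zero, by ring⟩
  exact hx (hP.le_of_ge hP' hle ⟨0, hPc.zero, 1, hPc.one, by ring⟩)

lemma exists_prime_ordering (hT : IsPrecone T) :
    ∃ (P : Set C) (I : Ideal C), T ⊆ P ∧ IsPrecone P ∧ I.IsPrime ∧
      (∀ x, x ∈ I ↔ x ∈ P ∧ -x ∈ P) := by
  obtain ⟨P, hTP, hP, hmax⟩ := hT.exists_maximal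
  have htot : ∀ a, a ∈ P ∨ -a ∈ P := by
    intro a
    by_contra! h
    obtain ⟨p, hp, q, hq, h1⟩ := hmax a h.1
    obtain ⟨p', hp', q', hq', h2⟩ := hmax (-a) h.2
    apply hP.neg_one
    have : (-1 : C) = p + p' + p * p' + (a * a) * (q * q') := by
      linear_combination (-1 - p') * h1 + (a * q) * h2
    rw [this]
    exact hP.add _ (hP.add _ (hP.add _ hp _ hp') _ (hP.mul _ hp _ hp')) _
      (hP.mul _ (hP.sq a) _ (hP.mul _ hq _ hq'))
  have hsupp : ∀ c x, x ∈ P → -x ∈ P → c * x ∈ P := by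
    intro c x hx hx'
    rcases htot c with h | h
    · exact hP.mul _ h _ hx
    · have := hP.mul _ h _ hx'
      simpa using this
  let I : Ideal C :=
    { carrier := {x | x ∈ P ∧ -x ∈ P}
      add_mem' := by
        rintro a b ⟨ha, ha'⟩ ⟨hb, hb'⟩
        exact ⟨hP.add _ ha _ hb, by rw [neg_add]; exact hP.add _ ha' _ hb'⟩
      zero_mem' := ⟨hP.zero, by simpa using hP.zero⟩
      smul_mem' := by
        rintro c x ⟨hx, hx'⟩
        refine ⟨hsupp c x hx hx', ?_⟩
        have := hsupp c (-x) hx' (by simpa using hx)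
        simpa using this }
  refine ⟨P, I, hTP, hP, ⟨?_, ?_⟩, fun x => Iff.rfl⟩
  · rw [Ideal.ne_top_iff_one]
    exact fun h => hP.neg_one h.2
  · intro x y hxy
    by_contra! h
    have key : ∀ u v : C, u * v ∈ I → u ∉ P → v ∉ P → False := by
      intro u v huv hu hv
      obtain ⟨p, hp, q, hq, h1⟩ := hmax u hu
      obtain ⟨p', hp', q', hq', h2⟩ := hmax v hv
      apply hP.neg_one
      have h3 : -((q * q') * (u * v)) ∈ P := (I.mul_mem_left (q * q') huv).2
      have : (-1 : C) = p + p' + p * p' + -((q * q') * (u * v)) := by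
        linear_combination (-1 - p') * h1 + (u * q) * h2
      rw [this]
      exact hP.add _ (hP.add _ (hP.add _ hp _ hp') _ (hP.mul _ hp _ hp')) _ h3
    have hx : x ∉ P ∨ -x ∉ P := by
      by_contra! h'
      exact h.1 h'
    have hy : y ∉ P ∨ -y ∉ P := by
      by_contra! h'
      exact h.2 h'
    rcases hx with hx | hx <;> rcases hy with hy | hy
    · exact key _ _ hxy hx hy
    · exact key _ _ (by simpa using I.neg_mem hxy) hx hy
    · exact key _ _ (by simpa using I.neg_mem hxy) hx hy
    · exact key _ _ (by simpa using hxy) hx hy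

end Precone

section RealClosure

open Polynomial IntermediateField

/-- Sums of squares in `L` weighted by elements of `T ⊆ K`. -/
def wcone {K : Type*} [Field K] (T : Set K) (L : Type*) [CommRing L] [Algebra K L] :
    AddSubmonoid L :=
  AddSubmonoid.closure {y | ∃ t ∈ T, ∃ x : L, y = algebraMap K L t * x ^ 2}

variable {K : Type*} [Field K] {T : Set K}

lemma wcone_mem {L : Type*} [CommRing L] [Algebra K L] {t : K} (ht : t ∈ T) (x : L) :
    algebraMap K L t * x ^ 2 ∈ wcone T L :=
  AddSubmonoid.subset_closure ⟨t, ht, x, rfl⟩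

lemma wcone_map {L M : Type*} [CommRing L] [Algebra K L] [CommRing M] [Algebra K M]
    (f : L →ₐ[K] M) {x : L} (hx : x ∈ wcone T L) : f x ∈ wcone T M := by
  induction hx using AddSubmonoid.closure_induction with
  | mem x hx =>
    obtain ⟨t, ht, y, rfl⟩ := hx
    rw [map_mul, map_pow, AlgHom.commutes]
    exact wcone_mem ht _
  | zero => simp
  | add x y _ _ hx hy => rw [map_add]; exact add_mem hx hy

lemma wcone_sq (hT : IsPrecone T) {L : Type*} [CommRing L] [Algebra K L] (x : L) :
    x ^ 2 ∈ wcone T L := by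
  simpa using wcone_mem (L := L) hT.one x

lemma wcone_mul (hT : IsPrecone T) {L : Type*} [CommRing L] [Algebra K L] {x y : L}
    (hx : x ∈ wcone T L) (hy : y ∈ wcone T L) : x * y ∈ wcone T L := by
  induction hx using AddSubmonoid.closure_induction with
  | mem x hx =>
    obtain ⟨t, ht, u, rfl⟩ := hx
    induction hy using AddSubmonoid.closure_induction with
    | mem y hy =>
      obtain ⟨s, hs, v, rfl⟩ := hy
      have : algebraMap K L t * u ^ 2 * (algebraMap K L s * v ^ 2) =
          algebraMap K L (t * s) * (u * v) ^ 2 := by rw [map_mul]; ring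
      rw [this]
      exact wcone_mem (hT.mul _ ht _ hs) _
    | zero => simp
    | add x y _ _ hx hy => rw [mul_add]; exact add_mem hx hy
  | zero => simp
  | add x y _ _ hx hy => rw [add_mul]; exact add_mem hx hy

lemma wcone_self (hT : IsPrecone T) {x : K} (hx : x ∈ wcone T K) : x ∈ T := by
  induction hx using AddSubmonoid.closure_induction with
  | mem x hx =>
    obtain ⟨t, ht, u, rfl⟩ := hx
    rw [pow_two]
    exact hT.mul _ ht _ (hT.sq u)
  | zero => exact hT.zero
  | add x y _ _ hx hy => exact hT.add _ hx _ hy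

/-- An ordered field in which nonnegative elements are squares and which has no proper
algebraic extension that can be ordered. -/
class IsMaxOrdered (R : Type*) [Field R] [LinearOrder R] : Prop where
  sq : ∀ x : R, 0 ≤ x → ∃ y, x = y ^ 2
  irr : ∀ p : R[X], Irreducible p → 2 ≤ p.natDegree →
    ∃ s ∈ AddSubmonoid.closure {q : R[X] | ∃ h : R[X], q = h ^ 2}, p ∣ 1 + s

lemma wcone_iSup {Ω : Type*} [Field Ω] [Algebra K Ω] {c : Set (IntermediateField K Ω)}
    (hc : IsChain (· ≤ ·) c) (hne : c.Nonempty) {x : (sSup c : IntermediateField K Ω)}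
    (hx : x ∈ wcone T (sSup c : IntermediateField K Ω)) :
    ∃ F ∈ c, ∃ y ∈ wcone T F, (y : Ω) = x := by
  have hmem : ∀ z : Ω, z ∈ (sSup c : IntermediateField K Ω) → ∃ F ∈ c, z ∈ F := by
    intro z hz
    have : Nonempty c := hne.to_subtype
    rw [sSup_eq_iSup'] at hz
    have hd : Directed (· ≤ ·) (fun F : c => (F : IntermediateField K Ω)) :=
      hc.directed
    rw [← SetLike.mem_coe, coe_iSup_of_directed hd] at hz
    simpa using hz
  induction hx using AddSubmonoid.closure_induction with
  | mem x hx =>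
    obtain ⟨t, ht, u, rfl⟩ := hx
    obtain ⟨F, hF, hu⟩ := hmem u u.2
    exact ⟨F, hF, _, wcone_mem ht (⟨u, hu⟩ : F), rfl⟩
  | zero =>
    obtain ⟨F, hF⟩ := hne
    exact ⟨F, hF, 0, zero_mem _, rfl⟩
  | add x y _ _ hx hy =>
    obtain ⟨F, hF, a, ha, hax⟩ := hx
    obtain ⟨G, hG, b, hb, hby⟩ := hy
    rcases hc.total hF hG with h | h
    · exact ⟨G, hG, inclusion h a + b, add_mem (wcone_map _ ha) hb, by simp [← hax, ← hby]⟩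
    · exact ⟨F, hF, a + inclusion h b, add_mem ha (wcone_map _ hb), by simp [← hax, ← hby]⟩

lemma exists_maximal_field (hT : IsPrecone T) (Ω : Type*) [Field Ω] [Algebra K Ω] :
    ∃ F : IntermediateField K Ω, (-1 : F) ∉ wcone T F ∧
      ∀ G : IntermediateField K Ω, F ≤ G → (-1 : G) ∉ wcone T G → G ≤ F := by
  obtain ⟨F, -, hF⟩ := zorn_le_nonempty₀ {F : IntermediateField K Ω | (-1 : F) ∉ wcone T F}
    (by
      intro c hc hchain y hy
      refine ⟨sSup c, fun h => ?_, fun z hz => le_sSup hz⟩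
      obtain ⟨F, hF, y, hy, hyx⟩ := wcone_iSup hchain ⟨y, hy⟩ h
      apply hc hF
      have : y = -1 := Subtype.ext (by simpa using hyx)
      rwa [this] at hy) ⊥
    (by
      intro h
      have := wcone_map (botEquiv K Ω).toAlgHom h
      exact hT.neg_one (wcone_self hT (by simpa using this)))
  exact ⟨F, hF.prop, fun G hG hG' => hF.le_of_ge hG' hG⟩

lemma exists_dvd_of_maximal {Ω : Type*} [Field Ω] [Algebra K Ω] {F : IntermediateField K Ω}
    (hF : ∀ G : IntermediateField K Ω, F ≤ G → (-1 : G) ∉ wcone T G → G ≤ F)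
    {p : F[X]} (hp : Irreducible p) {α : Ω} (hα : aeval α p = 0) (hαF : α ∉ F) :
    ∃ s ∈ wcone T F[X], p ∣ 1 + s := by
  let G : IntermediateField K Ω := (F⟮α⟯).restrictScalars K
  have hαG : α ∈ G := mem_adjoin_simple_self F α
  have hFG : F ≤ G := fun x hx => (F⟮α⟯).algebraMap_mem ⟨x, hx⟩
  have hG : (-1 : G) ∈ wcone T G := by
    by_contra h
    exact hαF (hF G hFG h hαG)
  have hint : IsAlgebraic F α := ⟨p, hp.ne_zero, hα⟩
  have hrep : ∀ z : Ω, z ∈ G → ∃ h : F[X], aeval α h = z := by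
    intro z hz
    have hz' : z ∈ (F⟮α⟯).toSubalgebra := hz
    rw [adjoin_simple_toSubalgebra_of_isAlgebraic hint,
      Algebra.adjoin_singleton_eq_range_aeval] at hz'
    exact hz'
  have key : ∀ z : G, z ∈ wcone T G → ∃ s ∈ wcone T F[X], aeval α s = (z : Ω) := by
    intro z hz
    induction hz using AddSubmonoid.closure_induction with
    | mem x hx =>
      obtain ⟨t, ht, u, rfl⟩ := hx
      obtain ⟨h, hh⟩ := hrep u u.2
      refine ⟨_, wcone_mem ht h, ?_⟩
      rw [map_mul, map_pow, hh, IsScalarTower.algebraMap_apply K F F[X]]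
      simp only [Polynomial.algebraMap_apply, Algebra.algebraMap_self, RingHom.id_apply, aeval_C]
      rfl
    | zero => exact ⟨0, zero_mem _, by simp⟩
    | add x y _ _ hx hy =>
      obtain ⟨s, hs, h1⟩ := hx
      obtain ⟨s', hs', h2⟩ := hy
      exact ⟨s + s', add_mem hs hs', by simp [h1, h2]⟩
  obtain ⟨s, hs, h⟩ := key _ hG
  refine ⟨s, hs, ?_⟩
  have h0 : aeval α (1 + s) = 0 := by simp [h]
  have h1 := minpoly.dvd F α h0
  have h2 := minpoly.dvd F α hα
  have h3 : Associated (minpoly F α) p :=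
    (minpoly.irreducible hint.isIntegral).associated_of_dvd hp h2
  exact h3.dvd_iff_dvd_left.mp h1

end RealClosure

section MaximalExtension

open Polynomial IntermediateField
variable {K : Type*} [Field K] {T : Set K}

lemma exists_eq_neg_one_of_dvd {F : Type*} [Field F] [Algebra K F]
    {a : F} {s : F[X]} (hs : s ∈ wcone T F[X])
    (hd : X ^ 2 - C a ∣ 1 + s) :
    ∃ t₁ ∈ wcone T F, ∃ t₂ ∈ wcone T F, t₁ + a * t₂ = -1 := by
  have hmon : (X ^ 2 - C a : F[X]).Monic := monic_X_pow_sub_C a two_ne_zero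
  have hdeg : (X ^ 2 - C a : F[X]).degree = 2 := degree_X_pow_sub_C (by norm_num) a
  have key : ∃ t₁ ∈ wcone T F, ∃ t₂ ∈ wcone T F, ∃ b : F,
      X ^ 2 - C a ∣ s - (C (t₁ + a * t₂) + C b * X) := by
    clear hd
    induction hs using AddSubmonoid.closure_induction with
    | mem x hx =>
      obtain ⟨t, ht, h, rfl⟩ := hx
      set r := h %ₘ (X ^ 2 - C a) with hr
      have hrd : r.degree ≤ 1 := by
        have := degree_modByMonic_lt h hmon
        rw [hdeg] at this
        exact Order.le_of_lt_succ this
      have hre : r = C (r.coeff 1) * X + C (r.coeff 0) := eq_X_add_C_of_degree_le_one hrd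
      have hh : h = r + (X ^ 2 - C a) * (h /ₘ (X ^ 2 - C a)) := (modByMonic_add_div h _).symm
      set u := r.coeff 0
      set v := r.coeff 1
      set q := h /ₘ (X ^ 2 - C a)
      refine ⟨_, wcone_mem ht u, _, wcone_mem ht v, algebraMap K F t * (2 * u * v), ?_⟩
      rw [hh, hre, IsScalarTower.algebraMap_apply K F F[X], Polynomial.algebraMap_eq]
      refine ⟨C (algebraMap K F t) * (C v ^ 2 + 2 * (C v * X + C u) * q
        + (X ^ 2 - C a) * q ^ 2), ?_⟩
      simp only [C_add, C_mul, C_pow, map_ofNat]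
      ring
    | zero => exact ⟨0, zero_mem _, 0, zero_mem _, 0, by simp⟩
    | add x y _ _ hx hy =>
      obtain ⟨t₁, h₁, t₂, h₂, b, hb⟩ := hx
      obtain ⟨t₁', h₁', t₂', h₂', b', hb'⟩ := hy
      refine ⟨t₁ + t₁', add_mem h₁ h₁', t₂ + t₂', add_mem h₂ h₂', b + b', ?_⟩
      convert dvd_add hb hb' using 1
      simp only [C_add, C_mul]
      ring
  obtain ⟨t₁, h₁, t₂, h₂, b, hb⟩ := key
  refine ⟨t₁, h₁, t₂, h₂, ?_⟩
  have h3 : X ^ 2 - C a ∣ C b * X + C (1 + (t₁ + a * t₂)) := by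
    convert dvd_sub hd hb using 1
    simp only [C_add, C_mul, C_1]
    ring
  have h4 : C b * X + C (1 + (t₁ + a * t₂)) = 0 := by
    refine eq_zero_of_dvd_of_degree_lt h3 ?_
    rw [hdeg]
    exact lt_of_le_of_lt degree_linear_le (by norm_num)
  have h5 := congrArg (fun q => coeff q 0) h4
  simp only [coeff_add, coeff_C_mul, coeff_X_zero, mul_zero, zero_add, coeff_C_zero,
    coeff_zero] at h5
  linear_combination h5

lemma exists_linearOrder {F : Type*} [Field F] (h1 : ∀ a : F, IsSquare a ∨ IsSquare (-a))
    (h2 : ∀ a b : F, IsSquare a → IsSquare b → IsSquare (a + b)) (h3 : ¬ IsSquare (-1 : F)) :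
    ∃ (_ : LinearOrder F), IsStrictOrderedRing F ∧ ∀ x : F, 0 ≤ x ↔ IsSquare x := by
  classical
  have hzero : ∀ a : F, IsSquare a → IsSquare (-a) → a = 0 := by
    intro a ha hb
    by_contra h0
    apply h3
    have : (-1 : F) = -a * a⁻¹ := by field_simp
    rw [this]
    exact hb.mul ha.inv
  let lo : LinearOrder F :=
    { le := fun a b => IsSquare (b - a)
      lt := fun a b => IsSquare (b - a) ∧ ¬ IsSquare (a - b)
      le_refl := fun a => by simp
      le_trans := fun a b c hab hbc => by
        have := h2 _ _ hbc hab
        simpa using this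
      le_antisymm := fun a b hab hba => by
        have := hzero _ hab (by simpa using hba)
        exact (sub_eq_zero.mp this).symm
      le_total := fun a b => by
        have := h1 (b - a)
        simpa using this
      toDecidableLE := Classical.decRel _
      lt_iff_le_not_ge := fun a b => Iff.rfl }
  have hle : ∀ a b : F, a ≤ b ↔ IsSquare (b - a) := fun _ _ => Iff.rfl
  refine ⟨lo, ?_, fun x => by rw [hle, sub_zero]⟩
  have : IsOrderedAddMonoid F :=
    { add_le_add_left := fun a b hab c => by rw [hle] at hab ⊢; simpa using hab
      add_le_add_right := fun a b hab c => by rw [hle] at hab ⊢; simpa using hab }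
  have : ZeroLEOneClass F := ⟨by rw [hle]; simp⟩
  have : IsOrderedRing F := .of_mul_nonneg fun x y hx hy => by
    rw [hle, sub_zero] at *
    exact hx.mul hy
  exact IsOrderedRing.toIsStrictOrderedRing F

universe u

theorem exists_isMaxOrdered_of_field {K : Type u} [Field K] {T : Set K} (hT : IsPrecone T) :
    ∃ (R : Type u) (_ : Field R) (_ : LinearOrder R) (_ : IsStrictOrderedRing R)
      (_ : IsMaxOrdered R) (φ : K →+* R), ∀ t ∈ T, 0 ≤ φ t := by
  obtain ⟨F, hF1, hF⟩ := exists_maximal_field hT (AlgebraicClosure K)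
  have hsqc : ∀ a : F, a ∈ wcone T F → ∃ y, a = y ^ 2 := by
    intro a ha
    by_contra hns
    have hirr : Irreducible (X ^ 2 - C a : F[X]) := by
      refine irreducible_of_degree_le_three_of_not_isRoot ?_ ?_
      · rw [natDegree_X_pow_sub_C]; simp
      · intro x hx
        refine hns ⟨x, ?_⟩
        have : x ^ 2 - a = 0 := by simpa [IsRoot.def] using hx
        linear_combination -this
    obtain ⟨α, hα⟩ := IsAlgClosed.exists_aeval_eq_zero (AlgebraicClosure K) (X ^ 2 - C a : F[X])
      (by rw [degree_X_pow_sub_C (by norm_num)]; norm_num)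
    have hαF : α ∉ F := by
      intro h
      refine hns ⟨⟨α, h⟩, ?_⟩
      have h' : α ^ 2 - algebraMap F (AlgebraicClosure K) a = 0 := by simpa using hα
      apply Subtype.ext
      have : (a : AlgebraicClosure K) = α ^ 2 := (sub_eq_zero.mp h').symm
      simpa using this
    obtain ⟨s, hs, hd⟩ := exists_dvd_of_maximal hF hirr hα hαF
    obtain ⟨t₁, h₁, t₂, h₂, h⟩ := exists_eq_neg_one_of_dvd hs hd
    apply hF1
    rw [← h]
    exact add_mem h₁ (wcone_mul hT ha h₂)
  have hneg : ¬ IsSquare (-1 : F) := by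
    rintro ⟨y, hy⟩
    apply hF1
    rw [hy, ← pow_two]
    exact wcone_sq hT y
  have h1 : ∀ a : F, IsSquare a ∨ IsSquare (-a) := by
    intro a
    by_contra! hcon
    obtain ⟨hns, hns'⟩ := hcon
    have hns : ¬ ∃ y, a = y ^ 2 := fun ⟨y, hy⟩ => hns ⟨y, by rw [hy, pow_two]⟩
    have hirr : Irreducible (X ^ 2 - C a : F[X]) := by
      refine irreducible_of_degree_le_three_of_not_isRoot ?_ ?_
      · rw [natDegree_X_pow_sub_C]; simp
      · intro x hx
        refine hns ⟨x, ?_⟩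
        have : x ^ 2 - a = 0 := by simpa [IsRoot.def] using hx
        linear_combination -this
    obtain ⟨α, hα⟩ := IsAlgClosed.exists_aeval_eq_zero (AlgebraicClosure K) (X ^ 2 - C a : F[X])
      (by rw [degree_X_pow_sub_C (by norm_num)]; norm_num)
    have hαF : α ∉ F := by
      intro h
      refine hns ⟨⟨α, h⟩, ?_⟩
      have h' : α ^ 2 - algebraMap F (AlgebraicClosure K) a = 0 := by simpa using hα
      apply Subtype.ext
      have : (a : AlgebraicClosure K) = α ^ 2 := (sub_eq_zero.mp h').symm
      simpa using this
    obtain ⟨s, hs, hd⟩ := exists_dvd_of_maximal hF hirr hα hαF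
    obtain ⟨t₁, h₁, t₂, h₂, h⟩ := exists_eq_neg_one_of_dvd hs hd
    have ht : t₂ ≠ 0 := by
      rintro rfl
      rw [mul_zero, add_zero] at h
      exact hF1 (h ▸ h₁)
    apply hns'
    have hmem : -a ∈ wcone T F := by
      have : -a = (1 ^ 2 + t₁) * t₂ * (t₂⁻¹) ^ 2 := by
        have h' : 1 + t₁ = - a * t₂ := by linear_combination h
        rw [one_pow, h']
        field_simp
      rw [this]
      exact wcone_mul hT (wcone_mul hT (add_mem (wcone_sq hT 1) h₁) h₂) (wcone_sq hT _)
    obtain ⟨y, hy⟩ := hsqc _ hmem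
    exact ⟨y, by rw [hy, pow_two]⟩
  have h2 : ∀ a b : F, IsSquare a → IsSquare b → IsSquare (a + b) := by
    rintro _ _ ⟨a, rfl⟩ ⟨b, rfl⟩
    rw [← pow_two, ← pow_two]
    obtain ⟨y, hy⟩ := hsqc _ (add_mem (wcone_sq hT a) (wcone_sq hT b))
    exact ⟨y, by rw [hy, pow_two]⟩
  obtain ⟨lo, hso, hle⟩ := exists_linearOrder h1 h2 hneg
  have hmax : IsMaxOrdered F :=
    { sq := fun x hx => by
        obtain ⟨y, hy⟩ := (hle x).1 hx
        exact ⟨y, by rw [hy, pow_two]⟩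
      irr := fun p hp hd => by
        obtain ⟨α, hα⟩ := IsAlgClosed.exists_aeval_eq_zero (AlgebraicClosure K) p
          (by rw [degree_eq_natDegree hp.ne_zero]; norm_cast; lia)
        have hαF : α ∉ F := by
          intro h
          have hroot : p.IsRoot ⟨α, h⟩ := by
            rw [IsRoot.def]
            apply (algebraMap F (AlgebraicClosure K)).injective
            rw [map_zero, ← hα, ← Polynomial.aeval_algebraMap_apply_eq_algebraMap_eval]
            rfl
          have h1 := degree_eq_one_of_irreducible_of_root hp hroot
          have h2 : p.natDegree = 1 := natDegree_eq_of_degree_eq_some h1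
          lia
        obtain ⟨s, hs, hd⟩ := exists_dvd_of_maximal hF hp hα hαF
        refine ⟨s, ?_, hd⟩
        clear hd
        induction hs using AddSubmonoid.closure_induction with
        | mem x hx =>
          obtain ⟨t, ht, h, rfl⟩ := hx
          obtain ⟨d, hd⟩ := hsqc (algebraMap K F t) (by simpa using wcone_mem (L := F) ht 1)
          refine AddSubmonoid.subset_closure ⟨C d * h, ?_⟩
          rw [IsScalarTower.algebraMap_apply K F F[X], hd, Polynomial.algebraMap_eq]
          simp only [C_pow]
          ring
        | zero => exact zero_mem _
        | add x y _ _ hx hy => exact add_mem hx hy }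
  refine ⟨F, inferInstance, lo, hso, hmax, algebraMap K F, fun t ht => ?_⟩
  obtain ⟨y, hy⟩ := hsqc (algebraMap K F t) (by simpa using wcone_mem (L := F) ht 1)
  exact (hle _).2 ⟨y, by rw [hy, pow_two]⟩

end MaximalExtension

section MaxOrderedExtension

universe u

theorem exists_isMaxOrdered {C : Type u} [CommRing C] {T : Set C} (hT : IsPrecone T) :
    ∃ (R : Type u) (_ : Field R) (_ : LinearOrder R) (_ : IsStrictOrderedRing R)
      (_ : IsMaxOrdered R) (φ : C →+* R), ∀ t ∈ T, 0 ≤ φ t := by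
  obtain ⟨P, I, hTP, hP, hI, hIP⟩ := exists_prime_ordering hT
  let K := FractionRing (C ⧸ I)
  let ι : C →+* K := (algebraMap (C ⧸ I) K).comp (Ideal.Quotient.mk I)
  have hι : ∀ c, ι c = 0 ↔ c ∈ I := by
    intro c
    rw [← Ideal.Quotient.eq_zero_iff_mem]
    exact map_eq_zero_iff _ (IsFractionRing.injective (C ⧸ I) K)
  have hfrac : ∀ x : K, ∃ a b : C, ι b ≠ 0 ∧ ι b * x = ι a := by
    intro x
    obtain ⟨⟨a, b⟩, h⟩ := IsLocalization.surj (nonZeroDivisors (C ⧸ I)) x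
    obtain ⟨a, rfl⟩ := Ideal.Quotient.mk_surjective a
    obtain ⟨b', hb'⟩ := Ideal.Quotient.mk_surjective (b : C ⧸ I)
    refine ⟨a, b', ?_, ?_⟩
    · rw [Ne, hι, ← Ideal.Quotient.eq_zero_iff_mem, hb']
      exact nonZeroDivisors.coe_ne_zero b
    · rw [mul_comm]
      dsimp only at h
      rw [← hb'] at h
      exact h
  let TK : Set K := {x | ∃ d p : C, ι d ≠ 0 ∧ p ∈ P ∧ ι d ^ 2 * x = ι p}
  have hTK : IsPrecone TK :=
    { add := by
        rintro x ⟨d, p, hd, hp, h⟩ y ⟨e, q, he, hq, h'⟩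
        refine ⟨d * e, e * e * p + d * d * q, ?_, ?_, ?_⟩
        · rw [map_mul]; exact mul_ne_zero hd he
        · exact hP.add _ (hP.mul _ (hP.sq e) _ hp) _ (hP.mul _ (hP.sq d) _ hq)
        · simp only [map_add, map_mul]
          linear_combination ι e ^ 2 * h + ι d ^ 2 * h'
      mul := by
        rintro x ⟨d, p, hd, hp, h⟩ y ⟨e, q, he, hq, h'⟩
        refine ⟨d * e, p * q, ?_, hP.mul _ hp _ hq, ?_⟩
        · rw [map_mul]; exact mul_ne_zero hd he
        · simp only [map_mul]
          linear_combination ι e ^ 2 * y * h + ι p * h'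
      sq := by
        intro x
        obtain ⟨a, b, hb, h⟩ := hfrac x
        refine ⟨b, a * a, hb, hP.sq a, ?_⟩
        rw [map_mul, ← h]; ring
      neg_one := by
        rintro ⟨d, p, hd, hp, h⟩
        have h1 : d * d + p ∈ I := by
          rw [← hι, map_add, map_mul, ← h]; ring
        have h2 : -(d * d) ∈ P := by
          have : -(d * d) = p + -(d * d + p) := by ring
          rw [this]
          exact hP.add _ hp _ ((hIP _).1 h1).2
        have h3 : d * d ∈ I := (hIP _).2 ⟨hP.sq d, h2⟩
        have h4 : d ∈ I := by simpa using hI.mem_or_mem h3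
        exact hd ((hι d).2 h4) }
  obtain ⟨R, h1, h2, h3, h4, φ, hφ⟩ := exists_isMaxOrdered_of_field hTK
  refine ⟨R, h1, h2, h3, h4, φ.comp ι, fun t ht => hφ _ ⟨1, t, ?_, hTP ht, ?_⟩⟩
  · simp
  · simp

end MaxOrderedExtension

section IntermediateValue

open Polynomial

/-- The intermediate value property for polynomials over an ordered field. -/
class HasIVT (R : Type*) [Field R] [LinearOrder R] : Prop where
  exists_root : ∀ (f : R[X]) (a b : R), a < b → f.eval a * f.eval b < 0 →
    ∃ c, a < c ∧ c < b ∧ f.eval c = 0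

variable {R : Type*} [Field R] [LinearOrder R] [IsStrictOrderedRing R]

lemma exists_irreducible_factor_mul_neg (f : R[X]) (a b : R) (h : f.eval a * f.eval b < 0) :
    ∃ r, Irreducible r ∧ r ∣ f ∧ r.eval a * r.eval b < 0 := by
  induction f using WfDvdMonoid.induction_on_irreducible with
  | zero => simp at h
  | unit u hu =>
    obtain ⟨c, hc, rfl⟩ := Polynomial.isUnit_iff.1 hu
    simp only [eval_C] at h
    exact absurd h (not_lt.2 (mul_self_nonneg c))
  | mul f p hf hp ih =>
    by_cases h' : p.eval a * p.eval b < 0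
    · exact ⟨p, hp, dvd_mul_right _ _, h'⟩
    · simp only [eval_mul] at h
      have h2 : (p.eval a * p.eval b) * (f.eval a * f.eval b) < 0 := by
        convert h using 1; ring
      obtain ⟨r, hr, hd, hlt⟩ := ih (by
        by_contra hcon
        exact absurd h2 (not_lt.2 (mul_nonneg (not_lt.1 h') (not_lt.1 hcon))))
      exact ⟨r, hr, hd.mul_left _, hlt⟩

lemma exists_reduced_sq {p : R[X]} (hp : 0 < p.natDegree) {s : R[X]}
    (hs : s ∈ AddSubmonoid.closure {q : R[X] | ∃ h : R[X], q = h ^ 2}) :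
    ∃ s' : R[X], p ∣ s - s' ∧ s'.natDegree ≤ 2 * (p.natDegree - 1) ∧ ∀ x, 0 ≤ s'.eval x := by
  induction hs using AddSubmonoid.closure_induction with
  | mem x hx =>
    obtain ⟨h, rfl⟩ := hx
    refine ⟨(h % p) ^ 2, ?_, ?_, fun x => ?_⟩
    · have : h ^ 2 - (h % p) ^ 2 = (h - h % p) * (h + h % p) := by ring
      rw [this]
      refine Dvd.dvd.mul_right ⟨h / p, ?_⟩ _
      have := EuclideanDomain.div_add_mod h p
      linear_combination -this
    · rw [natDegree_pow]
      have := natDegree_mod_lt h hp.ne'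
      gcongr
      lia
    · rw [eval_pow]; positivity
  | zero => exact ⟨0, by simp, by simp, by simp⟩
  | add x y _ _ hx hy =>
    obtain ⟨s, h1, h2, h3⟩ := hx
    obtain ⟨t, h4, h5, h6⟩ := hy
    refine ⟨s + t, ?_, (natDegree_add_le _ _).trans (max_le h2 h5), fun z => ?_⟩
    · convert dvd_add h1 h4 using 1; ring
    · rw [eval_add]; exact add_nonneg (h3 z) (h6 z)

lemma natDegree_eq_one_of_mul_neg [IsMaxOrdered R] (p : R[X]) (hp : Irreducible p) (a b : R)
    (h : p.eval a * p.eval b < 0) : p.natDegree = 1 := by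
  induction hd : p.natDegree using Nat.strong_induction_on generalizing p with
  | _ d ih =>
  subst hd
  by_contra hne
  have h0 : p.natDegree ≠ 0 := by
    intro h0
    exact hp.not_isUnit (by
      rw [natDegree_eq_zero] at h0
      obtain ⟨c, rfl⟩ := h0
      refine Polynomial.isUnit_C.2 (isUnit_iff_ne_zero.2 ?_)
      rintro rfl
      simp at h)
  obtain ⟨s, hs, hps⟩ := IsMaxOrdered.irr p hp (by lia)
  obtain ⟨t, hst, htd, ht⟩ := exists_reduced_sq (Nat.pos_of_ne_zero h0) hs
  have h1 : p ∣ 1 + t := by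
    convert dvd_sub hps hst using 1; ring
  obtain ⟨q, hq⟩ := h1
  have hpos : ∀ x, 0 < p.eval x * q.eval x := by
    intro x
    have := congrArg (eval x) hq
    rw [eval_add, eval_one, eval_mul] at this
    rw [← this]
    linarith [ht x]
  have hq0 : q ≠ 0 := by
    rintro rfl
    simpa using hpos 0
  have hqd : q.natDegree < p.natDegree := by
    have e := congrArg natDegree hq
    rw [natDegree_mul hp.ne_zero hq0] at e
    have : (1 + t).natDegree ≤ 2 * (p.natDegree - 1) :=
      (natDegree_add_le _ _).trans (by simpa using htd)
    lia
  have hqab : q.eval a * q.eval b < 0 := by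
    have := mul_pos (hpos a) (hpos b)
    have h' : (p.eval a * p.eval b) * (q.eval a * q.eval b) > 0 := by
      convert this using 1; ring
    by_contra hcon
    exact absurd h' (not_lt.2 (mul_nonpos_of_nonpos_of_nonneg h.le (not_lt.1 hcon)))
  obtain ⟨r, hr, hrq, hrab⟩ := exists_irreducible_factor_mul_neg q a b hqab
  have hrd := ih _ ((natDegree_le_of_dvd hrq hq0).trans_lt hqd) r hr hrab rfl
  obtain ⟨x, hx⟩ := exists_root_of_degree_eq_one
    ((degree_eq_iff_natDegree_eq_of_pos one_pos).2 hrd)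
  have := hpos x
  rw [(hx.dvd hrq).eq_zero, mul_zero] at this
  exact lt_irrefl _ this

instance [IsMaxOrdered R] : HasIVT R where
  exists_root f a b hab h := by
    obtain ⟨r, hr, hrf, hrab⟩ := exists_irreducible_factor_mul_neg f a b h
    have hd := natDegree_eq_one_of_mul_neg r hr a b hrab
    obtain ⟨u, hu, v, rfl⟩ := natDegree_eq_one.1 hd
    simp only [eval_add, eval_mul, eval_C, eval_X] at hrab
    have hc : ∀ x, u * x + v = u * (x - -v / u) := fun x => by field_simp; ring
    rw [hc, hc] at hrab
    have h2 : (a - -v / u) * (b - -v / u) < 0 := by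
      have : 0 < u * u := mul_self_pos.2 hu
      by_contra hcon
      nlinarith [mul_nonneg this.le (not_lt.1 hcon)]
    have hroot : f.eval (-v / u) = 0 := by
      have : IsRoot (C u * X + C v) (-v / u) := by
        simp only [IsRoot.def, eval_add, eval_mul, eval_C, eval_X]; field_simp; ring
      exact (this.dvd hrf).eq_zero
    rcases mul_neg_iff.1 h2 with ⟨h3, h4⟩ | ⟨h3, h4⟩
    · exact absurd hab (by linarith)
    · exact ⟨_, by linarith, by linarith, hroot⟩

instance : HasIVT ℝ where
  exists_root f a b hab h := by
    have hc : ContinuousOn (fun x => f.eval x) (Set.Icc a b) := f.continuous.continuousOn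
    rcases mul_neg_iff.1 h with ⟨h1, h2⟩ | ⟨h1, h2⟩
    · obtain ⟨c, hc, h⟩ := intermediate_value_Ioo' hab.le hc ⟨h2, h1⟩
      exact ⟨c, hc.1, hc.2, h⟩
    · obtain ⟨c, hc, h⟩ := intermediate_value_Ioo hab.le hc ⟨h1, h2⟩
      exact ⟨c, hc.1, hc.2, h⟩

end IntermediateValue

section OrderedCalculus

open Polynomial

variable {R : Type*} [Field R] [LinearOrder R] [IsStrictOrderedRing R]

lemma exists_eval_ge_of_leadingCoeff_pos (h : R[X]) (hpos : 0 < h.leadingCoeff) :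
    ∃ B ε : R, 0 < ε ∧ ∀ x, B ≤ x → ε ≤ h.eval x := by
  induction hn : h.natDegree generalizing h with
  | zero =>
    obtain ⟨c, rfl⟩ := natDegree_eq_zero.1 hn
    rw [leadingCoeff_C] at hpos
    exact ⟨0, c, hpos, by simp⟩
  | succ n ih =>
    have hd : h.divX.natDegree = n := by rw [natDegree_divX_eq_natDegree_tsub_one, hn]; simp
    have hl : h.divX.leadingCoeff = h.leadingCoeff := by
      rw [leadingCoeff, hd, coeff_divX, leadingCoeff, hn]
    obtain ⟨B, ε, hε, hB⟩ := ih h.divX (by rwa [hl]) hd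
    refine ⟨max (max B 0) ((1 - h.coeff 0) / ε), 1, one_pos, fun x hx => ?_⟩
    have h1 := le_trans (le_max_left _ _) hx
    have h2 := hB x (le_trans (le_max_left _ _) h1)
    have h3 : 0 ≤ x := le_trans (le_max_right _ _) h1
    have h4 := le_trans (le_max_right _ _) hx
    rw [div_le_iff₀ hε] at h4
    have h5 := congrArg (eval x) (divX_mul_X_add h)
    simp only [eval_add, eval_mul, eval_X, eval_C] at h5
    rw [← h5]
    nlinarith

variable [HasIVT R]

lemma exists_root_of_sign_ne {f : R[X]} {a b : R} (hab : a < b) (ha : f.eval a < 0)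
    (hb : 0 < f.eval b) : ∃ c, a < c ∧ c < b ∧ f.eval c = 0 :=
  HasIVT.exists_root f a b hab (mul_neg_of_neg_of_pos ha hb)

lemma sign_eq_of_no_root {f : R[X]} {a b : R} (hab : a ≤ b)
    (h : ∀ c, a ≤ c → c ≤ b → f.eval c ≠ 0) :
    SignType.sign (f.eval a) = SignType.sign (f.eval b) := by
  rcases hab.eq_or_lt with rfl | hab
  · rfl
  have ha := h a le_rfl hab.le
  have hb := h b hab.le le_rfl
  by_contra hne
  have : f.eval a * f.eval b < 0 := by
    rcases ha.lt_or_gt with ha | ha <;> rcases hb.lt_or_gt with hb | hb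
    · simp [sign_neg ha, sign_neg hb] at hne
    · exact mul_neg_of_neg_of_pos ha hb
    · exact mul_neg_of_pos_of_neg ha hb
    · simp [sign_pos ha, sign_pos hb] at hne
  obtain ⟨c, h1, h2, h3⟩ := HasIVT.exists_root f a b hab this
  exact h c h1.le h2.le h3

lemma exists_derivative_root_of_consecutive {f : R[X]} (hf : f ≠ 0) {a b : R} (hab : a < b)
    (ha : f.eval a = 0) (hb : f.eval b = 0) (hno : ∀ c, a < c → c < b → f.eval c ≠ 0) :
    ∃ c, a < c ∧ c < b ∧ f.derivative.eval c = 0 := by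
  obtain ⟨g, hg, hga⟩ := exists_eq_pow_rootMultiplicity_mul_and_not_dvd f hf a
  have hm : 0 < f.rootMultiplicity a := (rootMultiplicity_pos hf).2 ha
  set m := f.rootMultiplicity a
  have hg0 : g ≠ 0 := by rintro rfl; simp at hga
  have hgb : g.eval b = 0 := by
    rw [hg, eval_mul, eval_pow, eval_sub, eval_X, eval_C] at hb
    exact (mul_eq_zero.1 hb).resolve_left (pow_ne_zero _ (sub_ne_zero.2 hab.ne'))
  obtain ⟨u, hu, hub⟩ := exists_eq_pow_rootMultiplicity_mul_and_not_dvd g hg0 b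
  have hk : 0 < g.rootMultiplicity b := (rootMultiplicity_pos hg0).2 hgb
  set k := g.rootMultiplicity b
  rw [dvd_iff_isRoot, IsRoot.def] at hga hub
  have hua : u.eval a ≠ 0 := by
    intro h; apply hga; rw [hu, eval_mul, h, mul_zero]
  have husign : SignType.sign (u.eval a) = SignType.sign (u.eval b) := by
    refine sign_eq_of_no_root hab.le fun c h1 h2 h3 => ?_
    rcases h1.eq_or_lt with rfl | h1
    · exact hua h3
    rcases h2.eq_or_lt with rfl | h2
    · exact hub h3
    apply hno c h1 h2
    rw [hg, eval_mul, hu, eval_mul, h3, mul_zero, mul_zero]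
  have hmul : 0 < u.eval a * u.eval b := by
    rcases hua.lt_or_gt with h | h
    · rw [sign_neg h, eq_comm, sign_eq_neg_one_iff] at husign
      exact mul_pos_of_neg_of_neg h husign
    · rw [sign_pos h, eq_comm, sign_eq_one_iff] at husign
      exact mul_pos h husign
  obtain ⟨m', hm'⟩ : ∃ m', m = m' + 1 := ⟨m - 1, by lia⟩
  obtain ⟨k', hk'⟩ : ∃ k', k = k' + 1 := ⟨k - 1, by lia⟩
  let w : R[X] := ((m' : R[X]) + 1) * (X - C b) * u + ((k' : R[X]) + 1) * (X - C a) * u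
    + (X - C a) * (X - C b) * derivative u
  have hw : derivative f = (X - C a) ^ m' * (X - C b) ^ k' * w := by
    rw [hg, hu, hm', hk']
    simp only [derivative_mul, derivative_X_sub_C_pow, w, Nat.add_sub_cancel, map_natCast]
    push_cast
    ring
  have hwab : w.eval a * w.eval b < 0 := by
    have e1 : w.eval a = -(((m' : R) + 1) * (b - a) * u.eval a) := by simp [w]; ring
    have e2 : w.eval b = (((k' : R) + 1) * (b - a) * u.eval b) := by simp [w]
    have : 0 < ((m' : R) + 1) * (b - a) * (((k' : R) + 1) * (b - a)) * (u.eval a * u.eval b) := by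
      have := sub_pos.2 hab
      positivity
    rw [e1, e2]
    linarith
  obtain ⟨c, h1, h2, h3⟩ := HasIVT.exists_root w a b hab hwab
  exact ⟨c, h1, h2, by rw [hw, eval_mul, h3, mul_zero]⟩

lemma exists_derivative_root {f : R[X]} (hf : f ≠ 0) {a b : R} (hab : a < b)
    (ha : f.eval a = 0) (hb : f.eval b = 0) :
    ∃ c, a < c ∧ c < b ∧ f.derivative.eval c = 0 := by
  classical
  obtain ⟨d, hd, hmin⟩ := Finset.exists_min_image (f.roots.toFinset.filter (a < ·)) id
    ⟨b, by simp [hf, hab, hb]⟩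
  simp only [Finset.mem_filter, Multiset.mem_toFinset, mem_roots hf, IsRoot.def, id] at hd hmin
  obtain ⟨c, h1, h2, h3⟩ := exists_derivative_root_of_consecutive hf hd.2 ha hd.1
    fun c h1 h2 h3 => absurd (hmin c ⟨h3, h1⟩) (not_le.2 h2)
  exact ⟨c, h1, h2.trans_le (hmin b ⟨hb, hab⟩), h3⟩

lemma exists_derivative_eq_slope (f : R[X]) {a b : R} (hab : a < b) :
    ∃ c, a < c ∧ c < b ∧ f.eval b - f.eval a = f.derivative.eval c * (b - a) := by
  have hba : b - a ≠ 0 := sub_ne_zero.2 hab.ne'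
  let s := (f.eval b - f.eval a) / (b - a)
  let g : R[X] := f - C s * (X - C a) - C (f.eval a)
  have hgd : g.derivative = f.derivative - C s := by simp [g]
  have hs : f.eval b - f.eval a = s * (b - a) := by simp only [s]; field_simp
  by_cases hg : g = 0
  · obtain ⟨c, h1, h2⟩ := exists_between hab
    refine ⟨c, h1, h2, ?_⟩
    rw [hg, derivative_zero] at hgd
    have := sub_eq_zero.1 hgd.symm
    rw [this, eval_C, hs]
  · obtain ⟨c, h1, h2, h3⟩ := exists_derivative_root hg hab (by simp [g]) (by
      simp only [g, eval_sub, eval_mul, eval_C, eval_X]; linarith)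
    refine ⟨c, h1, h2, ?_⟩
    rw [hgd, eval_sub, eval_C] at h3
    rw [hs, sub_eq_zero.1 h3]

end OrderedCalculus

section Charts

open Polynomial

lemma leadingCoeff_pos_of_derivative {R : Type*} [Field R] [LinearOrder R]
    [IsStrictOrderedRing R] {f : R[X]} (h : 0 < f.derivative.leadingCoeff) :
    0 < f.leadingCoeff := by
  have h0 : f.natDegree ≠ 0 := by
    intro h0
    rw [derivative_of_natDegree_zero h0] at h
    simp at h
  have hd : f.derivative.natDegree = f.natDegree - 1 := natDegree_derivative f
  rw [leadingCoeff, hd, coeff_derivative, Nat.sub_add_cancel (Nat.pos_of_ne_zero h0)] at h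
  refine pos_of_mul_pos_left h ?_
  positivity

section Position

variable {R₁ R₂ : Type*} [LinearOrder R₁] [LinearOrder R₂]

/-- `a` and `b` have the same position relative to the marked points `Z`. -/
def SamePos (Z : Set (R₁ × R₂)) (a : R₁) (b : R₂) : Prop :=
  ∀ p ∈ Z, (p.1 < a ↔ p.2 < b) ∧ (a < p.1 ↔ b < p.2)

lemma SamePos.eq_iff {Z : Set (R₁ × R₂)} {a : R₁} {b : R₂} (h : SamePos Z a b)
    {p : R₁ × R₂} (hp : p ∈ Z) : p.1 = a ↔ p.2 = b := by
  have := h p hp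
  constructor
  · intro e
    rw [e] at this
    simp only [lt_irrefl, false_iff, not_lt] at this
    exact le_antisymm this.2 this.1
  · intro e
    rw [e] at this
    simp only [lt_irrefl, iff_false, not_lt] at this
    exact le_antisymm this.2 this.1

lemma SamePos.swap {Z : Set (R₁ × R₂)} {a : R₁} {b : R₂} (h : SamePos Z a b) :
    SamePos (Prod.swap ⁻¹' Z) b a :=
  fun p hp => ⟨(h p.swap hp).1.symm, (h p.swap hp).2.symm⟩

lemma SamePos.mono {Z Z' : Set (R₁ × R₂)} (hZ : Z ⊆ Z') {a : R₁} {b : R₂}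
    (h : SamePos Z' a b) : SamePos Z a b := fun p hp => h p (hZ hp)

end Position

variable {R₁ R₂ : Type*} [Field R₁] [LinearOrder R₁] [Field R₂] [LinearOrder R₂]

/-- Marked points `Z` which contain the critical points of `f₁` and `f₂` and at which `f₁`, `f₂`
have equal signs. -/
structure Good (Z : Set (R₁ × R₂)) (f₁ : R₁[X]) (f₂ : R₂[X]) : Prop where
  fin : Z.Finite
  chart : ∀ p ∈ Z, SamePos Z p.1 p.2
  left : ∀ c, f₁.derivative.eval c = 0 → ∃ p ∈ Z, p.1 = c
  right : ∀ c, f₂.derivative.eval c = 0 → ∃ p ∈ Z, p.2 = c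
  sgn : ∀ p ∈ Z, SignType.sign (f₁.eval p.1) = SignType.sign (f₂.eval p.2)
  deriv : ∀ a b, SamePos Z a b →
    SignType.sign (f₁.derivative.eval a) = SignType.sign (f₂.derivative.eval b)

variable {Z : Set (R₁ × R₂)} {f₁ : R₁[X]} {f₂ : R₂[X]}

lemma Good.swap (h : Good Z f₁ f₂) : Good (Prod.swap ⁻¹' Z) f₂ f₁ where
  fin := h.fin.preimage Prod.swap_injective.injOn
  chart p hp := (h.chart p.swap hp).swap
  left c hc := by
    obtain ⟨p, hp, hpc⟩ := h.right c hc
    exact ⟨p.swap, by simpa using hp, hpc⟩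
  right c hc := by
    obtain ⟨p, hp, hpc⟩ := h.left c hc
    exact ⟨p.swap, by simpa using hp, hpc⟩
  sgn p hp := (h.sgn p.swap hp).symm
  deriv a b hab := (h.deriv b a fun p hp => ⟨(hab p.swap hp).1.symm, (hab p.swap hp).2.symm⟩).symm

variable [IsStrictOrderedRing R₁] [IsStrictOrderedRing R₂]

lemma Good.neg (h : Good Z f₁ f₂) : Good Z (-f₁) (-f₂) where
  fin := h.fin
  chart := h.chart
  left c hc := h.left c (by simpa using hc)
  right c hc := h.right c (by simpa using hc)
  sgn p hp := by simp [Left.sign_neg, h.sgn p hp]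
  deriv a b hab := by simp [Left.sign_neg, h.deriv a b hab]

lemma SamePos.reverse {a : R₁} {b : R₂} (h : SamePos Z a b) :
    SamePos (Neg.neg ⁻¹' Z) (-a) (-b) := fun p hp => by
  have := h (-p) hp
  simp only [Prod.fst_neg, Prod.snd_neg] at this
  constructor
  · rw [lt_neg, this.2, lt_neg]
  · rw [neg_lt, this.1, neg_lt]

lemma SamePos.reverse_iff {a : R₁} {b : R₂} :
    SamePos (Neg.neg ⁻¹' Z) (-a) (-b) ↔ SamePos Z a b :=
  ⟨fun h => by simpa [Set.preimage_preimage] using h.reverse, SamePos.reverse⟩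

lemma Good.reverse (h : Good Z f₁ f₂) :
    Good (Neg.neg ⁻¹' Z) (-(f₁.comp (-X))) (-(f₂.comp (-X))) where
  fin := h.fin.preimage neg_injective.injOn
  chart p hp := by simpa using (h.chart (-p) hp).reverse
  left c hc := by
    obtain ⟨p, hp, hpc⟩ := h.left (-c) (by simpa [derivative_comp] using hc)
    exact ⟨-p, by simpa using hp, by simp [hpc]⟩
  right c hc := by
    obtain ⟨p, hp, hpc⟩ := h.right (-c) (by simpa [derivative_comp] using hc)
    exact ⟨-p, by simpa using hp, by simp [hpc]⟩
  sgn p hp := by simpa [Left.sign_neg] using h.sgn (-p) hp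
  deriv a b hab := by
    have := h.deriv (-a) (-b) (SamePos.reverse_iff.1 (by simpa using hab))
    simpa [derivative_comp] using this

variable [HasIVT R₁] [HasIVT R₂]

lemma Good.exists_root_right (h : Good Z f₁ f₂) {a : R₁} {b : R₂} (hab : SamePos Z a b)
    (haZ : ∀ p ∈ Z, p.1 ≠ a) (hda : 0 < f₁.derivative.eval a) (ha : 0 ≤ f₁.eval a)
    (hb : f₂.eval b < 0) : ∃ r, b < r ∧ f₂.eval r = 0 ∧ SamePos Z a r := by
  have hdb : 0 < f₂.derivative.eval b := by
    rw [← sign_eq_one_iff, ← h.deriv a b hab]; exact sign_pos hda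
  have hsame : ∀ r, b < r → (∀ q ∈ Z, b < q.2 → r < q.2) → SamePos Z a r := by
    intro r hr hq q hqZ
    have h1 := hab q hqZ
    constructor
    · rw [h1.1]
      refine ⟨fun h => h.trans hr, fun h => ?_⟩
      by_contra hcon
      rcases (not_lt.1 hcon).eq_or_lt with e | e
      · exact haZ q hqZ ((hab.eq_iff hqZ).2 e.symm)
      · exact absurd (hq q hqZ e) (not_lt.2 h.le)
    · rw [h1.2]
      exact ⟨fun h => hq q hqZ h, fun h => hr.trans h⟩
  by_cases hex : ∃ p ∈ Z, b < p.2
  · obtain ⟨p, ⟨hp, hbp⟩, hmin⟩ := Set.exists_min_image {p ∈ Z | b < p.2} Prod.snd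
      (h.fin.subset (Set.sep_subset _ _)) (by simpa [Set.Nonempty] using hex)
    have hap : a < p.1 := ((hab p hp).2).2 hbp
    obtain ⟨c, hac, hcp, hc⟩ := exists_derivative_eq_slope f₁ hap
    have hdc : 0 < f₁.derivative.eval c := by
      rw [← sign_eq_one_iff, ← sign_eq_of_no_root hac.le]
      · exact sign_pos hda
      · intro x hax hxc hx
        obtain ⟨q, hq, hqx⟩ := h.left x hx
        have hax' : a < q.1 := by
          rw [hqx]; exact lt_of_le_of_ne hax (hqx ▸ (haZ q hq).symm)
        have h1 : b < q.2 := ((hab q hq).2).1 hax'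
        have h2 : q.2 < p.2 := ((h.chart p hp q hq).1).1 (by
          rw [hqx]; exact hxc.trans_lt hcp)
        exact absurd (hmin q ⟨hq, h1⟩) (not_le.2 h2)
    have hfp : 0 < f₁.eval p.1 := by
      have := mul_pos hdc (sub_pos.2 hap)
      linarith
    have hfp2 : 0 < f₂.eval p.2 := by
      rw [← sign_eq_one_iff, ← h.sgn p hp]; exact sign_pos hfp
    obtain ⟨r, h1, h2, h3⟩ := exists_root_of_sign_ne hbp hb hfp2
    exact ⟨r, h1, h3, hsame r h1 fun q hq hbq => h2.trans_le (hmin q ⟨hq, hbq⟩)⟩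
  · push Not at hex
    have hpos : ∀ x, b ≤ x → 0 < f₂.derivative.eval x := by
      intro x hx
      rw [← sign_eq_one_iff, ← sign_eq_of_no_root hx]
      · exact sign_pos hdb
      · intro c hbc hcx hc
        obtain ⟨q, hq, hqc⟩ := h.right c hc
        have := hex q hq
        rw [hqc] at this
        rw [le_antisymm this hbc] at hc
        exact hdb.ne' hc
    have hlc : 0 < f₂.derivative.leadingCoeff := by
      rcases lt_trichotomy f₂.derivative.leadingCoeff 0 with hl | hl | hl
      · obtain ⟨B, ε, hε, hB⟩ := exists_eval_ge_of_leadingCoeff_pos (-f₂.derivative)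
          (by rw [leadingCoeff_neg]; linarith)
        have h1 := hB (max B b) (le_max_left _ _)
        have h2 := hpos (max B b) (le_max_right _ _)
        rw [eval_neg] at h1
        linarith
      · rw [leadingCoeff_eq_zero] at hl
        rw [hl] at hdb
        simp at hdb
      · exact hl
    obtain ⟨B, ε, hε, hB⟩ := exists_eval_ge_of_leadingCoeff_pos f₂
      (leadingCoeff_pos_of_derivative hlc)
    have h1 := hε.trans_le (hB (max B b) (le_max_left _ _))
    have h2 : b < max B b := by
      refine lt_of_le_of_ne (le_max_right _ _) fun e => ?_
      rw [← e] at h1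
      linarith
    obtain ⟨r, h3, h4, h5⟩ := exists_root_of_sign_ne h2 hb h1
    exact ⟨r, h3, h5, hsame r h3 fun q hq hbq => absurd (hex q hq) (not_le.2 hbq)⟩

end Charts

section ChartGluing

open Polynomial

variable {R₁ R₂ : Type*} [Field R₁] [LinearOrder R₁] [Field R₂] [LinearOrder R₂]
  [IsStrictOrderedRing R₁] [IsStrictOrderedRing R₂] [HasIVT R₁] [HasIVT R₂]
  {Z : Set (R₁ × R₂)} {f₁ : R₁[X]} {f₂ : R₂[X]}

lemma Good.not_nonneg_neg (h : Good Z f₁ f₂) {a : R₁} {b : R₂} (hab : SamePos Z a b)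
    (haZ : ∀ p ∈ Z, p.1 ≠ a) (hda : 0 < f₁.derivative.eval a)
    (H : ∀ r s, f₁.eval r = 0 → f₂.eval s = 0 → SamePos Z r s → SamePos {(r, s)} a b)
    (ha : 0 ≤ f₁.eval a) (hb : f₂.eval b < 0) : False := by
  obtain ⟨s, hs, hs0, hsa⟩ := h.exists_root_right hab haZ hda ha hb
  rcases ha.eq_or_lt with ha | ha
  · have := (H a s ha.symm hs0 hsa (a, s) rfl).2
    exact lt_irrefl _ (this.2 hs)
  · have hbZ : ∀ p ∈ Neg.neg ⁻¹' (Prod.swap ⁻¹' Z), p.1 ≠ -b := by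
      intro p hp e
      refine haZ _ hp ((hab.eq_iff hp).2 ?_)
      simp [e]
    have hdb : 0 < f₂.derivative.eval b := by
      rw [← sign_eq_one_iff, ← h.deriv a b hab]; exact sign_pos hda
    obtain ⟨r, hr, hr0, hrb⟩ := h.swap.reverse.exists_root_right hab.swap.reverse hbZ
      (by simpa [derivative_comp] using hdb) (by simpa using hb.le) (by simpa using ha)
    have hrb' : SamePos Z (-r) b := by
      have : SamePos (Prod.swap ⁻¹' Z) b (-r) := SamePos.reverse_iff.1 (by simpa using hrb)
      exact this.swap
    have hrs : SamePos Z (-r) s := fun p hp => by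
      rw [(hrb' p hp).1, (hrb' p hp).2, ← (hab p hp).1, ← (hab p hp).2, (hsa p hp).1,
        (hsa p hp).2]
      exact ⟨Iff.rfl, Iff.rfl⟩
    have := (H (-r) s (by simpa using hr0) hs0 hrs (-r, s) rfl).2
    have h2 := this.2 hs
    simp only at h2
    linarith

lemma Good.sign_eq_of_deriv_pos (h : Good Z f₁ f₂) {a : R₁} {b : R₂} (hab : SamePos Z a b)
    (haZ : ∀ p ∈ Z, p.1 ≠ a) (hda : 0 < f₁.derivative.eval a)
    (H : ∀ r s, f₁.eval r = 0 → f₂.eval s = 0 → SamePos Z r s → SamePos {(r, s)} a b) :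
    SignType.sign (f₁.eval a) = SignType.sign (f₂.eval b) := by
  have hdb : 0 < f₂.derivative.eval b := by
    rw [← sign_eq_one_iff, ← h.deriv a b hab]; exact sign_pos hda
  have hbZ : ∀ p ∈ Prod.swap ⁻¹' Z, p.1 ≠ b := fun p hp e => haZ _ hp ((hab.eq_iff hp).2 e)
  have hsw : ∀ r s (a : R₁) (b : R₂), SamePos {(r, s)} a b → SamePos {(s, r)} b a := by
    intro r s a b h p hp
    have := h (r, s) rfl
    rw [Set.mem_singleton_iff.1 hp]
    exact ⟨this.1.symm, this.2.symm⟩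
  have hrev : ∀ r s (a : R₁) (b : R₂), SamePos {(-r, -s)} a b → SamePos {(r, s)} (-a) (-b) := by
    intro r s a b h p hp
    have := h (-r, -s) rfl
    rw [Set.mem_singleton_iff.1 hp]
    exact ⟨by rw [lt_neg, this.2, lt_neg], by rw [neg_lt, this.1, neg_lt]⟩
  have h1 := fun x y => h.not_nonneg_neg hab haZ hda H x y
  have h2 := fun x y => h.swap.not_nonneg_neg hab.swap hbZ hdb
    (fun r s hr hs hrs => hsw _ _ _ _ (H s r hs hr hrs.swap)) x y
  have haZ' : ∀ p ∈ Neg.neg ⁻¹' Z, p.1 ≠ -a := fun p hp e => haZ _ hp (by simp [e])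
  have hbZ' : ∀ p ∈ Neg.neg ⁻¹' (Prod.swap ⁻¹' Z), p.1 ≠ -b :=
    fun p hp e => hbZ _ hp (by simp [e])
  have H' : ∀ r s, (-(f₁.comp (-X))).eval r = 0 → (-(f₂.comp (-X))).eval s = 0 →
      SamePos (Neg.neg ⁻¹' Z) r s → SamePos {(r, s)} (-a) (-b) := fun r s hr hs hrs =>
    hrev _ _ _ _ (H (-r) (-s) (by simpa using hr) (by simpa using hs)
      (SamePos.reverse_iff.1 (by simpa using hrs)))
  have h3 := fun x y => h.reverse.not_nonneg_neg hab.reverse haZ'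
    (by simpa [derivative_comp] using hda) H' x y
  have h4 := fun x y => h.swap.reverse.not_nonneg_neg hab.swap.reverse hbZ'
    (by simpa [derivative_comp] using hdb)
    (fun r s hr hs hrs => by
      refine hsw s r (-a) (-b) (H' s r (by simpa using hs) (by simpa using hr) ?_)
      exact hrs.swap) x y
  simp only [eval_neg, eval_comp, eval_X, neg_neg, Left.nonneg_neg_iff, Left.neg_neg_iff] at h3 h4
  rcases lt_trichotomy (f₁.eval a) 0 with ha | ha | ha <;>
    rcases lt_trichotomy (f₂.eval b) 0 with hb | hb | hb
  · rw [sign_neg ha, sign_neg hb]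
  · exact (h2 hb.ge ha).elim
  · exact (h2 hb.le ha).elim
  · exact (h1 ha.ge hb).elim
  · rw [ha, hb, sign_zero, sign_zero]
  · exact (h3 ha.le hb).elim
  · exact (h1 ha.le hb).elim
  · exact (h4 hb.le ha).elim
  · rw [sign_pos ha, sign_pos hb]

lemma Good.sign_eq (h : Good Z f₁ f₂) {a : R₁} {b : R₂} (hab : SamePos Z a b)
    (H : ∀ r s, f₁.eval r = 0 → f₂.eval s = 0 → SamePos Z r s → SamePos {(r, s)} a b) :
    SignType.sign (f₁.eval a) = SignType.sign (f₂.eval b) := by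
  by_cases haZ : ∀ p ∈ Z, p.1 ≠ a
  · rcases lt_trichotomy (f₁.derivative.eval a) 0 with hd | hd | hd
    · have := h.neg.sign_eq_of_deriv_pos hab haZ (by simpa using hd)
        (fun r s hr hs => H r s (by simpa using hr) (by simpa using hs))
      simpa [Left.sign_neg] using this
    · obtain ⟨p, hp, hpa⟩ := h.left a hd
      exact absurd hpa (haZ p hp)
    · exact h.sign_eq_of_deriv_pos hab haZ hd H
  · push Not at haZ
    obtain ⟨p, hp, hpa⟩ := haZ
    have := h.sgn p hp
    rwa [hpa, (hab.eq_iff hp).1 hpa] at this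

lemma Good.exists_between_roots (h : Good Z f₁ f₂) (hf : f₁ ≠ 0) {r r' : R₁} {s s' : R₂}
    (hr : f₁.eval r = 0) (hr' : f₁.eval r' = 0) (hrs : SamePos Z r s) (hrs' : SamePos Z r' s')
    (hlt : r < r') : s < s' := by
  obtain ⟨c, h1, h2, hc⟩ := exists_derivative_root hf hlt hr hr'
  obtain ⟨p, hp, rfl⟩ := h.left c hc
  exact ((hrs p hp).2.1 h1).trans ((hrs' p hp).1.1 h2)

lemma Good.exists_refinement (h : Good Z f₁ f₂) (hf₁ : f₁ ≠ 0) (hf₂ : f₂ ≠ 0) :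
    ∃ Z' : Set (R₁ × R₂), Z ⊆ Z' ∧ Z'.Finite ∧ (∀ p ∈ Z', SamePos Z' p.1 p.2) ∧
      ∀ a b, SamePos Z' a b → SignType.sign (f₁.eval a) = SignType.sign (f₂.eval b) := by
  classical
  let E : Set (R₁ × R₂) := {p | f₁.eval p.1 = 0 ∧ f₂.eval p.2 = 0 ∧ SamePos Z p.1 p.2}
  have hE : E.Finite := by
    refine ((f₁.roots.toFinset ×ˢ f₂.roots.toFinset).finite_toSet).subset fun p hp => ?_
    simp [hf₁, hf₂, hp.1, hp.2.1]
  refine ⟨Z ∪ E, Set.subset_union_left, h.fin.union hE, ?_, fun a b hab => ?_⟩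
  · have hpos : ∀ p ∈ Z ∪ E, SamePos Z p.1 p.2 := by
      rintro p (hp | hp)
      · exact h.chart p hp
      · exact hp.2.2
    have hlt : ∀ p ∈ Z ∪ E, ∀ q ∈ Z ∪ E, q.1 < p.1 ↔ q.2 < p.2 := by
      intro p hp q hq
      rcases hq with hq | hq
      · exact (hpos p hp q hq).1
      rcases hp with hp | hp
      · exact (hpos q (Or.inr hq) p hp).2
      · exact ⟨h.exists_between_roots hf₁ hq.1 hp.1 hq.2.2 hp.2.2,
          h.swap.exists_between_roots hf₂ hq.2.1 hp.2.1 hq.2.2.swap hp.2.2.swap⟩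
    exact fun p hp q hq => ⟨hlt p hp q hq, hlt q hq p hp⟩
  · refine h.sign_eq (hab.mono Set.subset_union_left) fun r s hr hs hrs => ?_
    refine hab.mono (Set.singleton_subset_iff.2 (Or.inr ⟨hr, hs, hrs⟩))

end ChartGluing

section ChartRefinement

open Polynomial

lemma exists_gap {R : Type*} [Field R] [LinearOrder R] [IsStrictOrderedRing R] {W : Set R}
    (hW : W.Finite) {a : R} (ha : a ∉ W) :
    ∃ l u, l < a ∧ a < u ∧ ∀ w ∈ W, w ≤ l ∨ u ≤ w := by
  induction W, hW using Set.Finite.induction_on with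
  | empty => exact ⟨a - 1, a + 1, by linarith, by linarith, by simp⟩
  | @insert x s hx _ ih =>
    simp only [Set.mem_insert_iff, not_or] at ha
    obtain ⟨l, u, hl, hu, h⟩ := ih ha.2
    rcases lt_or_gt_of_ne ha.1 with hax | hax
    · refine ⟨l, min u x, hl, lt_min hu hax, ?_⟩
      rintro w (rfl | hw)
      · exact Or.inr (min_le_right _ _)
      · exact (h w hw).imp id fun h => (min_le_left _ _).trans h
    · refine ⟨max l x, u, max_lt hl hax, hu, ?_⟩
      rintro w (rfl | hw)
      · exact Or.inl (le_max_right _ _)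
      · exact (h w hw).imp (fun h => h.trans (le_max_left _ _)) id

variable {R₁ R₂ : Type*} [Field R₁] [LinearOrder R₁] [Field R₂] [LinearOrder R₂]
  [IsStrictOrderedRing R₁] [IsStrictOrderedRing R₂] {Z : Set (R₁ × R₂)}

lemma exists_samePos (hZ : Z.Finite) (hc : ∀ p ∈ Z, SamePos Z p.1 p.2) (a : R₁) :
    ∃ b, SamePos Z a b := by
  let F : Order.PartialIso R₁ R₂ := ⟨hZ.toFinset, fun p hp q hq => by
    have h := hc q (by simpa using hq) p (by simpa using hp)
    rcases lt_trichotomy p.1 q.1 with h1 | h1 | h1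
    · rw [(cmp_eq_lt_iff _ _).2 h1, (cmp_eq_lt_iff _ _).2 (h.1.1 h1)]
    · have h2 := ((hc q (by simpa using hq)).eq_iff (p := p) (by simpa using hp)).1 h1
      rw [h1, h2, cmp_self_eq_eq, cmp_self_eq_eq]
    · rw [(cmp_eq_gt_iff _ _).2 h1, (cmp_eq_gt_iff _ _).2 (h.2.1 h1)]⟩
  obtain ⟨b, hb⟩ := Order.PartialIso.exists_across F a
  refine ⟨b, fun p hp => ?_⟩
  have h := hb p (by simpa [F] using hp)
  exact ⟨lt_iff_lt_of_cmp_eq_cmp h, by rw [← cmp_eq_gt_iff, h, cmp_eq_gt_iff]⟩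

lemma exists_mem_of_root (hZ : Z.Finite) (hc : ∀ p ∈ Z, SamePos Z p.1 p.2) {p₁ : R₁[X]}
    {p₂ : R₂[X]} (hp : p₁ ≠ 0)
    (hs : ∀ a b, SamePos Z a b → SignType.sign (p₁.eval a) = SignType.sign (p₂.eval b))
    {a : R₁} (ha : p₁.eval a = 0) : ∃ z ∈ Z, z.1 = a := by
  by_contra hcon
  obtain ⟨b, hb⟩ := exists_samePos hZ hc a
  obtain ⟨l, u, hl, hu, h⟩ := exists_gap (hZ.image Prod.fst) (a := a) (by simpa using hcon)
  apply hp
  have hb0 : SignType.sign (p₂.eval b) = 0 := by rw [← hs a b hb, ha, sign_zero]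
  refine eq_zero_of_infinite_isRoot _ ((Set.Ioo_infinite (hl.trans hu)).mono fun x hx => ?_)
  have hxb : SamePos Z x b := fun p hp => by
    rw [← (hb p hp).1, ← (hb p hp).2]
    rcases h p.1 ⟨p, hp, rfl⟩ with h | h
    · have h1 := h.trans_lt hx.1
      have h2 := h.trans_lt hl
      simp [h1, h2, h1.not_gt, h2.not_gt]
    · have h1 := hx.2.trans_le h
      have h2 := hu.trans_le h
      simp [h1, h2, h1.not_gt, h2.not_gt]
  have := hs x b hxb
  rwa [hb0, sign_eq_zero_iff] at this

variable [HasIVT R₁] [HasIVT R₂]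

lemma exists_chart_insert (hZ : Z.Finite) (hc : ∀ p ∈ Z, SamePos Z p.1 p.2)
    {Q : Set (R₁[X] × R₂[X])} (hQ : ∀ p ∈ Q, p.1 ≠ 0 ∧ p.2 ≠ 0)
    (hs : ∀ a b, SamePos Z a b → ∀ p ∈ Q,
      SignType.sign (p.1.eval a) = SignType.sign (p.2.eval b))
    {f₁ : R₁[X]} {f₂ : R₂[X]} (hf₁ : f₁ ≠ 0) (hf₂ : f₂ ≠ 0)
    (hd : (f₁.derivative, f₂.derivative) ∈ Q)
    (hf : ∀ z ∈ Z, ∀ p ∈ Q, p.1.eval z.1 = 0 →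
      SignType.sign (f₁.eval z.1) = SignType.sign (f₂.eval z.2)) :
    ∃ Z' : Set (R₁ × R₂), Z'.Finite ∧ (∀ p ∈ Z', SamePos Z' p.1 p.2) ∧
      ∀ a b, SamePos Z' a b → SignType.sign (f₁.eval a) = SignType.sign (f₂.eval b) ∧
        ∀ p ∈ Q, SignType.sign (p.1.eval a) = SignType.sign (p.2.eval b) := by
  let Z₀ : Set (R₁ × R₂) := {z ∈ Z | ∃ p ∈ Q, p.1.eval z.1 = 0}
  have hZ₀ : Z₀ ⊆ Z := Set.sep_subset _ _
  have hc₀ : ∀ p ∈ Z₀, SamePos Z₀ p.1 p.2 := fun p hp => (hc p (hZ₀ hp)).mono hZ₀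
  have hleft : ∀ p ∈ Q, ∀ a, p.1.eval a = 0 → ∃ z ∈ Z₀, z.1 = a := by
    intro p hp a ha
    obtain ⟨z, hz, rfl⟩ := exists_mem_of_root hZ hc (hQ p hp).1 (fun a b h => hs a b h p hp) ha
    exact ⟨z, ⟨hz, p, hp, ha⟩, rfl⟩
  have hright : ∀ p ∈ Q, ∀ b, p.2.eval b = 0 → ∃ z ∈ Z₀, z.2 = b := by
    intro p hp b hb
    obtain ⟨z, hz, rfl⟩ := exists_mem_of_root (Z := Prod.swap ⁻¹' Z) (p₂ := p.1)
      (hZ.preimage Prod.swap_injective.injOn) (fun q hq => (hc q.swap hq).swap) (hQ p hp).2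
      (fun a b h => (hs b a h.swap p hp).symm) hb
    refine ⟨z.swap, ⟨hz, p, hp, ?_⟩, rfl⟩
    have := hs _ _ (hc _ hz) p hp
    rw [← sign_eq_zero_iff, this, sign_eq_zero_iff]
    exact hb
  have hs₀ : ∀ a b, SamePos Z₀ a b → ∀ p ∈ Q,
      SignType.sign (p.1.eval a) = SignType.sign (p.2.eval b) := by
    intro a b hab p hp
    by_cases ha : ∃ z ∈ Z₀, z.1 = a
    · obtain ⟨z, hz, rfl⟩ := ha
      have := hs _ _ (hc z (hZ₀ hz)) p hp
      rwa [(hab.eq_iff hz).1 rfl] at this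
    · push Not at ha
      obtain ⟨b', hb'⟩ := exists_samePos hZ hc a
      rw [hs a b' hb' p hp]
      have hb'₀ := hb'.mono hZ₀
      have key : ∀ b b' : R₂, SamePos Z₀ a b → SamePos Z₀ a b' → b ≤ b' →
          SignType.sign (p.2.eval b) = SignType.sign (p.2.eval b') := by
        intro b b' hb hb' hle
        refine sign_eq_of_no_root hle fun c h1 h2 h3 => ?_
        obtain ⟨z, hz, rfl⟩ := hright p hp c h3
        rcases lt_or_gt_of_ne (ha z hz) with h | h
        · exact absurd ((hb z hz).1.1 h) (not_lt.2 h1)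
        · exact absurd ((hb' z hz).2.1 h) (not_lt.2 h2)
      rcases le_total b b' with h | h
      · exact (key b b' hab hb'₀ h).symm
      · exact key b' b hb'₀ hab h
  have good : Good Z₀ f₁ f₂ :=
    { fin := hZ.subset hZ₀
      chart := hc₀
      left := hleft _ hd
      right := hright _ hd
      sgn := fun z hz => by
        obtain ⟨hz, p, hp, h⟩ := hz
        exact hf z hz p hp h
      deriv := fun a b hab => hs₀ a b hab _ hd }
  obtain ⟨Z', h1, h2, h3, h4⟩ := good.exists_refinement hf₁ hf₂
  exact ⟨Z', h2, h3, fun a b hab => ⟨h4 a b hab, hs₀ a b (hab.mono h1)⟩⟩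

lemma exists_pseudo_mod {A : Type*} [CommRing A] (p f : A[X]) (hp : 0 < p.natDegree) :
    ∃ (k : ℕ) (h r : A[X]), C (p.leadingCoeff ^ k) * f = p * h + r ∧
      r.natDegree < p.natDegree := by
  induction hn : f.natDegree using Nat.strong_induction_on generalizing f with
  | _ n ih =>
  subst hn
  by_cases hlt : f.natDegree < p.natDegree
  · exact ⟨0, 0, f, by simp, hlt⟩
  · push Not at hlt
    let g := C p.leadingCoeff * f - p * (C f.leadingCoeff * X ^ (f.natDegree - p.natDegree))
    have hg : g.natDegree < f.natDegree := by
      have h1 : g.natDegree ≤ f.natDegree := by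
        refine (natDegree_sub_le _ _).trans (max_le (natDegree_C_mul_le _ _) ?_)
        refine natDegree_mul_le.trans ?_
        have := natDegree_C_mul_X_pow_le f.leadingCoeff (f.natDegree - p.natDegree)
        lia
      have h2 : g.coeff f.natDegree = 0 := by
        have e : p * (C f.leadingCoeff * X ^ (f.natDegree - p.natDegree)) =
            C f.leadingCoeff * (p * X ^ (f.natDegree - p.natDegree)) := by ring
        have e2 : (p * X ^ (f.natDegree - p.natDegree)).coeff f.natDegree = p.leadingCoeff := by
          conv_lhs => rw [show f.natDegree = p.natDegree + (f.natDegree - p.natDegree) by lia]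
          rw [Nat.add_sub_cancel_left, coeff_mul_X_pow]
          rfl
        simp only [g]
        rw [e, coeff_sub, coeff_C_mul, coeff_C_mul, e2, coeff_natDegree]
        ring
      refine lt_of_le_of_ne h1 fun h3 => ?_
      rw [← h3, coeff_natDegree, leadingCoeff_eq_zero] at h2
      rw [h2, natDegree_zero] at h3
      lia
    obtain ⟨k, h, r, h1, h2⟩ := ih _ hg g rfl
    refine ⟨k + 1, h + C (p.leadingCoeff ^ k) * (C f.leadingCoeff *
      X ^ (f.natDegree - p.natDegree)), r, ?_, h2⟩
    have h3 : C (p.leadingCoeff ^ (k + 1)) * f =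
        C (p.leadingCoeff ^ k) * g + C (p.leadingCoeff ^ k) *
          (p * (C f.leadingCoeff * X ^ (f.natDegree - p.natDegree))) := by
      simp only [g, pow_succ, C_mul]; ring
    rw [h3, h1]; ring

lemma exists_sign_mod {A : Type*} [CommRing A] (p f : A[X]) :
    ∃ r : A[X], (0 < p.natDegree → r.natDegree < p.natDegree) ∧
      (p.natDegree = 0 → r.natDegree = 0) ∧
      ∃ (k : ℕ) (h : A[X]), 0 < p.natDegree → C ((p.leadingCoeff ^ k) ^ 2) * f = p * h + r := by
  by_cases hp : 0 < p.natDegree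
  · obtain ⟨k, h, r, h1, h2⟩ := exists_pseudo_mod p f hp
    refine ⟨C (p.leadingCoeff ^ k) * r, fun _ => (natDegree_C_mul_le _ _).trans_lt h2,
      fun h => absurd h hp.ne', k, C (p.leadingCoeff ^ k) * h, fun _ => ?_⟩
    rw [pow_two, C_mul, mul_assoc, h1]; ring
  · exact ⟨0, fun h => absurd h hp, fun _ => by simp, 0, 0, fun h => absurd h hp⟩

lemma sign_eval_eq_of_mod {A : Type*} [CommRing A] {R : Type*} [Field R] [LinearOrder R]
    [IsStrictOrderedRing R] {p f r h : A[X]} {k : ℕ}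
    (e : C ((p.leadingCoeff ^ k) ^ 2) * f = p * h + r) (φ : A →+* R)
    (hl : φ p.leadingCoeff ≠ 0) {x : R} (hx : (p.map φ).eval x = 0) :
    SignType.sign ((f.map φ).eval x) = SignType.sign ((r.map φ).eval x) := by
  have := congrArg (fun q => (q.map φ).eval x) e
  simp only [Polynomial.map_mul, Polynomial.map_add, eval_mul, eval_add, hx, zero_mul, zero_add,
    map_C, eval_C] at this
  have h0 : 0 < φ ((p.leadingCoeff ^ k) ^ 2) := by
    rw [map_pow, map_pow]; positivity
  rw [← this, sign_mul, sign_pos h0, one_mul]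

end ChartRefinement

section ChartExistence

open Polynomial

variable {R₁ R₂ : Type*} [Field R₁] [LinearOrder R₁] [Field R₂] [LinearOrder R₂]
  [IsStrictOrderedRing R₁] [IsStrictOrderedRing R₂]

lemma isDershowitzMannaLT_replace {A : Type*} [CommRing A] (Φ : Multiset A[X]) (f : A[X])
    (M : Multiset A[X]) (hM : ∀ q ∈ M, q.natDegree < f.natDegree) :
    Multiset.IsDershowitzMannaLT ((Φ + M).map natDegree) ((f ::ₘ Φ).map natDegree) := by
  refine ⟨Φ.map natDegree, M.map natDegree, {f.natDegree}, by simp, by simp, ?_, ?_⟩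
  · rw [Multiset.map_cons, add_comm, Multiset.singleton_add]
  · intro y hy
    obtain ⟨q, hq, rfl⟩ := Multiset.mem_map.1 hy
    exact ⟨_, Multiset.mem_singleton_self _, hM q hq⟩

lemma leadingCoeff_derivative_ne_zero {A : Type*} [CommRing A] {R : Type*} [Field R]
    [LinearOrder R] [IsStrictOrderedRing R] (φ : A →+* R) {f : A[X]} (hd : 0 < f.natDegree)
    (hf : φ f.leadingCoeff ≠ 0) :
    φ f.derivative.leadingCoeff ≠ 0 := by
  have h1 : φ (f.derivative.coeff (f.natDegree - 1)) ≠ 0 := by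
    rw [coeff_derivative, Nat.sub_add_cancel hd, map_mul]
    refine mul_ne_zero hf ?_
    rw [map_add, map_natCast, map_one]
    positivity
  have h2 : f.derivative.natDegree = f.natDegree - 1 := by
    refine le_antisymm (natDegree_derivative_le f) (le_natDegree_of_ne_zero fun h => ?_)
    rw [h, map_zero] at h1
    exact h1 rfl
  rwa [leadingCoeff, h2]

lemma map_ne_zero_of_leadingCoeff {A : Type*} [CommRing A] {R : Type*} [Field R]
    (φ : A →+* R) {f : A[X]} (hf : φ f.leadingCoeff ≠ 0) : f.map φ ≠ 0 := fun h => hf (by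
  have := congrArg (fun q => q.coeff f.natDegree) h
  simpa using this)

lemma map_eraseLead_of_leadingCoeff {A : Type*} [CommRing A] {R : Type*} [Field R]
    (φ : A →+* R) {f : A[X]} (hf : φ f.leadingCoeff = 0) : f.eraseLead.map φ = f.map φ := by
  conv_rhs => rw [← eraseLead_add_C_mul_X_pow f]
  rw [Polynomial.map_add, Polynomial.map_mul, map_C, hf, C_0, zero_mul, add_zero]

variable (R₁ R₂) [HasIVT R₁] [HasIVT R₂]

/-- For finitely many polynomials over `A` there is a finite set of elements of `A` whose signs
under two homomorphisms to ordered fields determine the sign patterns of the polynomials. -/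
theorem exists_sign_chart {A : Type*} [CommRing A] (Φ : Multiset A[X]) :
    ∃ Ψ : Set A, Ψ.Finite ∧ ∀ (φ₁ : A →+* R₁) (φ₂ : A →+* R₂),
      (∀ c ∈ Ψ, SignType.sign (φ₁ c) = SignType.sign (φ₂ c)) →
      ∃ Z : Set (R₁ × R₂), Z.Finite ∧ (∀ p ∈ Z, SamePos Z p.1 p.2) ∧
        ∀ a b, SamePos Z a b → ∀ f ∈ Φ,
          SignType.sign ((f.map φ₁).eval a) = SignType.sign ((f.map φ₂).eval b) := by
  classical
  induction hM : Φ.map natDegree using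
    (Multiset.wellFounded_isDershowitzMannaLT (α := ℕ)).induction generalizing Φ with
  | _ M ih =>
  subst hM
  by_cases hdeg : ∀ f ∈ Φ, f.natDegree = 0
  · refine ⟨(fun f => coeff f 0) '' {f | f ∈ Φ}, ?_, fun φ₁ φ₂ h => ⟨∅, Set.finite_empty, by simp,
      fun a b _ f hf => ?_⟩⟩
    · exact Set.Finite.image _ (Φ.toFinset.finite_toSet.subset fun f hf => by simpa using hf)
    · rw [eq_C_of_natDegree_eq_zero (hdeg f hf), map_C, map_C, eval_C, eval_C]
      exact h _ ⟨f, hf, rfl⟩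
  push Not at hdeg
  obtain ⟨f, hf, hmax⟩ := Finset.exists_max_image Φ.toFinset natDegree (by
    obtain ⟨f, hf, -⟩ := hdeg
    exact ⟨f, by simpa using hf⟩)
  simp only [Multiset.mem_toFinset] at hf hmax
  have hf1 : 0 < f.natDegree := by
    obtain ⟨q, hq, hq0⟩ := hdeg
    exact (Nat.pos_of_ne_zero hq0).trans_le (hmax q hq)
  have ha : ∀ p ∈ Φ, 0 < p.natDegree → Multiset.IsDershowitzMannaLT
      ((Φ.erase p + {p.eraseLead}).map natDegree) (Φ.map natDegree) := by
    intro p hp hd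
    have := isDershowitzMannaLT_replace (Φ.erase p) p {p.eraseLead} (by
      intro q hq
      rw [Multiset.mem_singleton.1 hq]
      have := eraseLead_natDegree_le p
      lia)
    rwa [Multiset.cons_erase hp] at this
  choose r hr1 hr2 k h hr using fun p : A[X] => exists_sign_mod p f
  have hf'd : f.derivative.natDegree < f.natDegree := natDegree_derivative_lt hf1.ne'
  have hb : Multiset.IsDershowitzMannaLT
      ((Φ.erase f + (f.derivative ::ₘ (f.derivative ::ₘ Φ.erase f).map r)).map natDegree)
      (Φ.map natDegree) := by
    have := isDershowitzMannaLT_replace (Φ.erase f) f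
      (f.derivative ::ₘ (f.derivative ::ₘ Φ.erase f).map r) (by
        intro q hq
        rcases Multiset.mem_cons.1 hq with rfl | hq
        · exact hf'd
        · obtain ⟨p, hp, rfl⟩ := Multiset.mem_map.1 hq
          have hpf : p.natDegree ≤ f.natDegree := by
            rcases Multiset.mem_cons.1 hp with rfl | hp
            · exact hf'd.le
            · exact hmax p (Multiset.mem_of_mem_erase hp)
          rcases Nat.eq_zero_or_pos p.natDegree with h0 | h0
          · rw [hr2 p h0]; exact hf1
          · exact (hr1 p h0).trans_le hpf)
    rwa [Multiset.cons_erase hf] at this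
  have hΨa : ∀ p : A[X], ∃ Ψ : Set A, Ψ.Finite ∧ (p ∈ Φ → 0 < p.natDegree →
      ∀ (φ₁ : A →+* R₁) (φ₂ : A →+* R₂),
      (∀ c ∈ Ψ, SignType.sign (φ₁ c) = SignType.sign (φ₂ c)) →
      ∃ Z : Set (R₁ × R₂), Z.Finite ∧ (∀ p ∈ Z, SamePos Z p.1 p.2) ∧
        ∀ a b, SamePos Z a b → ∀ f ∈ Φ.erase p + {p.eraseLead},
          SignType.sign ((f.map φ₁).eval a) = SignType.sign ((f.map φ₂).eval b)) := by
    intro p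
    by_cases hp : p ∈ Φ ∧ 0 < p.natDegree
    · obtain ⟨Ψ, h1, h2⟩ := ih _ (ha p hp.1 hp.2) _ rfl
      exact ⟨Ψ, h1, fun _ _ => h2⟩
    · exact ⟨∅, Set.finite_empty, fun h1 h2 => absurd ⟨h1, h2⟩ hp⟩
  choose Ψa hΨa1 hΨa2 using hΨa
  obtain ⟨Ψb, hΨb1, hΨb2⟩ := ih _ hb _ rfl
  refine ⟨(⋃ p ∈ Φ.toFinset, (insert p.leadingCoeff (Ψa p))) ∪ Ψb, ?_, fun φ₁ φ₂ hφ => ?_⟩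
  · exact (Set.Finite.biUnion Φ.toFinset.finite_toSet fun p _ => (hΨa1 p).insert _).union hΨb1
  have hφlc : ∀ p ∈ Φ, SignType.sign (φ₁ p.leadingCoeff) = SignType.sign (φ₂ p.leadingCoeff) := by
    intro p hp
    refine hφ _ (Or.inl ?_)
    simp only [Multiset.mem_toFinset, Set.mem_iUnion]
    exact ⟨p, hp, Set.mem_insert _ _⟩
  have hφlc0 : ∀ p ∈ Φ, φ₁ p.leadingCoeff = 0 ↔ φ₂ p.leadingCoeff = 0 := by
    intro p hp
    rw [← sign_eq_zero_iff, hφlc p hp, sign_eq_zero_iff]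
  by_cases hlc : ∃ p ∈ Φ, 0 < p.natDegree ∧ φ₁ p.leadingCoeff = 0
  · obtain ⟨p, hp, hpd, hp0⟩ := hlc
    obtain ⟨Z, hZ, hc, hs⟩ := hΨa2 p hp hpd φ₁ φ₂ fun c hc => hφ c (Or.inl (by
      simp only [Multiset.mem_toFinset, Set.mem_iUnion]
      exact ⟨p, hp, Set.mem_insert_of_mem _ hc⟩))
    refine ⟨Z, hZ, hc, fun a b hab q hq => ?_⟩
    by_cases hqp : q = p
    · subst hqp
      rw [← map_eraseLead_of_leadingCoeff φ₁ hp0,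
        ← map_eraseLead_of_leadingCoeff φ₂ ((hφlc0 q hp).1 hp0)]
      exact hs a b hab _ (by simp)
    · exact hs a b hab q (Multiset.mem_add.2 (Or.inl ((Multiset.mem_erase_of_ne hqp).2 hq)))
  · push Not at hlc
    obtain ⟨Z, hZ, hc, hs⟩ := hΨb2 φ₁ φ₂ fun c hc => hφ c (Or.inr hc)
    have hflc := hlc f hf hf1
    have hflc2 : φ₂ f.leadingCoeff ≠ 0 := fun h => hflc ((hφlc0 f hf).2 h)
    have hf'1 := leadingCoeff_derivative_ne_zero φ₁ hf1 hflc
    have hf'2 := leadingCoeff_derivative_ne_zero φ₂ hf1 hflc2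
    let Q : Set (R₁[X] × R₂[X]) := {q | ∃ p ∈ f.derivative ::ₘ Φ.erase f,
      φ₁ p.leadingCoeff ≠ 0 ∧ φ₂ p.leadingCoeff ≠ 0 ∧ q = (p.map φ₁, p.map φ₂)}
    have hmem : ∀ p ∈ f.derivative ::ₘ Φ.erase f,
        p ∈ Φ.erase f + (f.derivative ::ₘ (f.derivative ::ₘ Φ.erase f).map r) := by
      intro p hp
      rcases Multiset.mem_cons.1 hp with rfl | hp
      · exact Multiset.mem_add.2 (Or.inr (Multiset.mem_cons_self _ _))
      · exact Multiset.mem_add.2 (Or.inl hp)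
    obtain ⟨Z', hZ', hc', hs'⟩ := exists_chart_insert hZ hc (Q := Q)
      (by
        rintro _ ⟨p, hp, h1, h2, rfl⟩
        exact ⟨map_ne_zero_of_leadingCoeff _ h1, map_ne_zero_of_leadingCoeff _ h2⟩)
      (by
        rintro a b hab _ ⟨p, hp, h1, h2, rfl⟩
        exact hs a b hab p (hmem p hp))
      (map_ne_zero_of_leadingCoeff _ hflc) (map_ne_zero_of_leadingCoeff _ hflc2)
      ⟨f.derivative, Multiset.mem_cons_self _ _, hf'1, hf'2, by
        rw [derivative_map, derivative_map]⟩
      (by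
        rintro z hz _ ⟨p, hp, h1, h2, rfl⟩ hz0
        have hz0' : (p.map φ₂).eval z.2 = 0 := by
          rw [← sign_eq_zero_iff, ← hs _ _ (hc z hz) p (hmem p hp), sign_eq_zero_iff]
          exact hz0
        have hpd : 0 < p.natDegree := by
          by_contra h0
          have h0 : p.natDegree = 0 := by lia
          rw [eq_C_of_natDegree_eq_zero h0, map_C, eval_C] at hz0
          rw [leadingCoeff, h0] at h1
          exact h1 hz0
        rw [sign_eval_eq_of_mod (hr p hpd) φ₁ h1 hz0, sign_eval_eq_of_mod (hr p hpd) φ₂ h2 hz0']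
        refine hs _ _ (hc z hz) _ (Multiset.mem_add.2 (Or.inr (Multiset.mem_cons_of_mem ?_)))
        exact Multiset.mem_map_of_mem r hp)
    refine ⟨Z', hZ', hc', fun a b hab q hq => ?_⟩
    by_cases hqf : q = f
    · rw [hqf]; exact (hs' a b hab).1
    · have hq' : q ∈ Φ.erase f := (Multiset.mem_erase_of_ne hqf).2 hq
      by_cases hq0 : φ₁ q.leadingCoeff = 0
      · have hqd : q.natDegree = 0 := by
          by_contra h0
          exact hlc q hq (Nat.pos_of_ne_zero h0) hq0
        rw [eq_C_of_natDegree_eq_zero hqd, map_C, map_C, eval_C, eval_C]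
        have := hφlc q hq
        rwa [leadingCoeff, hqd] at this
      · exact (hs' a b hab).2 _ ⟨q, Multiset.mem_cons_of_mem hq', hq0,
          fun h => hq0 ((hφlc0 q hq).2 h), rfl⟩

end ChartExistence

section Transfer

variable {R : Type*} [Field R] [LinearOrder R] [IsStrictOrderedRing R] [HasIVT R] [Algebra ℝ R]

lemma eval_map_finSuccEquiv {B : Type*} [CommRing B] [Algebra ℝ B] (n : ℕ)
    (x : Fin (n + 1) → B) (f : MvPolynomial (Fin (n + 1)) ℝ) :
    ((MvPolynomial.finSuccEquiv ℝ n f).map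
      (MvPolynomial.aeval (fun i => x i.succ) : MvPolynomial (Fin n) ℝ →ₐ[ℝ] B).toRingHom).eval
        (x 0) = MvPolynomial.aeval x f := by
  induction f using MvPolynomial.induction_on with
  | C a =>
    rw [MvPolynomial.finSuccEquiv_apply]
    simp
  | add p q hp hq => simp only [map_add, Polynomial.map_add, Polynomial.eval_add, hp, hq]
  | mul_X p i hp =>
    rw [map_mul, Polynomial.map_mul, Polynomial.eval_mul, hp, map_mul, MvPolynomial.aeval_X]
    congr 1
    refine Fin.cases ?_ (fun j => ?_) i
    · simp [MvPolynomial.finSuccEquiv_X_zero]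
    · simp [MvPolynomial.finSuccEquiv_X_succ]

lemma sign_algebraMap_real (c : ℝ) :
    SignType.sign (algebraMap ℝ R c) = SignType.sign c := by
  have hpos : ∀ c : ℝ, 0 < c → 0 < algebraMap ℝ R c := by
    intro c hc
    have : algebraMap ℝ R c = algebraMap ℝ R (Real.sqrt c) ^ 2 := by
      rw [← map_pow, Real.sq_sqrt hc.le]
    rw [this]
    have h0 : algebraMap ℝ R (Real.sqrt c) ≠ 0 := by
      simpa using (Real.sqrt_pos.2 hc).ne'
    positivity
  rcases lt_trichotomy c 0 with h | h | h
  · have := hpos (-c) (by linarith)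
    rw [map_neg] at this
    rw [sign_neg h, sign_neg (by linarith)]
  · simp [h]
  · rw [sign_pos h, sign_pos (hpos c h)]

lemma exists_real_point_sign (n : ℕ) {Γ : Set (MvPolynomial (Fin n) ℝ)} (hΓ : Γ.Finite)
    (x : Fin n → R) : ∃ y : Fin n → ℝ, ∀ f ∈ Γ,
      SignType.sign (MvPolynomial.aeval x f) = SignType.sign (MvPolynomial.aeval y f) := by
  induction n with
  | zero =>
    refine ⟨fun _ => 0, fun f _ => ?_⟩
    rw [MvPolynomial.eq_C_of_isEmpty f]
    simp [sign_algebraMap_real]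
  | succ n ih =>
    obtain ⟨Ψ, hΨ, h⟩ := exists_sign_chart R ℝ
      (hΓ.toFinset.val.map (MvPolynomial.finSuccEquiv ℝ n))
    obtain ⟨y, hy⟩ := ih hΨ (fun i => x i.succ)
    obtain ⟨Z, hZ, hc, hs⟩ := h
      (MvPolynomial.aeval (fun i => x i.succ) : MvPolynomial (Fin n) ℝ →ₐ[ℝ] R).toRingHom
      (MvPolynomial.aeval y : MvPolynomial (Fin n) ℝ →ₐ[ℝ] ℝ).toRingHom hy
    obtain ⟨b, hb⟩ := exists_samePos hZ hc (x 0)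
    refine ⟨Fin.cons b y, fun f hf => ?_⟩
    rw [← eval_map_finSuccEquiv n x f, ← eval_map_finSuccEquiv n (Fin.cons b y) f]
    exact hs (x 0) b hb _ (Multiset.mem_map_of_mem _ (by simpa using hf))

/-- A finite system of real polynomial equations solvable in an ordered extension field with the
intermediate value property is solvable over the reals. -/
theorem exists_real_solution {σ : Type*} [Finite σ] {Γ : Set (MvPolynomial σ ℝ)} (hΓ : Γ.Finite)
    (x : σ → R) (hx : ∀ f ∈ Γ, MvPolynomial.aeval x f = 0) :
    ∃ y : σ → ℝ, ∀ f ∈ Γ, MvPolynomial.aeval y f = 0 := by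
  obtain ⟨n, ⟨e⟩⟩ := Finite.exists_equiv_fin σ
  obtain ⟨y, hy⟩ := exists_real_point_sign n (hΓ.image (MvPolynomial.rename e)) (x ∘ e.symm)
  refine ⟨y ∘ e, fun f hf => ?_⟩
  have h := hy _ ⟨f, hf, rfl⟩
  rw [MvPolynomial.aeval_rename, MvPolynomial.aeval_rename, Function.comp_assoc,
    e.symm_comp_self, Function.comp_id, hx f hf, sign_zero] at h
  exact sign_eq_zero_iff.1 h.symm

end Transfer

section Newton

open Polynomial

variable {A A₁ : Type*} [CommRing A] [Algebra ℝ A] [CommRing A₁] [Algebra ℝ A₁]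

/-- The solution `c` of the Newton recurrence
`(l + 1) * c (l + 1) = w * ∑ j ≤ l, (-1) ^ j * p j * c (l - j)` with `c 0 = 1`. -/
def newt (w : ℝ) (p : ℕ → A) : ℕ → A
  | 0 => 1
  | l + 1 => (w / (l + 1) : ℝ) • ∑ j : Fin (l + 1), (-1) ^ (j : ℕ) * p j * newt w p (l - j)

theorem newt_zero (w : ℝ) (p : ℕ → A) : newt w p 0 = 1 := by
  rw [newt]

theorem newt_succ (w : ℝ) (p : ℕ → A) (l : ℕ) :
    (l + 1 : A) * newt w p (l + 1) =
      w • ∑ j ∈ Finset.range (l + 1), (-1) ^ j * p j * newt w p (l - j) := by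
  rw [newt, ← Finset.sum_range (fun j => (-1) ^ j * p j * newt w p (l - j))]
  have h : (l + 1 : A) = algebraMap ℝ A (l + 1) := by simp
  rw [h, ← Algebra.smul_def, smul_smul]
  congr 1
  field_simp

theorem newt_unique {w : ℝ} {p c : ℕ → A} (h0 : c 0 = 1)
    (h : ∀ l : ℕ, (l + 1 : A) * c (l + 1) =
      w • ∑ j ∈ Finset.range (l + 1), (-1) ^ j * p j * c (l - j)) (l : ℕ) :
    newt w p l = c l := by
  induction l using Nat.strong_induction_on with
  | _ l ih =>
    rcases l with _ | l
    · rw [newt_zero, h0]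
    · have h1 := newt_succ w p l
      have h2 := h l
      have h3 : ∑ j ∈ Finset.range (l + 1), (-1) ^ j * p j * newt w p (l - j) =
          ∑ j ∈ Finset.range (l + 1), (-1) ^ j * p j * c (l - j) :=
        Finset.sum_congr rfl fun j _ => by rw [ih (l - j) (by lia)]
      rw [h3, ← h2] at h1
      have h4 : (l + 1 : A) = algebraMap ℝ A (l + 1) := by simp
      rw [h4, ← Algebra.smul_def, ← Algebra.smul_def] at h1
      have h5 := congrArg (fun x => ((l + 1 : ℝ)⁻¹) • x) h1
      have h6 : ((l : ℝ) + 1) ≠ 0 := by positivity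
      simpa [smul_smul, h6] using h5

theorem map_newt (f : A →ₐ[ℝ] A₁) (w : ℝ) (p : ℕ → A) (l : ℕ) :
    f (newt w p l) = newt w (fun j => f (p j)) l := by
  refine (newt_unique (c := fun l => f (newt w p l)) ?_ ?_ l).symm
  · simp [newt_zero]
  · intro l
    have h := congrArg f (newt_succ w p l)
    simpa using h

end Newton

section MatrixNewton

open Polynomial

variable {ι : Type*} [Fintype ι] [DecidableEq ι]

theorem derivative_det {P : Type*} [CommRing P] (M : Matrix ι ι P[X]) :
    derivative M.det = (M.adjugate * M.map derivative).trace := by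
  have h1 : ∀ i, ∑ k, M.adjugate k i * derivative (M i k) =
      (M.updateRow i (fun k => derivative (M i k))).det := by
    intro i
    rw [← cramer_transpose_apply, cramer_eq_adjugate_mulVec, ← adjugate_transpose]
    rfl
  rw [trace_mul_comm, trace]
  simp only [diag_apply, mul_apply, map_apply]
  have h2 : ∀ i, ∑ k, derivative (M i k) * M.adjugate k i =
      ∑ σ : Equiv.Perm ι, (Equiv.Perm.sign σ : ℤ) •
        (derivative (M i (σ i)) * ∏ x ∈ Finset.univ.erase i, M x (σ x)) := by
    intro i
    rw [Finset.sum_congr rfl fun k _ => mul_comm _ _, h1, ← det_transpose, det_apply]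
    refine Finset.sum_congr rfl fun σ _ => ?_
    rw [← Finset.mul_prod_erase _ _ (Finset.mem_univ i)]
    simp only [transpose_apply, updateRow_self]
    congr 2
    refine Finset.prod_congr rfl fun x hx => ?_
    rw [updateRow_ne (Finset.ne_of_mem_erase hx)]
  rw [Finset.sum_congr rfl fun i _ => h2 i, Finset.sum_comm, ← det_transpose, det_apply,
    derivative_sum]
  refine Finset.sum_congr rfl fun σ _ => ?_
  rw [← Finset.smul_sum]
  simp only [transpose_apply]
  rw [Units.smul_def, derivative_smul, derivative_prod_finset]
  congr 1
  exact Finset.sum_congr rfl fun i _ => mul_comm _ _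

variable {P : Type*} [CommRing P]

/-- `det (1 + X M)`. -/
def detOneAdd (M : Matrix ι ι P) : P[X] :=
  ((X : P[X]) • M.map C + (1 : Matrix ι ι P).map C).det

theorem coeff_detOneAdd_eq_zero (M : Matrix ι ι P) {l : ℕ} (hl : Fintype.card ι < l) :
    (detOneAdd M).coeff l = 0 :=
  coeff_eq_zero_of_natDegree_lt ((natDegree_det_X_add_C_le M 1).trans_lt hl)

theorem coeff_detOneAdd_zero (M : Matrix ι ι P) : (detOneAdd M).coeff 0 = 1 := by
  rw [detOneAdd, coeff_det_X_add_C_zero, det_one]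

theorem coeff_derivative_detOneAdd (M : Matrix ι ι P) (l : ℕ) :
    (derivative (detOneAdd M)).coeff l =
      ∑ j ∈ Finset.range (l + 1),
        (-1) ^ j * (M ^ (j + 1)).trace * (detOneAdd M).coeff (l - j) := by
  set N : Matrix ι ι P[X] := (X : P[X]) • M.map C + (1 : Matrix ι ι P).map C with hN
  set M' : Matrix ι ι P[X] := M.map C with hM'
  have hf : detOneAdd M = N.det := rfl
  have hN' : N = (X : P[X]) • M' + 1 := by
    rw [hN]; congr 1; ext i j; simp [Matrix.one_apply, apply_ite C]
  have hd : N.map derivative = M' := by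
    ext1 i j
    simp [hN', hM', Matrix.one_apply, apply_ite derivative]
  have htr : ∀ j, (M' ^ j).trace = C ((M ^ j).trace) := by
    intro j
    have h : M' ^ j = (M ^ j).map C := (Matrix.map_pow M (C : P →+* P[X]) j).symm
    rw [h, AddMonoidHom.map_trace]
  have key : ∀ j, (N.adjugate * M' ^ (j + 1)).trace =
      C ((M ^ (j + 1)).trace) * N.det - X * (N.adjugate * M' ^ (j + 2)).trace := by
    intro j
    have h1 : N.adjugate * N * M' ^ (j + 1) = N.det • M' ^ (j + 1) := by
      rw [adjugate_mul, Matrix.smul_mul, Matrix.one_mul]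
    have h2 : N.adjugate * N * M' ^ (j + 1) =
        (X : P[X]) • (N.adjugate * M' ^ (j + 2)) + N.adjugate * M' ^ (j + 1) := by
      conv_lhs => enter [1, 2]; rw [hN']
      rw [Matrix.mul_add, Matrix.mul_one, Matrix.add_mul, Matrix.mul_smul, Matrix.smul_mul,
        Matrix.mul_assoc, ← pow_succ']
    have h3 := congrArg Matrix.trace (h2.symm.trans h1)
    rw [trace_add, trace_smul, trace_smul, htr, smul_eq_mul, smul_eq_mul] at h3
    linear_combination h3
  have main : ∀ l j, ((N.adjugate * M' ^ (j + 1)).trace).coeff l =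
      ∑ i ∈ Finset.range (l + 1),
        (-1) ^ i * (M ^ (i + j + 1)).trace * N.det.coeff (l - i) := by
    intro l
    induction l with
    | zero =>
      intro j
      rw [key]
      simp
    | succ l ih =>
      intro j
      rw [key, coeff_sub, coeff_C_mul, coeff_X_mul, ih (j + 1), Finset.sum_range_succ' _ (l + 1)]
      rw [sub_eq_add_neg, add_comm, ← Finset.sum_neg_distrib]
      congr 1
      · refine Finset.sum_congr rfl fun i _ => ?_
        rw [show i + (j + 1) + 1 = i + 1 + j + 1 by ring, Nat.add_sub_add_right]
        ring
      · simp
  rw [hf, derivative_det, hd]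
  simpa using main l 0

variable [Algebra ℝ P]

theorem newt_trace_eq_coeff (M : Matrix ι ι P) (l : ℕ) :
    newt 1 (fun j => (M ^ (j + 1)).trace) l = (detOneAdd M).coeff l := by
  refine newt_unique (coeff_detOneAdd_zero M) (fun l => ?_) l
  rw [one_smul, ← coeff_derivative_detOneAdd, coeff_derivative, mul_comm]

theorem newt_trace_eq_zero (M : Matrix ι ι P) {l : ℕ} (hl : Fintype.card ι < l) :
    newt 1 (fun j => (M ^ (j + 1)).trace) l = 0 := by
  rw [newt_trace_eq_coeff, coeff_detOneAdd_eq_zero M hl]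

end MatrixNewton

section SkewDet

open Polynomial

theorem isSquare_det_of_skew {F : Type*} [Field F] [CharZero F] (m : ℕ) :
    ∀ {ι : Type} [Fintype ι] [DecidableEq ι], Fintype.card ι = m →
      ∀ A : Matrix ι ι F, Aᵀ = -A → IsSquare A.det := by
  induction m using Nat.strong_induction_on with
  | _ m ih =>
    intro ι _ _ hm A hA
    have hsk : ∀ x y, A y x = - A x y := fun x y => congrFun (congrFun hA x) y
    have hdiag : ∀ x, A x x = 0 := fun x => by
      have h := hsk x x
      exact self_eq_neg.1 h
    by_cases hA0 : ∃ i j, A i j ≠ 0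
    · obtain ⟨i, j, hij⟩ := hA0
      have hne : i ≠ j := fun h => hij (h ▸ hdiag i)
      set p : ι → Prop := fun x => x = i ∨ x = j with hp
      set A₁ := toBlock A p p with hA1
      set B := toBlock A p (fun x => ¬ p x) with hB
      set D := toBlock A (fun x => ¬ p x) (fun x => ¬ p x) with hD
      have hA1t : A₁ᵀ = -A₁ := by ext x y; exact hsk _ _
      have hDt : Dᵀ = -D := by ext x y; exact hsk _ _
      have hC : toBlock A (fun x => ¬ p x) p = -Bᵀ := by ext x y; exact hsk _ _
      have hdet : A₁.det = A i j * A i j := by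
        let e : Fin 2 → {x // p x} := ![⟨i, Or.inl rfl⟩, ⟨j, Or.inr rfl⟩]
        have he : Function.Bijective e := by
          constructor
          · intro a b hab
            have h01 : e 0 ≠ e 1 := fun h => hne (congrArg Subtype.val h)
            fin_cases a <;> fin_cases b
            · rfl
            · exact absurd hab h01
            · exact absurd hab.symm h01
            · rfl
          · rintro ⟨x, rfl | rfl⟩
            · exact ⟨0, rfl⟩
            · exact ⟨1, rfl⟩
        rw [← det_submatrix_equiv_self (Equiv.ofBijective e he) A₁, det_fin_two]
        have h00 : A₁ (e 0) (e 0) = 0 := hdiag i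
        have h01 : A₁ (e 0) (e 1) = A i j := rfl
        have h10 : A₁ (e 1) (e 0) = - A i j := hsk i j
        simp [h00, h01, h10]
      have hunit : IsUnit A₁.det := by
        rw [hdet]; exact (mul_ne_zero hij hij).isUnit
      have hinv : Invertible A₁ := invertibleOfIsUnitDet A₁ hunit
      rw [det_toBlock A p, hC, det_fromBlocks₁₁]
      refine IsSquare.mul ⟨_, hdet⟩ ?_
      have hlt : Fintype.card {x // ¬ p x} < m := by
        rw [← hm]
        exact Fintype.card_subtype_lt (x := i) (fun h => h (Or.inl rfl))
      refine ih _ hlt rfl _ ?_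
      have hAi : (⅟A₁)ᵀ = -⅟A₁ := by
        rw [invOf_eq_nonsing_inv, transpose_nonsing_inv, hA1t]
        refine inv_eq_left_inv ?_
        rw [neg_mul_neg, nonsing_inv_mul _ hunit]
      rw [transpose_sub, transpose_mul, transpose_mul, hAi, hDt, transpose_neg,
        transpose_transpose]
      simp only [Matrix.mul_neg, Matrix.neg_mul, neg_neg, Matrix.mul_assoc]
      abel
    · push Not at hA0
      have : A = 0 := by ext x y; exact hA0 x y
      rcases isEmpty_or_nonempty ι with h | h
      · exact ⟨1, by simp⟩
      · exact ⟨0, by simp [this]⟩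

variable {ι : Type} [Fintype ι] [DecidableEq ι]

theorem isSquare_det_one_add_mul {F : Type*} [Field F] [CharZero F] {J K : Matrix ι ι F}
    (hJ : Jᵀ = -J) (hK : Kᵀ = -K) : IsSquare (1 + J * K).det := by
  have h1 : IsSquare (fromBlocks K 1 (-1) J).det :=
    isSquare_det_of_skew _ rfl _ (by
      rw [fromBlocks_transpose, hJ, hK, fromBlocks_neg]; simp)
  have h2 : IsSquare (fromBlocks (0 : Matrix ι ι F) (-1) 1 (0 : Matrix ι ι F)).det :=
    isSquare_det_of_skew _ rfl _ (by
      rw [fromBlocks_transpose, fromBlocks_neg]; simp)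
  have h3 : fromBlocks K 1 (-1) J * fromBlocks 1 0 (-K) 1 *
      fromBlocks (0 : Matrix ι ι F) (-1) 1 (0 : Matrix ι ι F) =
      fromBlocks 1 0 J (1 + J * K) := by
    simp [fromBlocks_multiply, add_comm]
  have h4 := congrArg det h3
  rw [det_mul, det_mul, det_fromBlocks_zero₁₂, det_fromBlocks_zero₁₂, det_one, mul_one, mul_one,
    one_mul] at h4
  rw [← h4]
  exact h1.mul h2

theorem isSquare_detOneAdd {F : Type*} [Field F] [CharZero F] {J K : Matrix ι ι F}
    (hJ : Jᵀ = -J) (hK : Kᵀ = -K) : IsSquare (detOneAdd (J * K)) := by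
  let f : F[X] →+* FractionRing F[X] := algebraMap _ _
  have hf : Function.Injective f := IsFractionRing.injective _ _
  let J' : Matrix ι ι (FractionRing F[X]) := ((X : F[X]) • J.map C).map f
  let K' : Matrix ι ι (FractionRing F[X]) := (K.map C).map f
  have hJ' : J'ᵀ = -J' := by
    ext x y
    have h : J y x = - J x y := congrFun (congrFun hJ x) y
    simp [J', h]
  have hK' : K'ᵀ = -K' := by
    ext x y
    have h : K y x = - K x y := congrFun (congrFun hK x) y
    simp [K', h]
  have hchar : CharZero (FractionRing F[X]) := charZero_of_injective_algebraMap hf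
  obtain ⟨r, hr⟩ := isSquare_det_one_add_mul hJ' hK'
  have h1 : (1 + J' * K').det = f (detOneAdd (J * K)) := by
    rw [detOneAdd, RingHom.map_det]
    congr 1
    ext x y
    simp [J', K', Matrix.mul_apply, Matrix.one_apply, apply_ite, add_comm, Finset.mul_sum]
    exact Finset.sum_congr rfl fun _ _ => by ring
  rw [h1] at hr
  obtain ⟨q, hq⟩ := IsIntegrallyClosed.exists_algebraMap_eq_of_isIntegral_pow
    (R := F[X]) (K := FractionRing F[X]) (x := r) (n := 2) two_pos (by
      rw [pow_two, ← hr]; exact isIntegral_algebraMap)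
  refine ⟨q, hf ?_⟩
  rw [hr, map_mul]
  exact congrArg₂ _ hq.symm hq.symm

theorem newt_half_eq_zero_of_field {F : Type*} [Field F] [Algebra ℝ F] {J K : Matrix ι ι F}
    (hJ : Jᵀ = -J) (hK : Kᵀ = -K) {l : ℕ} (hl : Fintype.card ι < l) :
    newt (1 / 2) (fun j => ((J * K) ^ (j + 1)).trace) l = 0 := by
  have hchar : CharZero F := charZero_of_injective_algebraMap (algebraMap ℝ F).injective
  obtain ⟨q, hq⟩ := isSquare_detOneAdd hJ hK
  have hq0 : q.coeff 0 * q.coeff 0 = 1 := by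
    rw [← mul_coeff_zero, ← hq, coeff_detOneAdd_zero]
  have hq00 : q.coeff 0 ≠ 0 := fun h => by simp [h] at hq0
  have hqne : q ≠ 0 := fun h => by simp [h] at hq0
  have hdeg : q.natDegree < l := by
    have h1 : (detOneAdd (J * K)).natDegree ≤ Fintype.card ι :=
      natDegree_det_X_add_C_le (J * K) 1
    rw [hq, natDegree_mul hqne hqne] at h1
    lia
  have hval : ∀ l, newt (1 / 2) (fun j => ((J * K) ^ (j + 1)).trace) l =
      q.coeff 0 * q.coeff l := by
    have hS : (derivative (q * q) : F[X]).toPowerSeries =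
        PowerSeries.mk (fun j => (-1) ^ j * ((J * K) ^ (j + 1)).trace) *
          (q.toPowerSeries * q.toPowerSeries) := by
      ext l
      rw [← Polynomial.coe_mul, Polynomial.coeff_coe, ← hq, coeff_derivative_detOneAdd,
        PowerSeries.coeff_mul, Finset.Nat.sum_antidiagonal_eq_sum_range_succ
          (fun a b => PowerSeries.coeff a (PowerSeries.mk
            (fun j => (-1) ^ j * ((J * K) ^ (j + 1)).trace)) *
            PowerSeries.coeff b (detOneAdd (J * K)).toPowerSeries)]
      simp
    have hq' : q.toPowerSeries ≠ 0 := by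
      rwa [Ne, Polynomial.coe_eq_zero_iff]
    have h2 : (2 : PowerSeries F) * (derivative q : F[X]).toPowerSeries =
        PowerSeries.mk (fun j => (-1) ^ j * ((J * K) ^ (j + 1)).trace) * q.toPowerSeries := by
      refine mul_right_cancel₀ hq' ?_
      rw [mul_assoc _ q.toPowerSeries, ← hS, derivative_mul, Polynomial.coe_add,
        Polynomial.coe_mul, Polynomial.coe_mul]
      ring
    refine newt_unique hq0 fun l => ?_
    have h3 := congrArg (PowerSeries.coeff l) h2
    rw [PowerSeries.coeff_mul (n := l) (PowerSeries.mk _),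
      Finset.Nat.sum_antidiagonal_eq_sum_range_succ
        (fun a b => PowerSeries.coeff a (PowerSeries.mk
          (fun j => (-1) ^ j * ((J * K) ^ (j + 1)).trace)) *
          PowerSeries.coeff b q.toPowerSeries), two_mul, map_add, Polynomial.coeff_coe,
      coeff_derivative] at h3
    simp only [PowerSeries.coeff_mk, Polynomial.coeff_coe] at h3
    have h4 : ∑ j ∈ Finset.range (l + 1), (-1) ^ j * ((J * K) ^ (j + 1)).trace *
        (q.coeff 0 * q.coeff (l - j)) =
        q.coeff 0 * (q.coeff (l + 1) * (l + 1) + q.coeff (l + 1) * (l + 1)) := by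
      rw [h3, Finset.mul_sum]
      exact Finset.sum_congr rfl fun _ _ => by ring
    rw [h4, ← two_mul, Algebra.smul_def, map_div₀, map_one, map_ofNat]
    ring
  rw [hval, coeff_eq_zero_of_natDegree_lt hdeg, mul_zero]

theorem newt_half_eq_zero {P : Type*} [CommRing P] [IsDomain P] [Algebra ℝ P]
    {J K : Matrix ι ι P} (hJ : Jᵀ = -J) (hK : Kᵀ = -K) {l : ℕ} (hl : Fintype.card ι < l) :
    newt (1 / 2) (fun j => ((J * K) ^ (j + 1)).trace) l = 0 := by
  let f : P →ₐ[ℝ] FractionRing P := IsScalarTower.toAlgHom ℝ P (FractionRing P)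
  have hf : Function.Injective f := IsFractionRing.injective P (FractionRing P)
  refine hf ?_
  rw [map_newt, map_zero]
  have hJ' : (f.mapMatrix J)ᵀ = - f.mapMatrix J := by
    rw [← map_neg, ← hJ]; rfl
  have hK' : (f.mapMatrix K)ᵀ = - f.mapMatrix K := by
    rw [← map_neg, ← hK]; rfl
  have h : (fun j => f ((J * K) ^ (j + 1)).trace) =
      fun j => ((f.mapMatrix J * f.mapMatrix K) ^ (j + 1)).trace := by
    funext j
    rw [← map_mul, ← map_pow]
    exact AddMonoidHom.map_trace (f : P →+ FractionRing P) _
  rw [h]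
  exact newt_half_eq_zero_of_field hJ' hK' hl

end SkewDet

section NewtonInteger

variable {R : Type*} [Field R] [Algebra ℝ R]

theorem exists_nat_of_newt_const {t : R} {p : ℕ → R} (hp : ∀ j, p j = t) {N : ℕ}
    (hN : ∀ l, N < l → newt 1 p l = 0) : ∃ m : ℕ, t = m := by
  by_contra! hne
  have hrec : ∀ l : ℕ, ((l : R) + 1) * newt 1 p (l + 1) = (t - l) * newt 1 p l := by
    intro l
    rw [newt_succ, one_smul]
    simp only [hp]
    cases l with
    | zero => simp
    | succ l =>
      have h := newt_succ 1 p l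
      rw [one_smul] at h
      simp only [hp] at h
      rw [Finset.sum_range_succ']
      simp only [Nat.add_sub_add_right, pow_succ, mul_neg, mul_one, neg_mul,
        Finset.sum_neg_distrib]
      rw [← h]
      push_cast
      simp
      ring
  have hnz : ∀ l, newt 1 p l ≠ 0 := by
    intro l
    induction l with
    | zero => rw [newt_zero]; exact one_ne_zero
    | succ l ih =>
      intro h
      have h1 := hrec l
      rw [h, mul_zero] at h1
      exact mul_ne_zero (sub_ne_zero.2 (hne l)) ih h1.symm
  exact hnz (N + 1) (hN _ (Nat.lt_succ_self N))

theorem exists_even_of_newt {w : ℝ} {t : R} {p : ℕ → R} (h0 : p 0 = 0) (h1 : p 1 = -t)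
    (h2 : ∀ j, p (j + 2) = - p j) {N : ℕ} (hN : ∀ l, N < l → newt w p l = 0) :
    ∃ m : ℕ, w • t = (2 * m : ℕ) := by
  by_contra! hne
  have hrec : ∀ l : ℕ, ((l : R) + 2) * newt w p (l + 2) = (w • t - l) * newt w p l := by
    intro l
    have h := newt_succ w p (l + 1)
    cases l with
    | zero =>
      simp [Finset.sum_range_succ, h0, h1, newt_zero] at h ⊢
      rw [← h]; ring
    | succ l =>
      have h' := newt_succ w p l
      rw [Finset.sum_range_succ', Finset.sum_range_succ'] at h
      have h3 : ∑ k ∈ Finset.range (l + 1),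
          (-1) ^ (k + 1 + 1) * p (k + 1 + 1) * newt w p (l + 1 + 1 - (k + 1 + 1)) =
          - ∑ k ∈ Finset.range (l + 1), (-1) ^ k * p k * newt w p (l - k) := by
        rw [← Finset.sum_neg_distrib]
        refine Finset.sum_congr rfl fun k _ => ?_
        rw [h2, Nat.add_sub_add_right, Nat.add_sub_add_right]
        ring
      rw [h3, smul_add, smul_add, smul_neg, ← h'] at h
      simp only [zero_add, h0, h1, pow_one, mul_neg, neg_mul, one_mul, neg_neg, mul_zero,
        zero_mul, smul_zero, add_zero, Nat.add_sub_cancel] at h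
      rw [← smul_mul_assoc] at h
      push_cast at h ⊢
      linear_combination h
  have hnz : ∀ l, newt w p (2 * l) ≠ 0 := by
    intro l
    induction l with
    | zero => rw [mul_zero, newt_zero]; exact one_ne_zero
    | succ l ih =>
      intro h
      have h1 := hrec (2 * l)
      rw [show 2 * l + 2 = 2 * (l + 1) by ring, h, mul_zero] at h1
      exact mul_ne_zero (sub_ne_zero.2 (hne l)) ih h1.symm
  exact hnz (N + 1) (hN _ (by lia))

end NewtonInteger

section TraceForm

/-- A positive definite tracial functional on an algebra with involution whose power traces
satisfy the identities of the traces of `n × n` matrices. -/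
structure IsTraceForm {R B : Type*} [Field R] [LinearOrder R] [Algebra ℝ R] [Ring B]
    [Algebra R B] [StarRing B] (n : ℕ) (τ : B →ₗ[R] R) : Prop where
  star_smul : ∀ (r : R) (b : B), star (r • b) = r • star b
  comm : ∀ a b, τ (a * b) = τ (b * a)
  trace_star : ∀ a, τ (star a) = τ a
  pos : ∀ a, a ≠ 0 → 0 < τ (star a * a)
  newt_one : ∀ b, ∀ l, n < l → newt 1 (fun j => τ (b ^ (j + 1))) l = 0
  newt_half : ∀ J K, star J = -J → star K = -K → ∀ l, n < l →
    newt (1 / 2) (fun j => τ ((J * K) ^ (j + 1))) l = 0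

variable {R : Type*} [Field R] [LinearOrder R] [IsStrictOrderedRing R] [IsMaxOrdered R]
  [Algebra ℝ R] {B : Type*} [Ring B] [Algebra R B] [StarRing B] {n : ℕ} {τ : B →ₗ[R] R}

namespace IsTraceForm

theorem nonneg (h : IsTraceForm n τ) (a : B) : 0 ≤ τ (star a * a) := by
  rcases eq_or_ne a 0 with rfl | ha
  · simp
  · exact (h.pos a ha).le

theorem eq_zero (h : IsTraceForm n τ) {a : B} (ha : τ (star a * a) = 0) : a = 0 := by
  by_contra hne
  exact (h.pos a hne).ne' ha

theorem eq_zero_of_sq (h : IsTraceForm n τ) {a : B} (ha : star a = a) (h2 : a * a = 0) :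
    a = 0 := h.eq_zero (by rw [ha, h2, map_zero])

theorem exists_nat (h : IsTraceForm n τ) {e : B} (he : e * e = e) : ∃ m : ℕ, τ e = m := by
  have hp : ∀ j : ℕ, e ^ (j + 1) = e := fun j => IsIdempotentElem.pow_succ_eq j he
  exact exists_nat_of_newt_const (fun j => by rw [hp]) (h.newt_one e)

theorem trace_skew (h : IsTraceForm n τ) {u : B} (hu : star u = -u) : τ u = 0 := by
  have h1 := h.trace_star u
  rw [hu, map_neg] at h1
  exact neg_eq_self.1 h1

theorem exists_even_of_skew (h : IsTraceForm n τ) {e u : B} (hu : star u = -u)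
    (huu : u * u = -e) (hue : u * e = u) :
    ∃ m : ℕ, τ e = (2 * m : ℕ) := by
  have h1 := exists_even_of_newt (w := 1) (t := τ e) (p := fun j => τ (u ^ (j + 1)))
    (by simpa using h.trace_skew hu) (by simp [pow_succ, huu])
    (fun j => by
      rw [show u ^ (j + 2 + 1) = u ^ (j + 1) * (u * u) by rw [← pow_two, ← pow_add], huu, mul_neg,
        map_neg, pow_succ, mul_assoc, hue]) (h.newt_one u)
  simpa using h1

theorem exists_four_mul_of_skew (h : IsTraceForm n τ) {e J K : B} (hJ : star J = -J)
    (hK : star K = -K) (hJK : J * K = -(K * J)) (huu : (J * K) * (J * K) = -e)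
    (hue : K * e = K) :
    ∃ m : ℕ, τ e = (4 * m : ℕ) := by
  have hs : star (J * K) = -(J * K) := by
    rw [star_mul, hJ, hK, neg_mul_neg, hJK, neg_neg]
  obtain ⟨m, hm⟩ := exists_even_of_newt (w := 1 / 2) (t := τ e)
    (p := fun j => τ ((J * K) ^ (j + 1)))
    (by simpa using h.trace_skew hs) (by simp [pow_succ, huu])
    (fun j => by
      rw [show (J * K) ^ (j + 2 + 1) = (J * K) ^ (j + 1) * ((J * K) * (J * K)) by
        rw [← pow_two, ← pow_add], huu, mul_neg,
        map_neg, pow_succ, mul_assoc, mul_assoc J, hue]) (h.newt_half J K hJ hK)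
  refine ⟨m, ?_⟩
  rw [Algebra.smul_def, map_div₀, map_one, map_ofNat] at hm
  push_cast at hm ⊢
  linear_combination 2 * hm

end IsTraceForm

end TraceForm

section Spectral

open Polynomial

variable {R : Type*} [Field R] [LinearOrder R] [IsStrictOrderedRing R] [IsMaxOrdered R]
  [Algebra ℝ R] {B : Type*} [Ring B] [Algebra R B] [StarRing B] {n : ℕ} {τ : B →ₗ[R] R}

namespace IsTraceForm

theorem star_aeval (h : IsTraceForm n τ) {a : B} (ha : star a = a) (p : R[X]) :
    star (aeval a p) = aeval a p := by
  rw [aeval_eq_sum_range, star_sum]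
  exact Finset.sum_congr rfl fun i _ => by rw [h.star_smul, star_pow, ha]

theorem isIntegral (h : IsTraceForm n τ) {a : B} (ha : star a = a) : IsIntegral R a := by
  set c : ℕ → R := newt 1 (fun j => τ (a ^ (j + 1))) with hc
  set p : R[X] := ∑ l ∈ Finset.range (n + 1), C ((-1) ^ l * c l) * X ^ (n - l + 1) with hp
  have hy : aeval a p = ∑ l ∈ Finset.range (n + 1), ((-1) ^ l * c l) • a ^ (n - l + 1) := by
    simp [hp, map_sum, Algebra.smul_def]
  have hk : ∀ k, τ (aeval a p * a ^ k) = 0 := by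
    intro k
    have h1 := newt_succ 1 (fun j => τ (a ^ (j + 1))) (n + k)
    rw [h.newt_one a _ (by lia), mul_zero, one_smul, ← Finset.sum_range_reflect] at h1
    have h2 : n + 1 ≤ n + k + 1 := by lia
    rw [← Finset.sum_range_add_sum_Ico _ h2] at h1
    have h3 : ∑ j ∈ Finset.Ico (n + 1) (n + k + 1), (-1 : R) ^ (n + k + 1 - 1 - j) *
        τ (a ^ (n + k + 1 - 1 - j + 1)) *
        newt 1 (fun j => τ (a ^ (j + 1))) (n + k - (n + k + 1 - 1 - j)) = 0 := by
      refine Finset.sum_eq_zero fun j hj => ?_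
      rw [Finset.mem_Ico] at hj
      rw [h.newt_one a _ (by lia), mul_zero]
    rw [h3, add_zero] at h1
    have h4 : τ (aeval a p * a ^ k) = (-1) ^ (n + k) * 0 := by
      rw [h1, hy, Finset.sum_mul, map_sum, Finset.mul_sum]
      refine Finset.sum_congr rfl fun l hl => ?_
      rw [Finset.mem_range] at hl
      rw [smul_mul_assoc, map_smul, ← pow_add, smul_eq_mul, ← mul_assoc, ← mul_assoc, ← pow_add,
        show n + k - (n + k + 1 - 1 - l) = l by lia,
        show n + k + 1 - 1 - l + 1 = n - l + 1 + k by lia]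
      obtain ⟨q, hq⟩ : ∃ q, n + k = q + l := ⟨n + k - l, by lia⟩
      rw [show n + k + (n + k + 1 - 1 - l) = 2 * q + l by lia,
        show (-1 : R) ^ (2 * q + l) = (-1) ^ l by rw [pow_add, pow_mul]; simp]
      ring
    rw [h4, mul_zero]
  have hy0 : aeval a p = 0 := by
    refine h.eq_zero ?_
    rw [h.star_aeval ha]
    conv_lhs => enter [2, 2]; rw [hy]
    rw [Finset.mul_sum, map_sum]
    refine Finset.sum_eq_zero fun l _ => ?_
    rw [mul_smul_comm, map_smul, hk, smul_zero]
  have hp0 : p ≠ 0 := by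
    intro h0
    have h1 : p.coeff (n + 1) = 1 := by
      rw [hp, finsetSum_coeff, Finset.sum_eq_single 0]
      · simp [hc, newt_zero, coeff_X_pow]
      · intro l hl hl0
        rw [Finset.mem_range] at hl
        rw [coeff_C_mul, coeff_X_pow, if_neg (by lia), mul_zero]
      · simp
    rw [h0] at h1
    simp at h1
  exact IsAlgebraic.isIntegral ⟨p, hp0, hy0⟩

theorem sum_sq_nonneg (h : IsTraceForm n τ) {a y : B} (ha : star a = a) (hy : star y = y)
    {s : R[X]} (hs : s ∈ AddSubmonoid.closure {q : R[X] | ∃ h, q = h ^ 2}) :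
    0 ≤ τ (y * aeval a s * y) := by
  induction hs using AddSubmonoid.closure_induction with
  | mem x hx =>
    obtain ⟨g, rfl⟩ := hx
    have := h.nonneg (aeval a g * y)
    rw [star_mul, h.star_aeval ha, hy] at this
    simpa [pow_two, mul_assoc] using this
  | zero => simp
  | add x z _ _ hx hz =>
    rw [map_add, mul_add, add_mul, map_add]
    exact add_nonneg hx hz

theorem splits_minpoly (h : IsTraceForm n τ) {a : B} (ha : star a = a) :
    (minpoly R a).Splits ∧ (minpoly R a).roots.Nodup := by
  have hint := h.isIntegral ha
  have hne := minpoly.ne_zero hint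
  have hmin : ∀ q r : R[X], minpoly R a = q * r → aeval a r = 0 → IsUnit q := by
    intro q r hqr hr
    obtain ⟨s, hs⟩ := minpoly.dvd R a hr
    have hr0 : r ≠ 0 := fun h0 => hne (by rw [hqr, h0, mul_zero])
    refine IsUnit.of_mul_eq_one s (mul_right_cancel₀ hr0 ?_)
    rw [one_mul]
    conv_rhs => rw [hs, hqr]
    ring
  constructor
  · rw [splits_iff_splits]
    refine Or.inr fun {g} hg hgd => ?_
    by_contra hdeg
    have h2 : 2 ≤ g.natDegree := by
      have h1 := hg.natDegree_pos
      have h3 : g.natDegree ≠ 1 := fun h3 => hdeg ((degree_eq_iff_natDegree_eq_of_pos one_pos).2 h3)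
      lia
    obtain ⟨s, hs, t, ht⟩ := IsMaxOrdered.irr g hg h2
    obtain ⟨q, hq⟩ := hgd
    have hys := h.star_aeval ha q
    have h0 : aeval a (1 + s) * aeval a q = 0 := by
      rw [← map_mul, show (1 + s) * q = minpoly R a * t by rw [ht, hq]; ring, map_mul,
        minpoly.aeval, zero_mul]
    refine hg.not_isUnit (hmin g q hq (h.eq_zero (le_antisymm ?_ (h.nonneg _))))
    have h1 := h.sum_sq_nonneg ha hys hs
    have h4 : τ (aeval a q * (aeval a (1 + s) * aeval a q)) = 0 := by rw [h0, mul_zero, map_zero]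
    rw [map_add, map_one, add_mul, one_mul, mul_add, map_add, ← mul_assoc] at h4
    rw [hys]
    linarith
  · rw [Multiset.nodup_iff_count_le_one]
    intro x
    by_contra! hx
    rw [count_roots] at hx
    have h2 : (X - C x) ^ 2 ∣ minpoly R a := (le_rootMultiplicity_iff hne).1 hx
    obtain ⟨q, hq⟩ := h2
    refine not_isUnit_X_sub_C x (hmin (X - C x) ((X - C x) * q) (by rw [hq]; ring)
      (h.eq_zero_of_sq (h.star_aeval ha _) ?_))
    rw [← map_mul, show (X - C x) * q * ((X - C x) * q) = minpoly R a * q by rw [hq]; ring,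
      map_mul, minpoly.aeval, zero_mul]

theorem exists_eigen (h : IsTraceForm n τ) {a : B} (ha : star a = a) {x : R}
    (hx : (minpoly R a).IsRoot x) :
    ∃ p : B, p ≠ 0 ∧ star p = p ∧ p * p = p ∧ a * p = x • p ∧ p * a = x • p := by
  have hint := h.isIntegral ha
  have hne := minpoly.ne_zero hint
  obtain ⟨q, hq⟩ := dvd_iff_isRoot.2 hx
  set y := aeval a q with hy
  have hys : star y = y := h.star_aeval ha q
  have hy0 : y ≠ 0 := by
    intro h0
    have h1 := minpoly.degree_le_of_ne_zero R a (p := q) (by rintro rfl; simp at hq; exact hne hq) h0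
    rw [hq] at h1
    have h2 : q ≠ 0 := by rintro rfl; simp at hq; exact hne hq
    rw [degree_mul, degree_X_sub_C, degree_eq_natDegree h2] at h1
    have h3 : 1 + q.natDegree ≤ q.natDegree := by exact_mod_cast h1
    lia
  have hay : a * y = x • y := by
    have h1 : aeval a ((X - C x) * q) = 0 := by rw [← hq, minpoly.aeval]
    rw [map_mul, map_sub, aeval_X, aeval_C, sub_mul, sub_eq_zero, ← Algebra.smul_def] at h1
    exact h1
  have hpy : ∀ r : R[X], aeval a r * y = r.eval x • y := by
    intro r
    have h1 : X - C x ∣ r - C (r.eval x) := X_sub_C_dvd_sub_C_eval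
    obtain ⟨s, hs⟩ := h1
    have h2 : r = s * (X - C x) + C (r.eval x) := by rw [mul_comm, ← hs]; ring
    conv_lhs => rw [h2]
    rw [map_add, map_mul, map_sub, aeval_X, aeval_C, aeval_C, add_mul, mul_assoc, sub_mul, hay,
      ← Algebra.smul_def, sub_self, mul_zero, zero_add, Algebra.smul_def]
  have hyy : y * y = q.eval x • y := hpy q
  have hqx : q.eval x ≠ 0 := by
    intro h0
    rw [h0, zero_smul] at hyy
    exact hy0 (h.eq_zero_of_sq hys hyy)
  refine ⟨(q.eval x)⁻¹ • y, smul_ne_zero (inv_ne_zero hqx) hy0, by rw [h.star_smul, hys], ?_, ?_, ?_⟩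
  · rw [smul_mul_smul_comm, hyy, smul_smul, inv_mul_cancel_right₀ hqx]
  · rw [mul_smul_comm, hay, smul_comm]
  · have h1 : y * a = x • y := by
      have h2 := congrArg star hay
      rwa [star_mul, h.star_smul, hys, ha] at h2
    rw [smul_mul_assoc, h1, smul_comm]

theorem exists_sqrt (h : IsTraceForm n τ) {a : B} (ha : star a = a)
    (hpos : ∀ b, 0 ≤ τ (b * a * star b)) : ∃ l : B, a = l * star l := by
  have hint := h.isIntegral ha
  have hne := minpoly.ne_zero hint
  have hroot : ∀ x, (minpoly R a).IsRoot x → 0 ≤ x := by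
    intro x hx
    obtain ⟨p, hp0, hps, hpp, hap, -⟩ := h.exists_eigen ha hx
    have h1 := hpos p
    rw [mul_assoc, hps, hap, mul_smul_comm, hpp, map_smul, smul_eq_mul] at h1
    have h2 := h.pos p hp0
    rw [hps, hpp] at h2
    exact nonneg_of_mul_nonneg_left h1 h2
  have hsq : ∀ x : R, ∃ y : R, 0 ≤ x → x = y ^ 2 := fun x => by
    by_cases hx : 0 ≤ x
    · obtain ⟨y, hy⟩ := IsMaxOrdered.sq x hx
      exact ⟨y, fun _ => hy⟩
    · exact ⟨0, fun h => absurd h hx⟩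
  choose f hf using hsq
  obtain ⟨hsp, hnd⟩ := h.splits_minpoly ha
  let g : R[X] := Lagrange.interpolate (minpoly R a).roots.toFinset id f
  have hg : minpoly R a ∣ g ^ 2 - X := by
    rcases eq_or_ne (g ^ 2 - X) 0 with h0 | h0
    · rw [h0]; exact dvd_zero _
    rw [hsp.dvd_iff_roots_le_roots hne h0, Multiset.le_iff_subset hnd]
    intro x hx
    rw [mem_roots h0, IsRoot, eval_sub, eval_pow, eval_X, sub_eq_zero]
    have h1 : g.eval (id x) = f x :=
      Lagrange.eval_interpolate_at_node f (Function.injective_id.injOn) (Multiset.mem_toFinset.2 hx)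
    rw [id] at h1
    rw [h1]
    exact (hf x (hroot x ((mem_roots hne).1 hx))).symm
  refine ⟨aeval a g, ?_⟩
  obtain ⟨t, ht⟩ := hg
  have h1 : aeval a (g ^ 2 - X) = 0 := by rw [ht, map_mul, minpoly.aeval, zero_mul]
  rw [h.star_aeval ha, ← pow_two, ← map_pow]
  rw [map_sub, aeval_X, sub_eq_zero] at h1
  exact h1.symm

end IsTraceForm

end Spectral

section Projections

variable {R : Type*} [Field R] [LinearOrder R] [IsStrictOrderedRing R] [IsMaxOrdered R]
  [Algebra ℝ R] {B : Type*} [Ring B] [Algebra R B] [StarRing B] {n : ℕ} {τ : B →ₗ[R] R}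

/-- A nonzero projection `e` such that the symmetric elements of `e B e` are scalars. -/
structure IsMinProj (R : Type*) {B : Type*} [Field R] [Ring B] [Algebra R B] [StarRing B]
    (e : B) : Prop where
  ne_zero : e ≠ 0
  star_eq : star e = e
  mul_self : e * e = e
  scalar : ∀ a, star a = a → e * a = a → a * e = a → ∃ r : R, a = r • e

namespace IsTraceForm

theorem trace_pos_of_proj (h : IsTraceForm n τ) {e : B} (he0 : e ≠ 0) (hes : star e = e)
    (hee : e * e = e) : 0 < τ e := by
  have h1 := h.pos e he0
  rwa [hes, hee] at h1

theorem exists_proj_lt (h : IsTraceForm n τ) {e : B} (he0 : e ≠ 0) (hes : star e = e)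
    (hee : e * e = e) (hmin : ¬ IsMinProj R e) :
    ∃ p : B, p ≠ 0 ∧ p ≠ e ∧ star p = p ∧ p * p = p ∧ e * p = p ∧ p * e = p := by
  obtain ⟨a, has, hea, hae, hns⟩ : ∃ a, star a = a ∧ e * a = a ∧ a * e = a ∧
      ∀ r : R, a ≠ r • e := by
    by_contra! hcon
    refine hmin ⟨he0, hes, hee, fun a h1 h2 h3 => ?_⟩
    obtain ⟨r, hr⟩ := hcon a h1 h2 h3
    exact ⟨r, hr⟩
  have hint := h.isIntegral has
  obtain ⟨hsp, hnd⟩ := h.splits_minpoly has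
  obtain ⟨x, hx, hx0⟩ : ∃ x, (minpoly R a).IsRoot x ∧ x ≠ 0 := by
    by_contra! hcon
    have hsub : (minpoly R a).roots ⊆ {0} := by
      intro x hx
      rw [Multiset.mem_singleton]
      exact hcon x (Polynomial.isRoot_of_mem_roots hx)
    have hle : (minpoly R a).roots ≤ {0} := (Multiset.le_iff_subset hnd).2 hsub
    have hdvd : minpoly R a ∣ Polynomial.X := by
      rw [hsp.dvd_iff_roots_le_roots (minpoly.ne_zero hint) Polynomial.X_ne_zero,
        Polynomial.roots_X]
      exact hle
    obtain ⟨t, ht⟩ := hdvd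
    have h1 : Polynomial.aeval a (Polynomial.X : Polynomial R) = 0 := by
      rw [ht, map_mul, minpoly.aeval, zero_mul]
    rw [Polynomial.aeval_X] at h1
    exact hns 0 (by rw [h1, zero_smul])
  obtain ⟨p, hp0, hps, hpp, hap, hpa⟩ := h.exists_eigen has hx
  have hp1 : p = x⁻¹ • (a * p) := by rw [hap, smul_smul, inv_mul_cancel₀ hx0, one_smul]
  have hp2 : p = x⁻¹ • (p * a) := by rw [hpa, smul_smul, inv_mul_cancel₀ hx0, one_smul]
  refine ⟨p, hp0, ?_, hps, hpp, ?_, ?_⟩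
  · rintro rfl
    exact hns x (by rw [← hap, hae])
  · rw [hp1, mul_smul_comm, ← mul_assoc, hea]
  · rw [hp2, smul_mul_assoc, mul_assoc, hae]

theorem exists_minProj_decomp_aux (h : IsTraceForm n τ) (m : ℕ) :
    ∀ e : B, star e = e → e * e = e → τ e = m →
      ∃ F : Finset B, (∀ f ∈ F, IsMinProj R f) ∧ (∀ f ∈ F, ∀ f' ∈ F, f ≠ f' → f * f' = 0) ∧
        (∀ f ∈ F, e * f = f ∧ f * e = f) ∧ ∑ f ∈ F, f = e := by
  classical
  induction m using Nat.strong_induction_on with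
  | _ m ih =>
    intro e hes hee hm
    rcases eq_or_ne e 0 with rfl | he0
    · exact ⟨∅, by simp, by simp, by simp, by simp⟩
    by_cases hmin : IsMinProj R e
    · refine ⟨{e}, by simpa using hmin, ?_, by simpa using hee, by simp⟩
      intro f hf f' hf' hne
      rw [Finset.mem_singleton] at hf hf'
      exact absurd (hf.trans hf'.symm) hne
    obtain ⟨p, hp0, hpe, hps, hpp, hep, hpe'⟩ := h.exists_proj_lt he0 hes hee hmin
    have hqs : star (e - p) = e - p := by rw [star_sub, hes, hps]
    have hqq : (e - p) * (e - p) = e - p := by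
      rw [mul_sub, sub_mul, sub_mul, hee, hpp, hep, hpe']; abel
    obtain ⟨m₁, hm₁⟩ := h.exists_nat hpp
    obtain ⟨m₂, hm₂⟩ := h.exists_nat hqq
    have hp1 := h.trace_pos_of_proj hp0 hps hpp
    have hp2 := h.trace_pos_of_proj (sub_ne_zero.2 hpe.symm) hqs hqq
    have hsum : m₁ + m₂ = m := by
      have h1 : τ p + τ (e - p) = τ e := by rw [← map_add]; congr 1; abel
      rw [hm₁, hm₂, hm] at h1
      exact_mod_cast h1
    rw [hm₁, Nat.cast_pos] at hp1
    rw [hm₂, Nat.cast_pos] at hp2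
    obtain ⟨F₁, hF1, ho1, he1, hs1⟩ := ih m₁ (by lia) p hps hpp hm₁
    obtain ⟨F₂, hF2, ho2, he2, hs2⟩ := ih m₂ (by lia) (e - p) hqs hqq hm₂
    have hpq : p * (e - p) = 0 := by rw [mul_sub, hpe', hpp, sub_self]
    have hqp : (e - p) * p = 0 := by rw [sub_mul, hep, hpp, sub_self]
    have hc1 : ∀ f ∈ F₁, ∀ f' ∈ F₂, f * f' = 0 := fun f hf f' hf' => by
      rw [← (he1 f hf).2, ← (he2 f' hf').1, mul_assoc, ← mul_assoc p, hpq, zero_mul, mul_zero]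
    have hc2 : ∀ f ∈ F₁, ∀ f' ∈ F₂, f' * f = 0 := fun f hf f' hf' => by
      rw [← (he1 f hf).1, ← (he2 f' hf').2, mul_assoc, ← mul_assoc (e - p), hqp, zero_mul, mul_zero]
    have hdisj : Disjoint F₁ F₂ := by
      rw [Finset.disjoint_left]
      intro f hf1 hf2
      have h1 := hc1 f hf1 f hf2
      rw [(hF1 f hf1).mul_self] at h1
      exact (hF1 f hf1).ne_zero h1
    refine ⟨F₁ ∪ F₂, ?_, ?_, ?_, ?_⟩
    · intro f hf
      rcases Finset.mem_union.1 hf with hf | hf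
      exacts [hF1 f hf, hF2 f hf]
    · intro f hf f' hf' hne
      rcases Finset.mem_union.1 hf with hf | hf <;> rcases Finset.mem_union.1 hf' with hf' | hf'
      exacts [ho1 f hf f' hf' hne, hc1 f hf f' hf', hc2 f' hf' f hf, ho2 f hf f' hf' hne]
    · intro f hf
      rcases Finset.mem_union.1 hf with hf | hf
      · obtain ⟨h1, h2⟩ := he1 f hf
        constructor
        · rw [← h1, ← mul_assoc, hep]
        · rw [← h2, mul_assoc, hpe']
      · obtain ⟨h1, h2⟩ := he2 f hf
        constructor
        · rw [← h1, ← mul_assoc, mul_sub, hee, hep]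
        · rw [← h2, mul_assoc, sub_mul, hee, hpe']
    · rw [Finset.sum_union hdisj, hs1, hs2]; abel

theorem exists_minProj_decomp (h : IsTraceForm n τ) :
    ∃ F : Finset B, (∀ f ∈ F, IsMinProj R f) ∧ (∀ f ∈ F, ∀ f' ∈ F, f ≠ f' → f * f' = 0) ∧
      ∑ f ∈ F, f = 1 := by
  obtain ⟨m, hm⟩ := h.exists_nat (e := (1 : B)) (mul_one 1)
  obtain ⟨F, h1, h2, -, h3⟩ := h.exists_minProj_decomp_aux m 1 (star_one B) (mul_one 1) hm
  exact ⟨F, h1, h2, h3⟩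

/-- A nonzero element of `f B e` can be rescaled to a partial isometry. -/
theorem exists_partial_isometry (h : IsTraceForm n τ) {e f x : B} (he : IsMinProj R e)
    (hf : IsMinProj R f) (hx : x ≠ 0) (hfx : f * x = x) (hxe : x * e = x) :
    ∃ u : B, f * u = u ∧ u * e = u ∧ star u * u = e ∧ u * star u = f := by
  have hes : e * star x = star x := by rw [← he.star_eq, ← star_mul, hxe]
  have hsf : star x * f = star x := by rw [← hf.star_eq, ← star_mul, hfx]
  obtain ⟨r, hr⟩ := he.scalar (star x * x) (by rw [star_mul, star_star])
    (by rw [← mul_assoc, hes]) (by rw [mul_assoc, hxe])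
  have hr0 : 0 < r := by
    have h1 := h.pos x hx
    rw [hr, map_smul, smul_eq_mul] at h1
    exact pos_of_mul_pos_left h1 (h.trace_pos_of_proj he.ne_zero he.star_eq he.mul_self).le
  obtain ⟨y, hy⟩ := IsMaxOrdered.sq r hr0.le
  have hy0 : y ≠ 0 := by rintro rfl; rw [hy] at hr0; simp at hr0
  have huu : star (y⁻¹ • x) * (y⁻¹ • x) = e := by
    rw [h.star_smul, smul_mul_smul_comm, hr, smul_smul, hy,
      show y⁻¹ * y⁻¹ * y ^ 2 = 1 by field_simp, one_smul]
  have hfu : f * (y⁻¹ • x) = y⁻¹ • x := by rw [mul_smul_comm, hfx]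
  have hue : (y⁻¹ • x) * e = y⁻¹ • x := by rw [smul_mul_assoc, hxe]
  set u := y⁻¹ • x
  have huf : star u * f = star u := by rw [← hf.star_eq, ← star_mul, hfu]
  obtain ⟨s, hs⟩ := hf.scalar (u * star u) (by rw [star_mul, star_star])
    (by rw [← mul_assoc, hfu]) (by rw [mul_assoc, huf])
  have hu0 : u ≠ 0 := by
    intro h0
    rw [h0, mul_zero] at huu
    exact he.ne_zero huu.symm
  have h1 : s • u = (1 : R) • u := by
    rw [one_smul]
    conv_lhs => rw [← hfu]
    rw [← smul_mul_assoc, ← hs, mul_assoc, huu, hue]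
  have hs1 : s = 1 := smul_left_injective R hu0 h1
  exact ⟨u, hfu, hue, huu, by rw [hs, hs1, one_smul]⟩

end IsTraceForm

end Projections

section Corner

variable {R : Type*} [Field R] [LinearOrder R] [IsStrictOrderedRing R] [IsMaxOrdered R]
  [Algebra ℝ R] {B : Type*} [Ring B] [Algebra R B] [StarRing B] {n : ℕ} {τ : B →ₗ[R] R}

/-- A basis of the corner `e B e`, orthogonal for the trace form and made of unitaries. -/
structure IsCornerBasis (τ : B →ₗ[R] R) (e : B) {d : ℕ} (q : Fin d → B) : Prop where
  left : ∀ k, e * q k = q k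
  right : ∀ k, q k * e = q k
  star_mul : ∀ k, star (q k) * q k = e
  mul_star : ∀ k, q k * star (q k) = e
  orth : ∀ k l, k ≠ l → τ (star (q k) * q l) = 0
  complete : ∀ x, e * x = x → x * e = x → τ e • x = ∑ k, τ (star (q k) * x) • q k

namespace IsTraceForm

theorem isCornerBasis_of_orth (h : IsTraceForm n τ) {e : B} {d : ℕ} {q : Fin d → B}
    (left : ∀ k, e * q k = q k) (right : ∀ k, q k * e = q k)
    (hsm : ∀ k, star (q k) * q k = e) (hms : ∀ k, q k * star (q k) = e)
    (orth : ∀ k l, k < l → τ (star (q k) * q l) = 0)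
    (complete : ∀ x, e * x = x → x * e = x → (∀ k, τ (star (q k) * x) = 0) → x = 0) :
    IsCornerBasis τ e q := by
  have orth' : ∀ k l, k ≠ l → τ (star (q k) * q l) = 0 := by
    intro k l hkl
    rcases lt_or_gt_of_ne hkl with hlt | hlt
    · exact orth k l hlt
    · rw [← h.trace_star, star_mul, star_star]
      exact orth l k hlt
  refine ⟨left, right, hsm, hms, orth', fun x hex hxe => ?_⟩
  rw [← sub_eq_zero]
  refine complete _ ?_ ?_ fun l => ?_
  · rw [mul_sub, mul_smul_comm, hex, Finset.mul_sum]
    congr 1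
    exact Finset.sum_congr rfl fun k _ => by rw [mul_smul_comm, left]
  · rw [sub_mul, smul_mul_assoc, hxe, Finset.sum_mul]
    congr 1
    exact Finset.sum_congr rfl fun k _ => by rw [smul_mul_assoc, right]
  · rw [mul_sub, map_sub, mul_smul_comm, map_smul, Finset.mul_sum, map_sum,
      Finset.sum_eq_single l]
    · rw [mul_smul_comm, map_smul, hsm, smul_eq_mul, smul_eq_mul, mul_comm, sub_self]
    · intro k _ hk
      rw [mul_smul_comm, map_smul, orth' l k hk.symm, smul_zero]
    · simp

theorem exists_skew_unitary (h : IsTraceForm n τ) {e u : B} (he : IsMinProj R e) (hu0 : u ≠ 0)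
    (hu : star u = -u) (heu : e * u = u) (hue : u * e = u) :
    ∃ r : R, r ≠ 0 ∧ star (r • u) = -(r • u) ∧ (r • u) * (r • u) = -e := by
  obtain ⟨v, hv⟩ : ∃ v, v = star u * u := ⟨_, rfl⟩
  obtain ⟨s, hs⟩ := he.scalar (star u * u) (by rw [star_mul, star_star])
    (by rw [hu, neg_mul, mul_neg, ← mul_assoc, heu]) (by rw [mul_assoc, hue])
  have hs0 : 0 < s := by
    have h1 := h.pos u hu0
    rw [hs, map_smul, smul_eq_mul] at h1
    exact pos_of_mul_pos_left h1 (h.trace_pos_of_proj he.ne_zero he.star_eq he.mul_self).le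
  obtain ⟨y, hy⟩ := IsMaxOrdered.sq s hs0.le
  have hy0 : y ≠ 0 := by rintro rfl; rw [hy] at hs0; simp at hs0
  refine ⟨y⁻¹, inv_ne_zero hy0, by rw [h.star_smul, hu, smul_neg], ?_⟩
  rw [hu, neg_mul] at hs
  have h2 : u * u = -(s • e) := by rw [← hs, neg_neg]
  rw [smul_mul_smul_comm, h2, smul_neg, smul_smul, hy,
      show y⁻¹ * y⁻¹ * y ^ 2 = 1 by field_simp, one_smul]

theorem anticomm_of_skew (h : IsTraceForm n τ) {e u v : B} (he : IsMinProj R e)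
    (hu : star u = -u) (heu : e * u = u) (hue : u * e = u)
    (hv : star v = -v) (hev : e * v = v) (hve : v * e = v) (huv : τ (u * v) = 0) :
    u * v = -(v * u) := by
  obtain ⟨s, hs⟩ := he.scalar (u * v + v * u)
    (by rw [star_add, star_mul, star_mul, hu, hv, neg_mul_neg, neg_mul_neg, add_comm])
    (by rw [mul_add, ← mul_assoc, ← mul_assoc, heu, hev])
    (by rw [add_mul, mul_assoc, mul_assoc, hue, hve])
  have h1 : τ (u * v + v * u) = 0 := by rw [map_add, h.comm v u, huv, add_zero]
  rw [hs, map_smul, smul_eq_mul] at h1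
  have h2 := h.trace_pos_of_proj he.ne_zero he.star_eq he.mul_self
  have hs0 : s = 0 := (mul_eq_zero.1 h1).resolve_right h2.ne'
  rw [hs0, zero_smul] at hs
  exact eq_neg_of_add_eq_zero_left hs

theorem skew_of_trace_eq_zero (h : IsTraceForm n τ) {e x : B} (he : IsMinProj R e)
    (hex : e * x = x) (hxe : x * e = x) (hx : τ x = 0) : star x = -x := by
  obtain ⟨s, hs⟩ := he.scalar (x + star x) (by rw [star_add, star_star, add_comm])
    (by
      have h1 : e * star x = star x := by rw [← he.star_eq, ← star_mul, hxe]
      rw [mul_add, hex, h1])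
    (by
      have h1 : star x * e = star x := by rw [← he.star_eq, ← star_mul, hex]
      rw [add_mul, hxe, h1])
  have h1 : τ (x + star x) = 0 := by rw [map_add, h.trace_star, hx, add_zero]
  rw [hs, map_smul, smul_eq_mul] at h1
  have h2 := h.trace_pos_of_proj he.ne_zero he.star_eq he.mul_self
  have hs0 : s = 0 := (mul_eq_zero.1 h1).resolve_right h2.ne'
  rw [hs0, zero_smul] at hs
  exact eq_neg_of_add_eq_zero_right hs

theorem exists_cornerBasis (h : IsTraceForm n τ) {e : B} (he : IsMinProj R e) :
    ∃ (d c : ℕ) (q : Fin d → B), τ e = (d * c : ℕ) ∧ IsCornerBasis τ e q := by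
  have hes := he.star_eq
  have hee := he.mul_self
  by_cases hone : ∀ u, star u = -u → e * u = u → u * e = u → u = 0
  · obtain ⟨c, hc⟩ := h.exists_nat hee
    refine ⟨1, c, ![e], by rw [one_mul, hc], h.isCornerBasis_of_orth ?_ ?_ ?_ ?_ ?_ ?_⟩
    · simpa [Fin.forall_fin_one] using hee
    · simpa [Fin.forall_fin_one] using hee
    · simpa [Fin.forall_fin_one, hes] using hee
    · simpa [Fin.forall_fin_one, hes] using hee
    · intro k l hkl
      exact absurd hkl (by simp [Subsingleton.elim k l])
    · intro x hex hxe hx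
      have h1 : τ x = 0 := by simpa [hes, hex] using hx 0
      exact hone x (h.skew_of_trace_eq_zero he hex hxe h1) hex hxe
  push Not at hone
  obtain ⟨i₀, hi1, hi2, hi3, hi4⟩ := hone
  obtain ⟨r, hr0, his, hii⟩ := h.exists_skew_unitary he hi4 hi1 hi2 hi3
  have hei : e * (r • i₀) = r • i₀ := by rw [mul_smul_comm, hi2]
  have hie : (r • i₀) * e = r • i₀ := by rw [smul_mul_assoc, hi3]
  generalize r • i₀ = i at his hii hei hie
  clear hi1 hi2 hi3 hi4
  by_cases htwo : ∀ u, star u = -u → e * u = u → u * e = u → τ (i * u) = 0 → u = 0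
  · obtain ⟨c, hc⟩ := h.exists_even_of_skew his hii hie
    refine ⟨2, c, ![e, i], hc, h.isCornerBasis_of_orth ?_ ?_ ?_ ?_ ?_ ?_⟩
    · simp [Fin.forall_fin_two, hee, hei]
    · simp [Fin.forall_fin_two, hee, hie]
    · simp [Fin.forall_fin_two, hee, hes, his, hii]
    · simp [Fin.forall_fin_two, hee, hes, his, hii]
    · simp [Fin.forall_fin_two, hes, hei, h.trace_skew his]
    · intro x hex hxe hx
      have h1 : τ x = 0 := by simpa [hes, hex] using hx 0
      have h2 : τ (i * x) = 0 := by simpa [his] using hx 1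
      exact htwo x (h.skew_of_trace_eq_zero he hex hxe h1) hex hxe h2
  push Not at htwo
  obtain ⟨j₀, hj1, hj2, hj3, hj4, hj5⟩ := htwo
  obtain ⟨r', hr0', hjs, hjj⟩ := h.exists_skew_unitary he hj5 hj1 hj2 hj3
  have hej : e * (r' • j₀) = r' • j₀ := by rw [mul_smul_comm, hj2]
  have hje : (r' • j₀) * e = r' • j₀ := by rw [smul_mul_assoc, hj3]
  have hij0 : τ (i * (r' • j₀)) = 0 := by rw [mul_smul_comm, map_smul, hj4, smul_zero]
  generalize r' • j₀ = j at hjs hjj hej hje hij0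
  clear hj1 hj2 hj3 hj4 hj5
  have hij := h.anticomm_of_skew he his hei hie hjs hej hje hij0
  have hji : j * i = -(i * j) := by rw [hij, neg_neg]
  have hks : star (i * j) = -(i * j) := by rw [star_mul, his, hjs, neg_mul_neg, hji]
  have hkk : (i * j) * (i * j) = -e := by
    rw [mul_assoc, ← mul_assoc j, hji, neg_mul, mul_neg, mul_assoc i j j, hjj, mul_neg, mul_neg,
      hie, hii, neg_neg]
  have hek : e * (i * j) = i * j := by rw [← mul_assoc, hei]
  have hke : i * j * e = i * j := by rw [mul_assoc, hje]
  have hik : τ (i * (i * j)) = 0 := by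
    rw [← mul_assoc, hii, neg_mul, hej, map_neg, h.trace_skew hjs, neg_zero]
  have hjk : τ (j * (i * j)) = 0 := by
    rw [h.comm, mul_assoc, hjj, mul_neg, hie, map_neg, h.trace_skew his, neg_zero]
  obtain ⟨c, hc⟩ := h.exists_four_mul_of_skew his hjs hij hkk hje
  refine ⟨4, c, ![e, i, j, i * j], hc, h.isCornerBasis_of_orth ?_ ?_ ?_ ?_ ?_ ?_⟩
  · simp [Fin.forall_fin_succ, hee, hei, hej, hek]
  · simp [Fin.forall_fin_succ, hee, hie, hje, hke]
  · simp only [Fin.forall_fin_succ]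
    simp [hee, hes, his, hii, hjs, hjj, -star_mul, hks, hkk]
  · simp only [Fin.forall_fin_succ]
    simp [hee, hes, his, hii, hjs, hjj, -star_mul, hks, hkk]
  · simp only [Fin.forall_fin_succ]
    simp [hes, his, hjs, hei, hej, hek, -star_mul, hks, h.trace_skew his, h.trace_skew hjs,
      h.trace_skew hks, hik, hjk]
  · intro x hex hxe hx
    have h1 : τ x = 0 := by simpa [hes, hex] using hx 0
    have h2 : τ (i * x) = 0 := by simpa [his] using hx 1
    have h3 : τ (j * x) = 0 := by simpa [hjs] using hx 2
    have h4 : τ (i * j * x) = 0 := by simpa [-star_mul, hks] using hx 3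
    have hxs := h.skew_of_trace_eq_zero he hex hxe h1
    have hxi := h.anticomm_of_skew he his hei hie hxs hex hxe h2
    have hxj := h.anticomm_of_skew he hjs hej hje hxs hex hxe h3
    have hxk := h.anticomm_of_skew he hks hek hke hxs hex hxe h4
    have h5 : i * j * x = x * (i * j) := by
      rw [mul_assoc, hxj, mul_neg, ← mul_assoc, hxi, neg_mul, neg_neg, mul_assoc]
    have h6 : (2 : R) • (i * j * x) = 0 := by
      rw [two_smul]
      conv_lhs => enter [1]; rw [hxk]
      rw [h5]; abel
    have h7 : i * j * x = 0 := by
      rcases smul_eq_zero.1 h6 with h8 | h8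
      · exact absurd h8 two_ne_zero
      · exact h8
    have h8 : (i * j) * (i * j * x) = -x := by rw [← mul_assoc, hkk, neg_mul, hex]
    rw [h7, mul_zero] at h8
    exact neg_eq_zero.1 h8.symm

end IsTraceForm

end Corner

section Frame

universe u

variable {R : Type*} [Field R] [LinearOrder R] [IsStrictOrderedRing R] [IsMaxOrdered R]
  [Algebra ℝ R] {B : Type u} [Ring B] [Algebra R B] [StarRing B] {n : ℕ} {τ : B →ₗ[R] R}

/-- A finite family of vectors on whose classes left multiplication acts, in orthonormal
coordinates. -/
structure IsFrame (τ : B →ₗ[R] R) {A κ : Type*} [Fintype A] [DecidableEq A] [DecidableEq κ]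
    (cls : A → κ) (v : A → B) : Prop where
  orth : ∀ α β, cls α = cls β → τ (star (v α) * v β) = if α = β then 1 else 0
  expand : ∀ a β, a * v β =
    ∑ α, (if cls α = cls β then τ (star (v α) * (a * v β)) else 0) • v α
  sum_eq : ∑ α, v α * star (v α) = 1

/-- The matrix representation in the coordinates of a frame. -/
def frameMatrix (τ : B →ₗ[R] R) {A κ : Type*} [DecidableEq κ] (cls : A → κ) (v : A → B)
    (a : B) : Matrix A A R :=
  Matrix.of fun α β => if cls α = cls β then τ (star (v α) * (a * v β)) else 0

namespace IsFrame

variable {A κ : Type*} [Fintype A] [DecidableEq A] [DecidableEq κ] {cls : A → κ} {v : A → B}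

theorem matrix_one (hf : IsFrame τ cls v) : frameMatrix τ cls v 1 = 1 := by
  ext α β
  rw [frameMatrix, Matrix.of_apply, one_mul, Matrix.one_apply]
  split_ifs with h1 h2 h2
  · rw [hf.orth α β h1, if_pos h2]
  · rw [hf.orth α β h1, if_neg h2]
  · exact absurd (congrArg cls h2) h1
  · rfl

theorem matrix_mul (hf : IsFrame τ cls v) (a b : B) :
    frameMatrix τ cls v (a * b) = frameMatrix τ cls v a * frameMatrix τ cls v b := by
  ext α β
  simp only [Matrix.mul_apply, frameMatrix, Matrix.of_apply]
  split_ifs with h1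
  · conv_lhs => rw [mul_assoc, hf.expand b β, Finset.mul_sum, Finset.mul_sum, map_sum]
    refine Finset.sum_congr rfl fun γ _ => ?_
    rw [mul_smul_comm, mul_smul_comm, map_smul, smul_eq_mul, mul_comm]
    by_cases h2 : cls γ = cls β
    · rw [if_pos h2, if_pos (h1.trans h2.symm)]
    · rw [if_neg h2, mul_zero, mul_zero]
  · refine (Finset.sum_eq_zero fun γ _ => ?_).symm
    by_cases h2 : cls γ = cls β
    · rw [if_neg fun h3 => h1 (h3.trans h2), zero_mul]
    · rw [if_neg h2, mul_zero]

theorem matrix_trace (h : IsTraceForm n τ) (hf : IsFrame τ cls v) (a : B) :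
    (frameMatrix τ cls v a).trace = τ a := by
  have h1 : ∀ α, τ (star (v α) * (a * v α)) = τ (a * (v α * star (v α))) := fun α => by
    rw [h.comm, mul_assoc]
  simp only [Matrix.trace, Matrix.diag, frameMatrix, Matrix.of_apply, if_true, h1]
  rw [← map_sum, ← Finset.mul_sum, hf.sum_eq, mul_one]

theorem matrix_star (h : IsTraceForm n τ) (a : B) :
    frameMatrix τ cls v (star a) = (frameMatrix τ cls v a)ᵀ := by
  ext α β
  simp only [frameMatrix, Matrix.of_apply, Matrix.transpose_apply]
  by_cases h1 : cls α = cls β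
  · rw [if_pos h1, if_pos h1.symm, ← h.trace_star]
    simp only [star_mul, star_star, mul_assoc]
  · rw [if_neg h1, if_neg fun h2 => h1 h2.symm]

/-- The matrix representation attached to a frame, as an algebra homomorphism. -/
def repr (hf : IsFrame τ cls v) : B →ₐ[R] Matrix A A R :=
  AlgHom.ofLinearMap
    { toFun := frameMatrix τ cls v
      map_add' := fun a b => by
        ext α β
        simp only [frameMatrix, Matrix.of_apply, Matrix.add_apply, add_mul, mul_add, map_add]
        split_ifs <;> simp
      map_smul' := fun r a => by
        ext α β
        simp [frameMatrix] }
    hf.matrix_one hf.matrix_mul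

theorem card_eq (h : IsTraceForm n τ) (hf : IsFrame τ cls v) (h1 : τ 1 = n) :
    Fintype.card A = n := by
  have h2 := hf.matrix_trace h 1
  rw [hf.matrix_one, Matrix.trace_one, h1] at h2
  exact_mod_cast h2

end IsFrame

namespace IsTraceForm

open Classical in
theorem exists_frame (h : IsTraceForm n τ) :
    ∃ (A κ : Type u) (_ : Fintype A) (_ : DecidableEq A) (_ : DecidableEq κ) (cls : A → κ)
      (v : A → B), IsFrame τ cls v := by
  obtain ⟨F, hF, hFo, hF1⟩ := h.exists_minProj_decomp
  have hpi : ∀ e f : F, (∃ x : B, x ≠ 0 ∧ (f : B) * x = x ∧ x * (e : B) = x) →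
      ∃ u : B, (f : B) * u = u ∧ u * (e : B) = u ∧ star u * u = e ∧ u * star u = f := by
    rintro e f ⟨x, hx, h1, h2⟩
    exact h.exists_partial_isometry (hF e e.2) (hF f f.2) hx h1 h2
  let s : Setoid F :=
    { r := fun e f => ∃ u : B, (f : B) * u = u ∧ u * (e : B) = u ∧ star u * u = e ∧
        u * star u = f
      iseqv :=
        { refl := fun e => by
            have he := hF e e.2
            exact ⟨e, he.mul_self, he.mul_self, by rw [he.star_eq, he.mul_self],
              by rw [he.star_eq, he.mul_self]⟩
          symm := by
            rintro e f ⟨u, h1, h2, h3, h4⟩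
            refine ⟨star u, ?_, ?_, ?_, ?_⟩
            · rw [← (hF e e.2).star_eq, ← star_mul, h2]
            · rw [← (hF f f.2).star_eq, ← star_mul, h1]
            · rw [star_star, h4]
            · rw [star_star, h3]
          trans := by
            rintro e f g ⟨u, h1, h2, h3, h4⟩ ⟨w, k1, k2, k3, k4⟩
            refine ⟨w * u, ?_, ?_, ?_, ?_⟩
            · rw [← mul_assoc, k1]
            · rw [mul_assoc, h2]
            · rw [star_mul, mul_assoc, ← mul_assoc (star w), k3, h1, h3]
            · rw [star_mul, mul_assoc, ← mul_assoc u, h4, ← mul_assoc, k2, k4] } }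
  have hout : ∀ i : Quotient s, ∀ f : {f : F // Quotient.mk s f = i},
      ∃ u : B, (f.1 : B) * u = u ∧ u * (i.out : B) = u ∧ star u * u = i.out ∧
        u * star u = f.1 := by
    rintro i ⟨f, rfl⟩
    exact Quotient.mk_out (s := s) f
  choose u hu1 hu2 hu3 hu4 using hout
  choose d c q hdc hq using fun i : Quotient s => h.exists_cornerBasis (hF i.out i.out.2)
  have hpos : ∀ i : Quotient s, 0 < τ (i.out : B) := fun i =>
    h.trace_pos_of_proj (hF _ i.out.2).ne_zero (hF _ i.out.2).star_eq (hF _ i.out.2).mul_self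
  choose t ht using fun i => IsMaxOrdered.sq (τ ((Quotient.out i : F) : B)) (hpos i).le
  have hstar : ∀ i (f : {f : F // Quotient.mk s f = i}) k,
      star ((t i)⁻¹ • (u i f * q i k)) = (t i)⁻¹ • (star (q i k) * star (u i f)) := by
    intro i f k
    rw [h.star_smul, star_mul]
  have hinv : ∀ i, (t i)⁻¹ * (t i)⁻¹ = (τ (i.out : B))⁻¹ := fun i => by
    rw [ht, pow_two, mul_inv]
  have hfib : ∀ y : F → B,
      ∑ i : Quotient s, ∑ f : {f : F // Quotient.mk s f = i}, y f.1 = ∑ f, y f := by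
    intro y
    rw [← (Equiv.sigmaFiberEquiv (Quotient.mk s)).sum_comp, Fintype.sum_sigma]
    rfl
  refine ⟨Σ i : Quotient s, Fin (c i) × {f : F // Quotient.mk s f = i} × Fin (d i),
    Σ i : Quotient s, Fin (c i), inferInstance, inferInstance, inferInstance,
    fun α => ⟨α.1, α.2.1⟩, fun α => (t α.1)⁻¹ • (u α.1 α.2.2.1 * q α.1 α.2.2.2), ?_, ?_, ?_⟩
  · rintro ⟨i, a, f, k⟩ ⟨i', a', f', k'⟩ hcls
    obtain ⟨rfl, hcls⟩ := Sigma.mk.inj_iff.1 hcls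
    obtain rfl := eq_of_heq hcls
    simp only [hstar, smul_mul_assoc, mul_smul_comm, map_smul, smul_eq_mul]
    rw [← mul_assoc, hinv]
    by_cases hff : f = f'
    · subst hff
      rw [mul_assoc, ← mul_assoc (star (u i f)), hu3, (hq i).left]
      by_cases hkk : k = k'
      · subst hkk
        rw [(hq i).star_mul, if_pos rfl, inv_mul_cancel₀ (hpos i).ne']
      · rw [(hq i).orth k k' hkk, mul_zero, if_neg]
        simpa using hkk
    · have hne : (f.1 : B) ≠ f'.1 := fun h1 => hff (Subtype.ext (Subtype.ext h1))
      have h0 : star (u i f) * u i f' = 0 := by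
        rw [← hu1 i f, ← hu1 i f', star_mul, (hF _ f.1.2).star_eq, mul_assoc,
          ← mul_assoc (f.1 : B), hFo _ f.1.2 _ f'.1.2 hne, zero_mul, mul_zero]
      rw [mul_assoc, ← mul_assoc (star (u i f)), h0, zero_mul, mul_zero, map_zero, mul_zero,
        if_neg]
      simp [hff]
  · rintro a ⟨i, a', f, k⟩
    obtain ⟨x, hx⟩ : ∃ x, x = a * ((t i)⁻¹ • (u i f * q i k)) := ⟨_, rfl⟩
    have hxe : x * (i.out : B) = x := by
      rw [hx, mul_assoc, smul_mul_assoc, mul_assoc, (hq i).right]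
    have hfx : ∀ f : F, Quotient.mk s f ≠ i → (f : B) * x = 0 := by
      intro f hfi
      by_contra h0
      refine hfi ?_
      rw [← Quotient.out_eq i]
      refine Quotient.sound (Setoid.symm (hpi _ _ ⟨(f : B) * x, h0, ?_, ?_⟩))
      · rw [← mul_assoc, (hF f f.2).mul_self]
      · rw [mul_assoc, hxe]
    have hfu : ∀ f : {f : F // Quotient.mk s f = i},
        ∑ k, τ (star ((t i)⁻¹ • (u i f * q i k)) * x) • ((t i)⁻¹ • (u i f * q i k)) =
          (f.1 : B) * x := by
      intro f
      have h1 := (hq i).complete (star (u i f) * x)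
        (by
          rw [← mul_assoc]
          congr 1
          conv_lhs => rw [← (hF _ i.out.2).star_eq]
          rw [← star_mul, hu2])
        (by rw [mul_assoc, hxe])
      have h2 : ∀ k, τ (star ((t i)⁻¹ • (u i f * q i k)) * x) • ((t i)⁻¹ • (u i f * q i k)) =
          (τ (i.out : B))⁻¹ • (u i f * (τ (star (q i k) * (star (u i f) * x)) • q i k)) := by
        intro k
        rw [hstar, smul_mul_assoc, map_smul, mul_smul_comm, smul_smul, smul_smul, ← hinv,
          mul_assoc, smul_eq_mul]
        congr 1
        ring
      simp only [h2]
      rw [← Finset.smul_sum, ← Finset.mul_sum, ← h1, mul_smul_comm, smul_smul,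
        inv_mul_cancel₀ (hpos i).ne', one_smul, ← mul_assoc, hu4]
    simp only
    rw [← hx, Fintype.sum_sigma, Finset.sum_eq_single i, Fintype.sum_prod_type,
      Finset.sum_eq_single a', Fintype.sum_prod_type]
    · simp only [if_true, hfu]
      conv_lhs => rw [← one_mul x, ← hF1, ← Finset.sum_coe_sort, Finset.sum_mul]
      rw [← hfib, Finset.sum_eq_single i]
      · intro j _ hj
        exact Finset.sum_eq_zero fun f _ => hfx f.1 (by rw [f.2]; exact hj)
      · simp
    · intro b _ hb
      refine Finset.sum_eq_zero fun y _ => ?_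
      rw [if_neg, zero_smul]
      simpa using hb
    · simp
    · intro j _ hj
      refine Finset.sum_eq_zero fun y _ => ?_
      rw [if_neg, zero_smul]
      intro h1
      exact hj (Sigma.mk.inj_iff.1 h1).1
    · simp
  · rw [Fintype.sum_sigma]
    have h1 : ∀ i, ∑ α : Fin (c i) × {f : F // Quotient.mk s f = i} × Fin (d i),
        ((t i)⁻¹ • (u i α.2.1 * q i α.2.2)) * star ((t i)⁻¹ • (u i α.2.1 * q i α.2.2)) =
        ∑ f : {f : F // Quotient.mk s f = i}, (f.1 : B) := by
      intro i
      have h2 : ∀ f k, ((t i)⁻¹ • (u i f * q i k)) * star ((t i)⁻¹ • (u i f * q i k)) =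
          (τ (i.out : B))⁻¹ • (f.1 : B) := by
        intro f k
        rw [hstar, smul_mul_assoc, mul_smul_comm, smul_smul, hinv, mul_assoc,
          ← mul_assoc (q i k), (hq i).mul_star, ← mul_assoc, hu2, hu4]
      simp only [h2, Fintype.sum_prod_type, Finset.sum_const, Finset.card_univ,
        Fintype.card_fin]
      rw [← Finset.smul_sum, ← Finset.smul_sum, ← Nat.cast_smul_eq_nsmul R,
        ← Nat.cast_smul_eq_nsmul R, smul_smul, smul_smul, ← Nat.cast_mul, mul_comm (c i),
        ← hdc i, mul_inv_cancel₀ (hpos i).ne', one_smul]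
    simp only [h1]
    rw [← hF1, ← Finset.sum_coe_sort F]
    exact hfib fun f => f

theorem exists_repr (h : IsTraceForm n τ) (h1 : τ 1 = n) :
    ∃ π : B →ₐ[R] Matrix (Fin n) (Fin n) R,
      (∀ a, π (star a) = (π a)ᵀ) ∧ ∀ a, (π a).trace = τ a := by
  obtain ⟨A, κ, _, _, _, cls, v, hf⟩ := h.exists_frame
  have σ : A ≃ Fin n := Fintype.equivFinOfCardEq (hf.card_eq h h1)
  refine ⟨(Matrix.reindexAlgEquiv R R σ : Matrix A A R →ₐ[R] _).comp hf.repr,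
    fun a => ?_, fun a => ?_⟩
  · change Matrix.reindex σ σ (frameMatrix τ cls v (star a)) = _
    rw [IsFrame.matrix_star h]
    rfl
  · rw [← hf.matrix_trace h a]
    exact σ.symm.sum_comp fun α => frameMatrix τ cls v a α α

end IsTraceForm

end Frame

section Quotient

universe u

variable {R : Type*} [Field R] [LinearOrder R] [IsStrictOrderedRing R]
  [Algebra ℝ R] {E : Type u} [Ring E] [Algebra R E]

theorem map_mul_eq_zero_of_star_self {τ : E →ₗ[R] R} {s : E →ₗ[R] E}
    (hsm : ∀ a b, s (a * b) = s b * s a) (hss : ∀ a, s (s a) = a) (hτs : ∀ a, τ (s a) = τ a)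
    (hpos : ∀ a, 0 ≤ τ (s a * a)) {a : E} (ha : τ (s a * a) = 0) (b : E) :
    τ (s b * a) = 0 := by
  have hsym : τ (s a * b) = τ (s b * a) := by rw [← hτs, hsm, hss]
  obtain ⟨t, ht⟩ : ∃ t, t = τ (s b * a) := ⟨_, rfl⟩
  obtain ⟨y, hy⟩ : ∃ y, y = τ (s b * b) := ⟨_, rfl⟩
  have hy0 : 0 ≤ y := hy ▸ hpos b
  have h1 : ∀ x : R, 0 ≤ 2 * x * t + x ^ 2 * y := by
    intro x
    have h2 := hpos (a + x • b)
    have h3 : τ (s (a + x • b) * (a + x • b)) = 2 * x * t + x ^ 2 * y := by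
      simp only [map_add, map_smul, add_mul, mul_add, smul_mul_assoc, mul_smul_comm,
        smul_eq_mul, ha, hsym, ← ht, ← hy]
      ring
    rwa [h3] at h2
  have h4 := h1 (-t / (y + 1))
  have hy1 : y + 1 ≠ 0 := by positivity
  have h5 : 2 * (-t / (y + 1)) * t + (-t / (y + 1)) ^ 2 * y =
      -(t ^ 2 * ((y + 2) / (y + 1) ^ 2)) := by
    field_simp
    ring
  rw [h5] at h4
  have h6 : 0 < (y + 2) / (y + 1) ^ 2 := by positivity
  rw [← ht]
  by_contra h0
  have h7 : 0 < t ^ 2 * ((y + 2) / (y + 1) ^ 2) := mul_pos (by positivity) h6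
  linarith

/-- The two-sided kernel of a trace form. -/
def traceKer (τ : E →ₗ[R] R) : Ideal E where
  carrier := {a | ∀ b, τ (b * a) = 0}
  add_mem' := by
    intro a b ha hb c
    rw [mul_add, map_add, ha, hb, add_zero]
  zero_mem' := by
    intro b
    rw [mul_zero, map_zero]
  smul_mem' := by
    intro c a ha b
    rw [smul_eq_mul, ← mul_assoc]
    exact ha _

theorem exists_isTraceForm_quotient {n : ℕ} {τ : E →ₗ[R] R} {s : E →ₗ[R] E}
    (hcomm : ∀ a b, τ (a * b) = τ (b * a))
    (hsm : ∀ a b, s (a * b) = s b * s a) (hss : ∀ a, s (s a) = a) (hτs : ∀ a, τ (s a) = τ a)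
    (hpos : ∀ a, 0 ≤ τ (s a * a))
    (hone : ∀ b l, n < l → newt 1 (fun j => τ (b ^ (j + 1))) l = 0)
    (hhalf : ∀ J K, s J = -J → s K = -K → ∀ l, n < l →
      newt (1 / 2) (fun j => τ ((J * K) ^ (j + 1))) l = 0) :
    ∃ (B : Type u) (_ : Ring B) (_ : Algebra R B) (_ : StarRing B) (σ : B →ₗ[R] R)
      (p : E →ₐ[R] B), IsTraceForm n σ ∧ Function.Surjective p ∧ (∀ a, σ (p a) = τ a) ∧
        (∀ a, star (p a) = p (s a)) ∧ ∀ a b, (∀ c, τ (c * a) = τ (c * b)) → p a = p b := by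
  have htwo : (traceKer τ).IsTwoSided := ⟨by
    intro a c ha b
    rw [← mul_assoc, hcomm, ← mul_assoc]
    exact ha _⟩
  have hker : ∀ a ∈ traceKer τ, τ a = 0 := fun a ha => by
    have h1 := ha 1
    rwa [one_mul] at h1
  have hs : ∀ a ∈ traceKer τ, s a ∈ traceKer τ := by
    intro a ha b
    rw [← hτs, hsm, hss, hcomm]
    exact ha _
  let p : E →ₐ[R] E ⧸ traceKer τ := Ideal.Quotient.mkₐ R (traceKer τ)
  have hp : Function.Surjective p := Ideal.Quotient.mkₐ_surjective R (traceKer τ)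
  have hpe : ∀ a b, p a = p b ↔ a - b ∈ traceKer τ := fun a b => Ideal.Quotient.eq
  let st : E ⧸ traceKer τ → E ⧸ traceKer τ := fun x => p (s (Function.surjInv hp x))
  have hst : ∀ a, st (p a) = p (s a) := by
    intro a
    refine (hpe _ _).2 ?_
    rw [← map_sub]
    refine hs _ ((hpe _ _).1 ?_)
    exact Function.surjInv_eq hp _
  let σ : (E ⧸ traceKer τ) →ₗ[R] R :=
    { toFun := fun x => τ (Function.surjInv hp x)
      map_add' := fun x y => by
        rw [← sub_eq_zero, ← map_add, ← map_sub]
        refine hker _ ((hpe _ _).1 ?_)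
        rw [map_add]
        simp only [Function.surjInv_eq hp]
      map_smul' := fun r x => by
        rw [← sub_eq_zero, RingHom.id_apply, ← map_smul, ← map_sub]
        refine hker _ ((hpe _ _).1 ?_)
        rw [map_smul]
        simp only [Function.surjInv_eq hp] }
  have hσ : ∀ a, σ (p a) = τ a := by
    intro a
    rw [← sub_eq_zero]
    change τ (Function.surjInv hp (p a)) - τ a = 0
    rw [← map_sub]
    refine hker _ ((hpe _ _).1 ?_)
    exact Function.surjInv_eq hp _
  let sr : StarRing (E ⧸ traceKer τ) :=
    { star := st
      star_involutive := fun x => by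
        obtain ⟨a, rfl⟩ := hp x
        exact (congrArg st (hst a)).trans ((hst _).trans (congrArg p (hss a)))
      star_mul := fun x y => by
        obtain ⟨a, rfl⟩ := hp x
        obtain ⟨b, rfl⟩ := hp y
        change st (p a * p b) = st (p b) * st (p a)
        rw [← map_mul, hst, hst, hst, hsm, map_mul]
      star_add := fun x y => by
        obtain ⟨a, rfl⟩ := hp x
        obtain ⟨b, rfl⟩ := hp y
        change st (p a + p b) = st (p a) + st (p b)
        rw [← map_add, hst, hst, hst, map_add, map_add] }
  have hstar : ∀ a, star (p a) = p (s a) := hst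
  refine ⟨E ⧸ traceKer τ, inferInstance, inferInstance, sr, σ, p, ?_, hp, hσ, hstar, ?_⟩
  · have hskew : ∀ x, star x = -x → ∃ a, s a = -a ∧ p a = x := by
      intro x hx
      obtain ⟨a, rfl⟩ := hp x
      refine ⟨(2 : R)⁻¹ • (a - s a), ?_, ?_⟩
      · rw [map_smul, map_sub, hss, ← smul_neg, neg_sub]
      · rw [map_smul, map_sub, ← hstar, hx, sub_neg_eq_add, ← two_smul R, smul_smul,
          inv_mul_cancel₀ two_ne_zero, one_smul]
    refine ⟨?_, ?_, ?_, ?_, ?_, ?_⟩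
    · intro r x
      obtain ⟨a, rfl⟩ := hp x
      rw [← map_smul, hstar, hstar, map_smul, map_smul]
    · intro x y
      obtain ⟨a, rfl⟩ := hp x
      obtain ⟨b, rfl⟩ := hp y
      rw [← map_mul, ← map_mul, hσ, hσ, hcomm]
    · intro x
      obtain ⟨a, rfl⟩ := hp x
      rw [hstar, hσ, hσ, hτs]
    · intro x hx
      obtain ⟨a, rfl⟩ := hp x
      rw [hstar, ← map_mul, hσ]
      refine lt_of_le_of_ne (hpos a) fun h0 => hx ?_
      rw [← map_zero p, hpe, sub_zero]
      intro b
      have h1 := map_mul_eq_zero_of_star_self hsm hss hτs hpos h0.symm (s b)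
      rwa [hss] at h1
    · intro x l hl
      obtain ⟨a, rfl⟩ := hp x
      simp only [← map_pow, hσ]
      exact hone a l hl
    · intro x y hx hy l hl
      obtain ⟨a, ha, rfl⟩ := hskew x hx
      obtain ⟨b, hb, rfl⟩ := hskew y hy
      simp only [← map_mul, ← map_pow, hσ]
      exact hhalf a b ha hb l hl
  · intro a b hab
    rw [hpe]
    intro c
    rw [mul_sub, map_sub, hab, sub_self]

end Quotient

section Gram

theorem sum_mul_mul_succ {K : Type*} [CommRing K] {m : ℕ} (H : Fin (m + 1) → Fin (m + 1) → K)
    (hH : ∀ i j, H i j = H j i) (x : Fin (m + 1) → K) :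
    ∑ i, ∑ j, x i * x j * H i j = x 0 ^ 2 * H 0 0 +
      2 * x 0 * (∑ j : Fin m, x j.succ * H 0 j.succ) +
      ∑ i : Fin m, ∑ j : Fin m, x i.succ * x j.succ * H i.succ j.succ := by
  rw [Fin.sum_univ_succ, Fin.sum_univ_succ]
  simp only [Fin.sum_univ_succ (n := m), Finset.sum_add_distrib]
  have h1 : ∑ j : Fin m, x 0 * x j.succ * H 0 j.succ =
      x 0 * ∑ j : Fin m, x j.succ * H 0 j.succ := by
    rw [Finset.mul_sum]
    exact Finset.sum_congr rfl fun j _ => by ring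
  have h2 : ∑ j : Fin m, x j.succ * x 0 * H j.succ 0 =
      x 0 * ∑ j : Fin m, x j.succ * H 0 j.succ := by
    rw [Finset.mul_sum]
    exact Finset.sum_congr rfl fun j _ => by rw [hH j.succ 0]; ring
  rw [h1, h2]
  ring

theorem gram_nonneg {R C : Type*} [Field R] [LinearOrder R] [IsStrictOrderedRing R] [CommRing C]
    (φ : C →+* R) {m : ℕ} (G : Fin m → Fin m → C) (hG : ∀ i j, G i j = G j i)
    (hpos : ∀ x : Fin m → C, 0 ≤ φ (∑ i, ∑ j, x i * x j * G i j)) (r : Fin m → R) :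
    0 ≤ ∑ i, ∑ j, r i * r j * φ (G i j) := by
  induction m with
  | zero => simp
  | succ m ih =>
    have h00 : 0 ≤ φ (G 0 0) := by
      have h1 := hpos (Pi.single 0 1)
      rw [sum_mul_mul_succ G hG] at h1
      simpa using h1
    rw [sum_mul_mul_succ (fun i j => φ (G i j)) (fun i j => by rw [hG])]
    rcases h00.eq_or_lt with h0 | h0
    · have hz : ∀ j : Fin m, φ (G 0 j.succ) = 0 := by
        intro j
        have h1 := hpos (Fin.cons (-G j.succ j.succ - 1)
          (Pi.single j (G 0 j.succ)))
        rw [sum_mul_mul_succ G hG] at h1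
        simp only [Fin.cons_zero, Fin.cons_succ] at h1
        simp only [Pi.single_apply, ite_mul, mul_ite, zero_mul, mul_zero, Finset.sum_ite_eq',
          Finset.mem_univ, if_true, map_add, map_mul, map_sub, map_neg,
          map_pow, map_one, map_ofNat, ← h0] at h1
        have h2 := hpos (Pi.single j.succ 1)
        simp only [Pi.single_apply, ite_mul, mul_ite, zero_mul, mul_zero, Finset.sum_ite_eq',
          Finset.mem_univ, if_true, one_mul] at h2
        have h3 : φ (G 0 j.succ) ^ 2 * (φ (G j.succ j.succ) + 2) ≤ 0 := by linarith
        by_contra hne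
        have h4 : 0 < φ (G 0 j.succ) ^ 2 * (φ (G j.succ j.succ) + 2) := by positivity
        exact h4.not_ge h3
      simp only [hz, ← h0, mul_zero, Finset.sum_const_zero, add_zero, zero_add]
      refine ih (fun i j => G i.succ j.succ) (fun i j => hG _ _) (fun x => ?_)
        (fun i => r i.succ)
      have h1 := hpos (Fin.cons 0 x)
      rw [sum_mul_mul_succ G hG] at h1
      simpa using h1
    · have h1 := ih (fun i j => G 0 0 * G i.succ j.succ - G 0 i.succ * G 0 j.succ)
        (fun i j => by rw [hG i.succ j.succ]; ring) (fun x => ?_) (fun i => r i.succ)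
      · have h2 : ∑ i : Fin m, ∑ j : Fin m, r i.succ * r j.succ *
            φ (G 0 0 * G i.succ j.succ - G 0 i.succ * G 0 j.succ) =
            φ (G 0 0) * (∑ i : Fin m, ∑ j : Fin m, r i.succ * r j.succ * φ (G i.succ j.succ)) -
            (∑ j : Fin m, r j.succ * φ (G 0 j.succ)) ^ 2 := by
          rw [pow_two, Finset.sum_mul_sum, Finset.mul_sum, ← Finset.sum_sub_distrib]
          refine Finset.sum_congr rfl fun i _ => ?_
          rw [Finset.mul_sum, ← Finset.sum_sub_distrib]
          refine Finset.sum_congr rfl fun j _ => ?_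
          rw [map_sub, map_mul, map_mul]
          ring
        rw [h2] at h1
        refine nonneg_of_mul_nonneg_right ?_ h0
        nlinarith [sq_nonneg (φ (G 0 0) * r 0 + ∑ j : Fin m, r j.succ * φ (G 0 j.succ))]
      · have h3 := hpos (Fin.cons (-∑ j : Fin m, x j * G 0 j.succ) fun i => G 0 0 * x i)
        rw [sum_mul_mul_succ G hG] at h3
        simp only [Fin.cons_zero, Fin.cons_succ] at h3
        have h4 : ∑ i : Fin m, ∑ j : Fin m, x i * x j *
            (G 0 0 * G i.succ j.succ - G 0 i.succ * G 0 j.succ) =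
            G 0 0 * (∑ i : Fin m, ∑ j : Fin m, x i * x j * G i.succ j.succ) -
            (∑ j : Fin m, x j * G 0 j.succ) ^ 2 := by
          rw [pow_two, Finset.sum_mul_sum, Finset.mul_sum, ← Finset.sum_sub_distrib]
          refine Finset.sum_congr rfl fun i _ => ?_
          rw [Finset.mul_sum, ← Finset.sum_sub_distrib]
          refine Finset.sum_congr rfl fun j _ => ?_
          ring
        have h5 : ∑ i : Fin m, ∑ j : Fin m, G 0 0 * x i * (G 0 0 * x j) * G i.succ j.succ =
            G 0 0 ^ 2 * ∑ i : Fin m, ∑ j : Fin m, x i * x j * G i.succ j.succ := by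
          simp only [Finset.mul_sum]
          exact Finset.sum_congr rfl fun i _ => Finset.sum_congr rfl fun j _ => by ring
        have h6 : ∑ j : Fin m, G 0 0 * x j * G 0 j.succ =
            G 0 0 * ∑ j : Fin m, x j * G 0 j.succ := by
          rw [Finset.mul_sum]
          exact Finset.sum_congr rfl fun j _ => by ring
        rw [h5, h6] at h3
        rw [h4]
        refine nonneg_of_mul_nonneg_right ?_ h0
        rw [← map_mul]
        convert h3 using 2
        ring

end Gram

section TraceAlgebra

/-- An algebra of matrices closed under transposition and containing its own traces, together
with the coefficient algebra of its scalar matrices. -/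
structure TraceAlg (n : ℕ) (P : Type*) [CommRing P] [Algebra ℝ P] where
  carrier : Subalgebra ℝ (Matrix (Fin n) (Fin n) P)
  center : Subalgebra ℝ P
  transpose_mem : ∀ h ∈ carrier, hᵀ ∈ carrier
  trace_mem : ∀ h ∈ carrier, h.trace ∈ center
  scalar_mem : ∀ c ∈ center, c • (1 : Matrix (Fin n) (Fin n) P) ∈ carrier

/-- The linear map on a monoid algebra with given values on the monoid. -/
def linExt (K : Type*) {M V : Type*} [CommRing K] [AddCommGroup V] [Module K V] (f : M → V) :
    MonoidAlgebra K M →ₗ[K] V :=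
  Finsupp.linearCombination K f ∘ₗ (MonoidAlgebra.coeffLinearEquiv K).toLinearMap

theorem linExt_single {K M V : Type*} [CommRing K] [AddCommGroup V] [Module K V] (f : M → V)
    (m : M) (r : K) : linExt K f (MonoidAlgebra.single m r) = r • f m := by
  simp [linExt]

namespace TraceAlg

variable {n : ℕ} {P : Type*} [CommRing P] [Algebra ℝ P] (D : TraceAlg n P)

/-- Transposition on the carrier. -/
def transp (h : D.carrier) : D.carrier := ⟨(h : Matrix _ _ P)ᵀ, D.transpose_mem _ h.2⟩

/-- The trace with values in the center. -/
def tr (h : D.carrier) : D.center := ⟨(h : Matrix _ _ P).trace, D.trace_mem _ h.2⟩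

theorem transp_mul (h k : D.carrier) : D.transp (h * k) = D.transp k * D.transp h :=
  Subtype.ext (Matrix.transpose_mul _ _)

theorem transp_transp (h : D.carrier) : D.transp (D.transp h) = h := rfl

theorem tr_transp (h : D.carrier) : D.tr (D.transp h) = D.tr h :=
  Subtype.ext (show h.1ᵀ.trace = h.1.trace from Matrix.trace_transpose _)

theorem tr_mul_comm (h k : D.carrier) : D.tr (h * k) = D.tr (k * h) :=
  Subtype.ext (show (h.1 * k.1).trace = (k.1 * h.1).trace from Matrix.trace_mul_comm _ _)

variable {K : Type*} [CommRing K] [Algebra ℝ K]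

variable (K) in
/-- The involution on formal combinations of elements of the carrier. -/
def adj : MonoidAlgebra K D.carrier →ₗ[K] MonoidAlgebra K D.carrier :=
  linExt K fun h => MonoidAlgebra.single (D.transp h) 1

/-- The trace on formal combinations of elements of the carrier. -/
def trace (ψ : D.center →ₐ[ℝ] K) : MonoidAlgebra K D.carrier →ₗ[K] K :=
  linExt K fun h => ψ (D.tr h)

theorem adj_single (h : D.carrier) (r : K) :
    D.adj K (MonoidAlgebra.single h r) = MonoidAlgebra.single (D.transp h) r := by
  rw [adj, linExt_single, MonoidAlgebra.smul_single, smul_eq_mul, mul_one]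

theorem trace_single (ψ : D.center →ₐ[ℝ] K) (h : D.carrier) (r : K) :
    D.trace ψ (MonoidAlgebra.single h r) = r * ψ (D.tr h) := by
  rw [trace, linExt_single, smul_eq_mul]

theorem adj_mul (a b : MonoidAlgebra K D.carrier) :
    D.adj K (a * b) = D.adj K b * D.adj K a := by
  induction a using MonoidAlgebra.induction_linear with
  | zero => simp
  | add x y hx hy => rw [add_mul, map_add, map_add, mul_add, hx, hy]
  | single h r =>
    induction b using MonoidAlgebra.induction_linear with
    | zero => simp
    | add x y hx hy => rw [mul_add, map_add, map_add, add_mul, hx, hy]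
    | single k t =>
      rw [MonoidAlgebra.single_mul_single, adj_single, adj_single, adj_single,
        MonoidAlgebra.single_mul_single, transp_mul, mul_comm]

theorem adj_adj (a : MonoidAlgebra K D.carrier) : D.adj K (D.adj K a) = a := by
  induction a using MonoidAlgebra.induction_linear with
  | zero => simp
  | add x y hx hy => rw [map_add, map_add, hx, hy]
  | single h r => rw [adj_single, adj_single, transp_transp]

theorem trace_adj (ψ : D.center →ₐ[ℝ] K) (a : MonoidAlgebra K D.carrier) :
    D.trace ψ (D.adj K a) = D.trace ψ a := by
  induction a using MonoidAlgebra.induction_linear with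
  | zero => simp
  | add x y hx hy => rw [map_add, map_add, map_add, hx, hy]
  | single h r => rw [adj_single, trace_single, trace_single, tr_transp]

theorem trace_mul_comm (ψ : D.center →ₐ[ℝ] K) (a b : MonoidAlgebra K D.carrier) :
    D.trace ψ (a * b) = D.trace ψ (b * a) := by
  induction a using MonoidAlgebra.induction_linear with
  | zero => simp
  | add x y hx hy => rw [add_mul, map_add, mul_add, map_add, hx, hy]
  | single h r =>
    induction b using MonoidAlgebra.induction_linear with
    | zero => simp
    | add x y hx hy => rw [mul_add, map_add, add_mul, map_add, hx, hy]
    | single k t =>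
      rw [MonoidAlgebra.single_mul_single, MonoidAlgebra.single_mul_single, trace_single,
        trace_single, tr_mul_comm, mul_comm r]

section Embedding

variable {P₁ : Type*} [CommRing P₁] [Algebra ℝ P₁] (ι : K →ₐ[ℝ] P₁) (κ : P →ₐ[ℝ] P₁)

/-- Formal combinations of elements of the carrier, realized as matrices. -/
def toMatrix : MonoidAlgebra K D.carrier →+* Matrix (Fin n) (Fin n) P₁ :=
  MonoidAlgebra.liftNCRingHom ((Matrix.scalar (Fin n)).comp ι.toRingHom)
    ((κ.mapMatrix (m := Fin n)).comp D.carrier.val).toRingHom.toMonoidHom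
    fun _ _ => Matrix.scalar_commute _ (fun _ => Commute.all _ _) _

theorem toMatrix_single (h : D.carrier) (r : K) :
    D.toMatrix ι κ (MonoidAlgebra.single h r) = ι r • (h : Matrix (Fin n) (Fin n) P).map κ := by
  rw [Matrix.smul_eq_diagonal_mul]
  exact MonoidAlgebra.liftNC_single _ _ _ _

variable {ι κ}

theorem toMatrix_adj (a : MonoidAlgebra K D.carrier) :
    D.toMatrix ι κ (D.adj K a) = (D.toMatrix ι κ a)ᵀ := by
  induction a using MonoidAlgebra.induction_linear with
  | zero => simp
  | add x y hx hy => rw [map_add, map_add, map_add, hx, hy, Matrix.transpose_add]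
  | single h r => rw [adj_single, toMatrix_single, toMatrix_single]; rfl

theorem trace_toMatrix {ψ : D.center →ₐ[ℝ] K} (hψ : ∀ c, ι (ψ c) = κ c)
    (a : MonoidAlgebra K D.carrier) :
    (D.toMatrix ι κ a).trace = ι (D.trace ψ a) := by
  induction a using MonoidAlgebra.induction_linear with
  | zero => simp
  | add x y hx hy => rw [map_add, map_add, map_add, Matrix.trace_add, hx, hy]
  | single h r =>
    rw [toMatrix_single, trace_single, map_mul, hψ, Matrix.trace_smul, smul_eq_mul]
    congr 1
    exact (AddMonoidHom.map_trace κ.toRingHom.toAddMonoidHom _).symm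

theorem newt_one_of_embedding {ψ : D.center →ₐ[ℝ] K} (hψ : ∀ c, ι (ψ c) = κ c)
    (hι : Function.Injective ι) (a : MonoidAlgebra K D.carrier) {l : ℕ} (hl : n < l) :
    newt 1 (fun j => D.trace ψ (a ^ (j + 1))) l = 0 := by
  apply hι
  rw [map_newt, map_zero]
  simp only [← trace_toMatrix D hψ, map_pow]
  exact newt_trace_eq_zero _ (by rwa [Fintype.card_fin])

theorem newt_half_of_embedding [IsDomain P₁] {ψ : D.center →ₐ[ℝ] K} (hψ : ∀ c, ι (ψ c) = κ c)
    (hι : Function.Injective ι) {J L : MonoidAlgebra K D.carrier} (hJ : D.adj K J = -J)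
    (hL : D.adj K L = -L) {l : ℕ} (hl : n < l) :
    newt (1 / 2) (fun j => D.trace ψ ((J * L) ^ (j + 1))) l = 0 := by
  apply hι
  rw [map_newt, map_zero]
  simp only [← trace_toMatrix D hψ, map_pow, map_mul]
  refine newt_half_eq_zero ?_ ?_ (by rwa [Fintype.card_fin])
  · rw [← toMatrix_adj, hJ, map_neg]
  · rw [← toMatrix_adj, hL, map_neg]

end Embedding

section Surjection

variable {R : Type*} [CommRing R] [Algebra ℝ R] {ev : K →ₐ[ℝ] R}

theorem adj_map (a : MonoidAlgebra K D.carrier) :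
    D.adj R (MonoidAlgebra.mapRingHom _ ev.toRingHom a) =
      MonoidAlgebra.mapRingHom _ ev.toRingHom (D.adj K a) := by
  induction a using MonoidAlgebra.induction_linear with
  | zero => simp
  | add x y hx hy => rw [map_add, map_add, map_add, map_add, hx, hy]
  | single h r =>
    rw [adj_single, MonoidAlgebra.mapRingHom_single, MonoidAlgebra.mapRingHom_single, adj_single]

theorem trace_map {ψ : D.center →ₐ[ℝ] K} {φ : D.center →ₐ[ℝ] R} (hev : ∀ c, ev (ψ c) = φ c)
    (a : MonoidAlgebra K D.carrier) :
    D.trace φ (MonoidAlgebra.mapRingHom _ ev.toRingHom a) = ev (D.trace ψ a) := by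
  induction a using MonoidAlgebra.induction_linear with
  | zero => simp
  | add x y hx hy => rw [map_add, map_add, map_add, map_add, hx, hy]
  | single h r =>
    rw [MonoidAlgebra.mapRingHom_single, trace_single, trace_single, map_mul, hev]
    rfl

theorem map_surjective (hev : Function.Surjective ev) :
    Function.Surjective (MonoidAlgebra.mapRingHom D.carrier ev.toRingHom) :=
  MonoidAlgebra.map_surjective ev.toRingHom.toAddMonoidHom hev

end Surjection

section Field

variable {R : Type*} [Field R] [Algebra ℝ R]

theorem exists_cover (φ : D.center →ₐ[ℝ] R) :
    ∃ (ev : MvPolynomial R D.center →ₐ[ℝ] R) (ψ : D.center →ₐ[ℝ] MvPolynomial R D.center)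
      (ι : MvPolynomial R D.center →ₐ[ℝ] MvPolynomial R P) (κ : P →ₐ[ℝ] MvPolynomial R P),
      Function.Surjective ev ∧ (∀ c, ev (ψ c) = φ c) ∧ Function.Injective ι ∧
        ∀ c : D.center, ι (ψ c) = κ c := by
  refine ⟨{ MvPolynomial.eval₂Hom φ.toRingHom id with
      commutes' := fun r => ?_ }, IsScalarTower.toAlgHom ℝ _ _, 
    MvPolynomial.mapAlgHom D.center.val, IsScalarTower.toAlgHom ℝ _ _, fun r => ?_, fun c => ?_,
    ?_, fun c => ?_⟩
  · rw [IsScalarTower.algebraMap_apply ℝ D.center]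
    exact (MvPolynomial.eval₂_C _ _ _).trans (φ.commutes r)
  · exact ⟨MvPolynomial.X r, MvPolynomial.eval₂_X _ _ _⟩
  · exact MvPolynomial.eval₂_C _ _ _
  · exact MvPolynomial.map_injective _ Subtype.val_injective
  · exact MvPolynomial.map_C _ _

theorem newt_one (φ : D.center →ₐ[ℝ] R) (a : MonoidAlgebra R D.carrier) {l : ℕ} (hl : n < l) :
    newt 1 (fun j => D.trace φ (a ^ (j + 1))) l = 0 := by
  obtain ⟨ev, ψ, ι, κ, hsurj, hev, hι, hψ⟩ := D.exists_cover φ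
  obtain ⟨a, rfl⟩ := D.map_surjective hsurj a
  simp only [← map_pow, D.trace_map hev]
  rw [← map_newt, D.newt_one_of_embedding hψ hι a hl, map_zero]

theorem newt_half [IsDomain P] (φ : D.center →ₐ[ℝ] R) {J L : MonoidAlgebra R D.carrier}
    (hJ : D.adj R J = -J) (hL : D.adj R L = -L) {l : ℕ} (hl : n < l) :
    newt (1 / 2) (fun j => D.trace φ ((J * L) ^ (j + 1))) l = 0 := by
  obtain ⟨ev, ψ, ι, κ, hsurj, hev, hι, hψ⟩ := D.exists_cover φ
  have hskew : ∀ J : MonoidAlgebra R D.carrier, D.adj R J = -J →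
      ∃ a : MonoidAlgebra (MvPolynomial R D.center) D.carrier, D.adj _ a = -a ∧
        MonoidAlgebra.mapRingHom D.carrier ev.toRingHom a = J := by
    intro J hJ
    obtain ⟨a, ha⟩ := D.map_surjective hsurj ((2 : R)⁻¹ • J)
    refine ⟨a - D.adj _ a, ?_, ?_⟩
    · rw [map_sub, adj_adj]
      abel
    · have hchar : CharZero R :=
        charZero_of_injective_algebraMap (algebraMap ℝ R).injective
      rw [map_sub, ← adj_map, ha, map_smul, hJ, smul_neg, sub_neg_eq_add, ← two_smul R,
        smul_smul, mul_inv_cancel₀ two_ne_zero, one_smul]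
  obtain ⟨a, ha, rfl⟩ := hskew J hJ
  obtain ⟨b, hb, rfl⟩ := hskew L hL
  simp only [← map_mul, ← map_pow, D.trace_map hev]
  rw [← map_newt, D.newt_half_of_embedding hψ hι ha hb hl, map_zero]

end Field

end TraceAlg

end TraceAlgebra

section Representation

universe u

namespace TraceAlg

variable {n : ℕ} {P : Type u} [CommRing P] [Algebra ℝ P] (D : TraceAlg n P)

/-- Elements of the center as scalar matrices in the carrier. -/
def scal (c : D.center) : D.carrier := ⟨(c : P) • 1, D.scalar_mem _ c.2⟩

theorem tr_scal_mul (c : D.center) (h : D.carrier) : D.tr (D.scal c * h) = c * D.tr h := by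
  refine Subtype.ext ?_
  change (((c : P) • (1 : Matrix (Fin n) (Fin n) P)) * h.1).trace = c.1 * h.1.trace
  rw [smul_mul_assoc, one_mul, Matrix.trace_smul, smul_eq_mul]

theorem tr_add (h k : D.carrier) : D.tr (h + k) = D.tr h + D.tr k :=
  Subtype.ext (show (h.1 + k.1).trace = h.1.trace + k.1.trace from Matrix.trace_add _ _)

theorem tr_one : D.tr 1 = n := by
  refine Subtype.ext ?_
  change (1 : Matrix (Fin n) (Fin n) P).trace = _
  simp

theorem exists_sum_single {K M : Type*} [CommRing K] (a : MonoidAlgebra K M) :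
    ∃ (m : ℕ) (h : Fin m → M) (r : Fin m → K), a = ∑ i, MonoidAlgebra.single (h i) (r i) := by
  induction a using MonoidAlgebra.induction_linear with
  | zero => exact ⟨0, Fin.elim0, Fin.elim0, by simp⟩
  | add x y hx hy =>
    obtain ⟨m, h, r, rfl⟩ := hx
    obtain ⟨m', h', r', rfl⟩ := hy
    exact ⟨m + m', Fin.append h h', Fin.append r r', by simp [Fin.sum_univ_add]⟩
  | single h r => exact ⟨1, fun _ => h, fun _ => r, by simp⟩

theorem tr_congr_sum {m : ℕ} (x : Fin m → D.center) (h : Fin m → D.carrier) (q : D.carrier) :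
    D.tr ((∑ i, D.scal (x i) * h i) * q * D.transp (∑ i, D.scal (x i) * h i)) =
      ∑ i, ∑ j, x i * x j * D.tr (h i * q * D.transp (h j)) := by
  refine Subtype.ext ?_
  have h1 : ((∑ i, D.scal (x i) * h i : D.carrier) : Matrix (Fin n) (Fin n) P) =
      ∑ i, (x i : P) • (h i : Matrix (Fin n) (Fin n) P) := by
    rw [AddSubmonoidClass.coe_finsetSum]
    refine Finset.sum_congr rfl fun i _ => ?_
    change ((x i : P) • (1 : Matrix (Fin n) (Fin n) P)) * (h i).1 = _
    rw [smul_mul_assoc, one_mul]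
  change ((∑ i, D.scal (x i) * h i : D.carrier).1 * q.1 *
    (∑ i, D.scal (x i) * h i : D.carrier).1ᵀ).trace = _
  rw [h1, AddSubmonoidClass.coe_finsetSum, Matrix.transpose_sum, Finset.sum_mul,
    Finset.sum_mul, Matrix.trace_sum]
  refine Finset.sum_congr rfl fun i _ => ?_
  rw [AddSubmonoidClass.coe_finsetSum, Finset.mul_sum, Matrix.trace_sum]
  refine Finset.sum_congr rfl fun j _ => ?_
  change _ = (x i : P) * (x j : P) * ((h i).1 * q.1 * (h j).1ᵀ).trace
  simp only [Matrix.transpose_smul, smul_mul_assoc, mul_smul_comm, Matrix.trace_smul,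
    smul_eq_mul]
  ring

variable {R : Type u} [Field R] [LinearOrder R] [IsStrictOrderedRing R] [Algebra ℝ R]

theorem trace_conj_nonneg {φ : D.center →ₐ[ℝ] R} {q : D.carrier} (hq : D.transp q = q)
    (hpos : ∀ h, 0 ≤ φ (D.tr (h * q * D.transp h))) (a : MonoidAlgebra R D.carrier) :
    0 ≤ D.trace φ (a * MonoidAlgebra.single q 1 * D.adj R a) := by
  obtain ⟨m, h, r, rfl⟩ := exists_sum_single a
  have h1 := gram_nonneg φ.toRingHom (fun i j => D.tr (h i * q * D.transp (h j)))
    (fun i j => by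
      rw [← tr_transp, transp_mul, transp_mul, transp_transp, hq, mul_assoc])
    (fun x => by
      rw [← tr_congr_sum]
      exact hpos _) r
  convert h1 using 1
  rw [map_sum, Finset.sum_mul, Finset.sum_mul, map_sum]
  refine Finset.sum_congr rfl fun i _ => ?_
  rw [Finset.mul_sum, map_sum]
  refine Finset.sum_congr rfl fun j _ => ?_
  rw [adj_single, MonoidAlgebra.single_mul_single, MonoidAlgebra.single_mul_single, trace_single,
    mul_one]
  rfl

theorem exists_representation [IsDomain P] [IsMaxOrdered R] (φ : D.center →ₐ[ℝ] R)
    {Q : Set D.carrier} (hone : 1 ∈ Q) (hsym : ∀ q ∈ Q, D.transp q = q)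
    (hconj : ∀ h, ∀ q ∈ Q, h * q * D.transp h ∈ Q) (hpos : ∀ q ∈ Q, 0 ≤ φ (D.tr q)) :
    ∃ π : D.carrier →+* Matrix (Fin n) (Fin n) R,
      (∀ h, π (D.transp h) = (π h)ᵀ) ∧ (∀ h, (π h).trace = φ (D.tr h)) ∧
      (∀ c, π (D.scal c) = φ c • 1) ∧ ∀ q ∈ Q, ∃ L, π q = L * Lᵀ := by
  have hnn : ∀ q ∈ Q, ∀ a, 0 ≤ D.trace φ (a * MonoidAlgebra.single q 1 * D.adj R a) :=
    fun q hq => D.trace_conj_nonneg (hsym q hq) fun h => hpos _ (hconj h q hq)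
  obtain ⟨B, _, _, _, σ, p, hB, hp, hσ, hstar, hpe⟩ :=
    exists_isTraceForm_quotient (n := n) (D.trace_mul_comm φ) D.adj_mul D.adj_adj (D.trace_adj φ)
      (fun a => by
        have h1 := hnn 1 hone (D.adj R a)
        rwa [← MonoidAlgebra.one_def, mul_one, adj_adj] at h1)
      (fun b l hl => D.newt_one φ b hl) (fun J K hJ hK l hl => D.newt_half φ hJ hK hl)
  have hpe' : ∀ x y : MonoidAlgebra R D.carrier, (∀ k, D.trace φ (MonoidAlgebra.single k 1 * x) =
      D.trace φ (MonoidAlgebra.single k 1 * y)) → p x = p y := by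
    intro x y hxy
    refine hpe _ _ fun c => ?_
    induction c using MonoidAlgebra.induction_linear with
    | zero => simp
    | add a b ha hb => rw [add_mul, add_mul, map_add, map_add, ha, hb]
    | single k r =>
      have h1 : MonoidAlgebra.single k r = r • MonoidAlgebra.single k (1 : R) := by
        rw [MonoidAlgebra.smul_single, smul_eq_mul, mul_one]
      rw [h1, smul_mul_assoc, smul_mul_assoc, map_smul, map_smul, hxy]
  let ρ : D.carrier →+* B :=
    { toFun := fun h => p (MonoidAlgebra.single h 1)
      map_one' := map_one p
      map_mul' := fun h k => by
        rw [← map_mul, MonoidAlgebra.single_mul_single, one_mul]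
      map_zero' := by
        rw [← map_zero p]
        refine hpe' _ _ fun k => ?_
        rw [MonoidAlgebra.single_mul_single, trace_single, mul_zero, mul_zero, map_zero]
        have h1 : D.tr 0 = 0 :=
          Subtype.ext (show (0 : Matrix (Fin n) (Fin n) P).trace = 0 from Matrix.trace_zero _ _)
        rw [h1, map_zero, mul_zero]
      map_add' := fun h k => by
        rw [← map_add]
        refine hpe' _ _ fun g => ?_
        rw [mul_add, map_add]
        simp only [MonoidAlgebra.single_mul_single, trace_single, mul_add, tr_add, map_add] }
  have hρ : ∀ h, ρ h = p (MonoidAlgebra.single h 1) := fun _ => rfl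
  have hσ1 : σ 1 = n := by
    rw [← map_one p, hσ, MonoidAlgebra.one_def, trace_single, tr_one, map_natCast, one_mul]
  obtain ⟨Φ, hΦs, hΦt⟩ := hB.exists_repr hσ1
  refine ⟨Φ.toRingHom.comp ρ, fun h => ?_, fun h => ?_, fun c => ?_, fun q hq => ?_⟩
  · change Φ (ρ (D.transp h)) = (Φ (ρ h))ᵀ
    rw [← hΦs, hρ, hρ, hstar, adj_single]
  · change (Φ (ρ h)).trace = _
    rw [hΦt, hρ, hσ, trace_single, one_mul]
  · change Φ (ρ (D.scal c)) = _
    have h1 : ρ (D.scal c) = φ c • 1 := by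
      rw [← map_one p, ← map_smul, hρ]
      refine hpe' _ _ fun k => ?_
      rw [mul_smul_comm, mul_one, MonoidAlgebra.single_mul_single, map_smul, trace_single,
        trace_single, tr_mul_comm, tr_scal_mul, map_mul, smul_eq_mul]
      ring
    rw [h1, map_smul, map_one]
  · obtain ⟨l, hl⟩ := hB.exists_sqrt (a := ρ q)
      (by rw [hρ, hstar, adj_single, hsym q hq])
      (fun b => by
        obtain ⟨a, rfl⟩ := hp b
        rw [hstar, hρ, ← map_mul, ← map_mul, hσ]
        exact hnn q hq a)
    refine ⟨Φ l, ?_⟩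
    change Φ (ρ q) = _
    rw [hl, map_mul, hΦs]

end TraceAlg

end Representation

section TraceRing

variable {n g : ℕ}

/-- The polynomials whose scalar matrices lie in the trace ring. -/
def scalarCenter (n g : ℕ) : Subalgebra ℝ (PolyRing n g) where
  carrier := {p | p • (1 : MatP n g) ∈ traceRing n g}
  mul_mem' {a b} ha hb := by
    have h := (traceRing n g).mul_mem ha hb
    rwa [smul_mul_smul_comm, mul_one] at h
  add_mem' {a b} ha hb := by
    have h := (traceRing n g).add_mem ha hb
    rwa [← add_smul] at h
  algebraMap_mem' r := by
    have h := (traceRing n g).algebraMap_mem r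
    change algebraMap ℝ (PolyRing n g) r • (1 : MatP n g) ∈ traceRing n g
    rwa [algebraMap_smul, ← Algebra.algebraMap_eq_smul_one]

theorem transpose_mem_genSet {w : MatP n g} (hw : w ∈ genSet n g) : wᵀ ∈ genSet n g := by
  rcases hw with ⟨j, rfl⟩ | ⟨j, rfl⟩
  · exact Or.inr ⟨j, rfl⟩
  · exact Or.inl ⟨j, rfl⟩

theorem transpose_mem_traceRing {h : MatP n g} (hh : h ∈ traceRing n g) :
    hᵀ ∈ traceRing n g := by
  unfold traceRing at hh
  induction hh using Algebra.adjoin_induction with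
  | mem x hx =>
    refine Algebra.subset_adjoin ?_
    rcases hx with hx | ⟨w, hw, rfl⟩
    · exact Or.inl (transpose_mem_genSet hx)
    · exact Or.inr ⟨w, hw, by rw [Matrix.transpose_smul, Matrix.transpose_one]⟩
  | algebraMap r =>
    rw [Algebra.algebraMap_eq_smul_one, Matrix.transpose_smul, Matrix.transpose_one,
      ← Algebra.algebraMap_eq_smul_one]
    exact (traceRing n g).algebraMap_mem r
  | add x y _ _ hx hy => rw [Matrix.transpose_add]; exact add_mem hx hy
  | mul x y _ _ hx hy => rw [Matrix.transpose_mul]; exact mul_mem hy hx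

/-- Every element of the trace ring is a combination of words with coefficients in the
center. -/
theorem traceRing_le_span {h : MatP n g} (hh : h ∈ traceRing n g) :
    h ∈ Submodule.span (scalarCenter n g) (Submonoid.closure (genSet n g) : Set (MatP n g)) := by
  unfold traceRing at hh
  induction hh using Algebra.adjoin_induction with
  | mem x hx =>
    rcases hx with hx | ⟨w, hw, rfl⟩
    · exact Submodule.subset_span (Submonoid.subset_closure hx)
    · have hc : w.trace ∈ scalarCenter n g := Algebra.subset_adjoin (Or.inr ⟨w, hw, rfl⟩)
      exact Submodule.smul_mem _ (⟨w.trace, hc⟩ : scalarCenter n g)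
        (Submodule.subset_span (one_mem _))
  | algebraMap r =>
    have h1 : algebraMap ℝ (MatP n g) r = algebraMap ℝ (scalarCenter n g) r • (1 : MatP n g) := by
      rw [algebraMap_smul, Algebra.algebraMap_eq_smul_one]
    rw [h1]
    exact Submodule.smul_mem _ _ (Submodule.subset_span (one_mem _))
  | add x y _ _ hx hy => exact add_mem hx hy
  | mul x y _ _ hx hy =>
    have h1 := Submodule.mul_mem_mul hx hy
    rwa [Submodule.span_mul_span, Submonoid.coe_mul_self_eq] at h1

theorem trace_mem_scalarCenter {h : MatP n g} (hh : h ∈ traceRing n g) :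
    h.trace ∈ scalarCenter n g := by
  have h1 := traceRing_le_span hh
  clear hh
  induction h1 using Submodule.span_induction with
  | mem w hw => exact Algebra.subset_adjoin (Or.inr ⟨w, hw, rfl⟩)
  | zero => rw [Matrix.trace_zero]; exact zero_mem _
  | add x y _ _ hx hy => rw [Matrix.trace_add]; exact add_mem hx hy
  | smul c x _ hx =>
    change ((c : PolyRing n g) • x).trace ∈ _
    rw [Matrix.trace_smul]; exact mul_mem c.2 hx

/-- The trace ring with its center. -/
def traceAlg (n g : ℕ) : TraceAlg n (PolyRing n g) where
  carrier := traceRing n g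
  center := scalarCenter n g
  transpose_mem _ := transpose_mem_traceRing
  trace_mem _ := trace_mem_scalarCenter
  scalar_mem _ := id

theorem isCyclicPreordering_sym (n g : ℕ) :
    IsCyclicPreordering n g {q | q ∈ traceRing n g ∧ qᵀ = q} := by
  refine ⟨⟨fun q hq => hq, ⟨one_mem _, Matrix.transpose_one⟩, fun a ha b hb =>
    ⟨add_mem ha.1 hb.1, by rw [Matrix.transpose_add, ha.2, hb.2]⟩, fun h hh q hq =>
    ⟨mul_mem (mul_mem hh hq.1) (transpose_mem_traceRing hh), ?_⟩, fun q hq =>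
    ⟨trace_mem_scalarCenter hq.1, by rw [Matrix.transpose_smul, Matrix.transpose_one]⟩⟩, ?_⟩
  · rw [Matrix.transpose_mul, Matrix.transpose_mul, Matrix.transpose_transpose, hq.2, mul_assoc]
  · rintro a ⟨ha, _, p, rfl⟩ b ⟨hb, _, q, rfl⟩
    refine ⟨mul_mem ha.1 hb.1, ?_⟩
    rw [smul_mul_smul_comm, mul_one, Matrix.transpose_smul, Matrix.transpose_one]

theorem isCyclicPreordering_TtrS {S : Set (MatP n g)}
    (hS : ∀ s ∈ S, s ∈ traceRing n g ∧ sᵀ = s) : IsCyclicPreordering n g (TtrS n g S) := by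
  refine ⟨⟨fun q hq => hq _ (isCyclicPreordering_sym n g) hS, fun T hT _ => hT.1.2.1,
    fun a ha b hb T hT hST => hT.1.2.2.1 a (ha T hT hST) b (hb T hT hST),
    fun h hh q hq T hT hST => hT.1.2.2.2.1 h hh q (hq T hT hST),
    fun q hq T hT hST => hT.1.2.2.2.2 q (hq T hT hST)⟩,
    fun a ha b hb T hT hST => hT.2 a ⟨ha.1 T hT hST, ha.2⟩ b ⟨hb.1 T hT hST, hb.2⟩⟩

theorem evalMat_eq (X : Fin g → Matrix (Fin n) (Fin n) ℝ) (h : MatP n g) :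
    evalMat n g X h = (MvPolynomial.eval fun v => X v.1 v.2.1 v.2.2).mapMatrix h := rfl

theorem evalMat_smul_one (X : Fin g → Matrix (Fin n) (Fin n) ℝ) (p : PolyRing n g) :
    evalMat n g X (p • 1) =
      MvPolynomial.eval (fun v : Fin g × Fin n × Fin n => X v.1 v.2.1 v.2.2) p • 1 := by
  ext a b
  by_cases hab : a = b <;> simp [evalMat, hab]

theorem posSemidef_smul_one_iff (hn : 0 < n) (r : ℝ) :
    (r • (1 : Matrix (Fin n) (Fin n) ℝ)).PosSemidef ↔ 0 ≤ r := by
  refine ⟨fun h => ?_, fun h => Matrix.PosSemidef.one.smul h⟩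
  have := h.diag_nonneg (i := ⟨0, hn⟩)
  simpa using this

theorem isCyclicPreordering_eval (hn : 0 < n) (X : Fin g → Matrix (Fin n) (Fin n) ℝ) :
    IsCyclicPreordering n g
      {q | (q ∈ traceRing n g ∧ qᵀ = q) ∧ (evalMat n g X q).PosSemidef} := by
  have hsym := isCyclicPreordering_sym n g
  refine ⟨⟨fun q hq => hq.1, ⟨hsym.1.2.1, ?_⟩, fun a ha b hb =>
    ⟨hsym.1.2.2.1 a ha.1 b hb.1, ?_⟩, fun h hh q hq => ⟨hsym.1.2.2.2.1 h hh q hq.1, ?_⟩,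
    fun q hq => ⟨hsym.1.2.2.2.2 q hq.1, ?_⟩⟩, ?_⟩
  · rw [evalMat_eq, map_one]
    exact Matrix.PosSemidef.one
  · rw [evalMat_eq, map_add]
    exact ha.2.add hb.2
  · have h1 := hq.2.mul_mul_conjTranspose_same (evalMat n g X h)
    rw [Matrix.conjTranspose_eq_transpose_of_trivial] at h1
    rw [evalMat_eq, map_mul, map_mul]
    exact h1
  · rw [evalMat_smul_one, posSemidef_smul_one_iff hn]
    have h1 := hq.2.trace_nonneg
    have h2 := AddMonoidHom.map_trace
      (MvPolynomial.eval fun v : Fin g × Fin n × Fin n => X v.1 v.2.1 v.2.2).toAddMonoidHom q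
    exact h1.trans_eq h2.symm
  · rintro a ⟨ha, hac⟩ b ⟨hb, hbc⟩
    refine ⟨hsym.2 a ⟨ha.1, hac⟩ b ⟨hb.1, hbc⟩, ?_⟩
    obtain ⟨-, p, rfl⟩ := hac
    obtain ⟨-, q, rfl⟩ := hbc
    rw [smul_mul_smul_comm, mul_one, evalMat_smul_one, posSemidef_smul_one_iff hn, map_mul]
    have h1 := ha.2
    have h2 := hb.2
    rw [evalMat_smul_one, posSemidef_smul_one_iff hn] at h1 h2
    exact mul_nonneg h1 h2

theorem KSet_eq_empty_of_neg_one_mem (hn : 0 < n) {S : Set (MatP n g)}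
    (hS : ∀ s ∈ S, s ∈ traceRing n g ∧ sᵀ = s) (h : (-1 : MatP n g) ∈ TtrS n g S) :
    KSet n g S = ∅ := by
  refine Set.eq_empty_of_forall_notMem fun X hX => ?_
  have h1 := (h _ (isCyclicPreordering_eval hn X) fun s hs => ⟨hS s hs, hX s hs⟩).2
  rw [← neg_one_smul (PolyRing n g) (1 : MatP n g), evalMat_smul_one,
    posSemidef_smul_one_iff hn, map_neg, map_one] at h1
  linarith

end TraceRing

section Positivstellensatz

variable {n g : ℕ}

/-- If the elements of `S` become hermitian squares at a point over a real closed extension,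
then they are positive semidefinite at some real point. -/
theorem KSet_nonempty_of_sq {R : Type} [Field R] [LinearOrder R] [IsStrictOrderedRing R]
    [HasIVT R] [Algebra ℝ R] {S : Set (MatP n g)} (hSfin : S.Finite)
    (x : Fin g × Fin n × Fin n → R)
    (hx : ∀ s ∈ S, ∃ L : Matrix (Fin n) (Fin n) R, s.map (MvPolynomial.aeval x) = L * Lᵀ) :
    (KSet n g S).Nonempty := by
  have := hSfin.to_subtype
  choose! L hL using hx
  let σ := (Fin g × Fin n × Fin n) ⊕ (S × Fin n × Fin n)
  let e : S × Fin n × Fin n → MvPolynomial σ ℝ := fun v =>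
    MvPolynomial.rename Sum.inl (v.1.1 v.2.1 v.2.2) -
      ∑ c, MvPolynomial.X (Sum.inr (v.1, v.2.1, c)) * MvPolynomial.X (Sum.inr (v.1, v.2.2, c))
  obtain ⟨y, hy⟩ := exists_real_solution (Set.finite_range e)
    (Sum.elim x fun v => L v.1.1 v.2.1 v.2.2 : σ → R) (by
      rintro _ ⟨⟨s, a, b⟩, rfl⟩
      have h1 := congrFun (congrFun (hL s.1 s.2) a) b
      rw [Matrix.map_apply, Matrix.mul_apply] at h1
      simp only [e, map_sub, map_sum, map_mul, MvPolynomial.aeval_X, Sum.elim_inr,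
        MvPolynomial.aeval_rename]
      exact sub_eq_zero.2 h1)
  refine ⟨fun j => Matrix.of fun a b => y (Sum.inl (j, a, b)), fun s hs => ?_⟩
  let M : Matrix (Fin n) (Fin n) ℝ := Matrix.of fun a c => y (Sum.inr (⟨s, hs⟩, a, c))
  have h2 : evalMat n g (fun j => Matrix.of fun a b => y (Sum.inl (j, a, b))) s = M * Mᴴ := by
    ext a b
    have h1 := hy _ ⟨(⟨s, hs⟩, a, b), rfl⟩
    simp only [e, map_sub, map_sum, map_mul, MvPolynomial.aeval_X,
      MvPolynomial.aeval_rename, sub_eq_zero] at h1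
    rw [Matrix.mul_apply]
    exact h1
  rw [h2]
  exact Matrix.posSemidef_self_mul_conjTranspose M

theorem isPrecone_center {T : Set (MatP n g)} (hT : IsCyclicPreordering n g T)
    (h : (-1 : MatP n g) ∉ T) :
    IsPrecone {c : (traceAlg n g).center | (c : PolyRing n g) • (1 : MatP n g) ∈ T} where
  add a ha b hb := by
    have h1 := hT.1.2.2.1 _ ha _ hb
    rwa [← add_smul] at h1
  mul a ha b hb := by
    have h1 := hT.2 _ ⟨ha, a.2, a, rfl⟩ _ ⟨hb, b.2, b, rfl⟩
    rwa [smul_mul_smul_comm, mul_one] at h1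
  sq a := by
    have h1 := hT.1.2.2.2.1 _ a.2 1 hT.1.2.1
    rwa [mul_one, Matrix.transpose_smul, Matrix.transpose_one, smul_mul_smul_comm, mul_one] at h1
  neg_one h1 := h (by
    change (-1 : PolyRing n g) • (1 : MatP n g) ∈ T at h1
    rwa [neg_one_smul] at h1)

/-- A trace preserving representation of the trace ring is evaluation at the images of the
generic matrices. -/
theorem eq_map_aeval {R : Type} [Field R] [Algebra ℝ R] (φ : (traceAlg n g).center →ₐ[ℝ] R)
    (π : (traceAlg n g).carrier →+* Matrix (Fin n) (Fin n) R)
    (hπs : ∀ h, π ((traceAlg n g).transp h) = (π h)ᵀ)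
    (hπt : ∀ h, (π h).trace = φ ((traceAlg n g).tr h))
    (hπc : ∀ c, π ((traceAlg n g).scal c) = φ c • 1) :
    ∃ x : Fin g × Fin n × Fin n → R,
      ∀ h : (traceAlg n g).carrier, π h = (h : MatP n g).map (MvPolynomial.aeval x) := by
  have hgen : ∀ {w}, w ∈ genSet n g → w ∈ traceRing n g := fun hw =>
    Algebra.subset_adjoin (Or.inl hw)
  have hX : ∀ j, genMat n g j ∈ genSet n g := fun j => Or.inl ⟨j, rfl⟩
  let x : Fin g × Fin n × Fin n → R := fun v => π ⟨genMat n g v.1, hgen (hX v.1)⟩ v.2.1 v.2.2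
  let F : MatP n g →ₐ[ℝ] Matrix (Fin n) (Fin n) R := (MvPolynomial.aeval x).mapMatrix
  have hx : ∀ w (hw : w ∈ genSet n g), π ⟨w, hgen hw⟩ = F w := by
    have h0 : ∀ j, π ⟨genMat n g j, hgen (hX j)⟩ = F (genMat n g j) := by
      intro j
      ext a b
      change _ = MvPolynomial.aeval x (MvPolynomial.X (j, a, b))
      rw [MvPolynomial.aeval_X]
    rintro _ (⟨j, rfl⟩ | ⟨j, rfl⟩)
    · exact h0 j
    · have h1 := hπs ⟨genMat n g j, hgen (hX j)⟩
      rw [h0] at h1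
      exact h1
  have hcl : ∀ w ∈ Submonoid.closure (genSet n g), w ∈ traceRing n g := fun w hw =>
    (Submonoid.closure_le (S := (traceRing n g).toSubmonoid)).2 (fun _ => hgen) hw
  have hword : ∀ w (hw : w ∈ Submonoid.closure (genSet n g)), π ⟨w, hcl w hw⟩ = F w := by
    intro w hw
    induction hw using Submonoid.closure_induction with
    | mem w hw => exact hx w hw
    | one => rw [map_one F]; exact map_one π
    | mul a b ha hb iha ihb =>
      rw [map_mul F, ← iha, ← ihb, ← map_mul π]
      rfl
  have hall : ∀ h (hh : h ∈ traceRing n g), π ⟨h, hh⟩ = F h := by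
    intro h hh
    change h ∈ Algebra.adjoin ℝ _ at hh
    induction hh using Algebra.adjoin_induction with
    | mem w hw =>
      rcases hw with hw | ⟨w, hw, rfl⟩
      · exact hx w hw
      · have h1 := hπt ⟨w, hcl w hw⟩
        rw [hword w hw] at h1
        refine (hπc ((traceAlg n g).tr ⟨w, hcl w hw⟩)).trans ?_
        rw [← h1]
        have h2 := AddMonoidHom.map_trace (MvPolynomial.aeval x).toRingHom.toAddMonoidHom w
        ext a b
        have h3 : (F w).trace = MvPolynomial.aeval x w.trace := h2.symm
        rw [h3]
        change _ = MvPolynomial.aeval x ((w.trace • (1 : MatP n g)) a b)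
        by_cases hab : a = b <;> simp [hab]
    | algebraMap r =>
      refine (congrArg π (Subtype.ext ?_)).trans
        ((hπc (algebraMap ℝ (traceAlg n g).center r)).trans ?_)
      · change algebraMap ℝ (MatP n g) r = algebraMap ℝ (PolyRing n g) r • (1 : MatP n g)
        rw [algebraMap_smul, Algebra.algebraMap_eq_smul_one]
      · rw [φ.commutes, F.commutes, algebraMap_smul, Algebra.algebraMap_eq_smul_one]
    | add a b ha hb iha ihb =>
      rw [map_add F, ← iha, ← ihb, ← map_add π]
      rfl
    | mul a b ha hb iha ihb =>
      rw [map_mul F, ← iha, ← ihb, ← map_mul π]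
      rfl
  exact ⟨x, fun h => hall h.1 h.2⟩

theorem KSet_nonempty_of_neg_one_notMem {S : Set (MatP n g)} (hSfin : S.Finite)
    (hS : ∀ s ∈ S, s ∈ traceRing n g ∧ sᵀ = s) (h : (-1 : MatP n g) ∉ TtrS n g S) :
    (KSet n g S).Nonempty := by
  have hT := isCyclicPreordering_TtrS hS
  obtain ⟨R, _, _, _, _, φ, hφ⟩ := exists_isMaxOrdered (isPrecone_center hT h)
  let _ : Algebra ℝ R := (φ.comp (algebraMap ℝ (traceAlg n g).center)).toAlgebra
  let φ' : (traceAlg n g).center →ₐ[ℝ] R := { φ with commutes' := fun _ => rfl }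
  obtain ⟨π, hπs, hπt, hπc, hπq⟩ := (traceAlg n g).exists_representation φ'
    (Q := {q | (q : MatP n g) ∈ TtrS n g S}) hT.1.2.1
    (fun q hq => Subtype.ext (hT.1.1 _ hq).2)
    (fun h q hq => hT.1.2.2.2.1 _ h.2 _ hq)
    (fun q hq => hφ _ (hT.1.2.2.2.2 _ hq))
  obtain ⟨x, hx⟩ := eq_map_aeval φ' π hπs hπt hπc
  refine KSet_nonempty_of_sq hSfin x fun s hs => ?_
  obtain ⟨L, hL⟩ := hπq ⟨s, (hS s hs).1⟩ fun T _ hST => hST hs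
  exact ⟨L, (hx ⟨s, (hS s hs).1⟩).symm.trans hL⟩

end Positivstellensatz

end TracePos

/-- K_S = ∅ iff −1 ∈ T_S^tr. -/
theorem stmt11 (n g : ℕ) (hn : 0 < n) (hg : 0 < g)
    (S : Set (MatP n g)) (hSfin : S.Finite)
    (hS : ∀ s ∈ S, s ∈ traceRing n g ∧ sᵀ = s) :
    KSet n g S = ∅ ↔ (-1 : MatP n g) ∈ TtrS n g S := by
  refine ⟨fun h => ?_, TracePos.KSet_eq_empty_of_neg_one_mem hn hS⟩
  by_contra hne
  exact (TracePos.KSet_nonempty_of_neg_one_notMem hSfin hS hne).ne_empty h
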